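/- Let G be a 3-edge-connected reduced graph of order n that is not supereulerian. If n ≤ 17, then the maximum matching size of G satisfies α'(G) ≥ (n − 1)/2. -/

import Mathlib

open scoped Classical

/-- A finite loopless multigraph on vertex type `V`, given by a multiset of edges. -/
structure Multigraph (V : Type) where
  edges : Multiset (Sym2 V)
  loopless : ∀ e ∈ edges, ¬ e.IsDiag

namespace Multigraph

variable {V W : Type}

/-- The degree of a vertex with respect to a multiset of edges. -/
noncomputable def degIn (E : Multiset (Sym2 V)) (v : V) : ℕ :=
  Multiset.card (E.filter fun e => v ∈ e)

/-- The degree of a vertex in a multigraph. -/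
noncomputable def deg (G : Multigraph V) (v : V) : ℕ :=
  degIn G.edges v

/-- All endpoints of the edges in `E` lie in `S`. -/
def Within (S : Set V) (E : Multiset (Sym2 V)) : Prop :=
  ∀ e ∈ E, ∀ v ∈ e, v ∈ S

/-- The graph with vertex set `S` and edge multiset `E` is connected (and spans `S`). -/
def ConnOn (S : Set V) (E : Multiset (Sym2 V)) : Prop :=
  S.Nonempty ∧ Within S E ∧
    ∀ u ∈ S, ∀ v ∈ S, Relation.ReflTransGen (fun a b => s(a, b) ∈ E) u v

/-- The graph with vertex set `S` and edge multiset `E` is collapsible: for every even subset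
`R` of `S` there is a spanning connected subgraph whose set of odd-degree vertices is `R`. -/
def CollapsiblePair (S : Set V) (E : Multiset (Sym2 V)) : Prop :=
  S.Nonempty ∧ Within S E ∧
    ∀ R : Set V, R ⊆ S → R.Finite → Even R.ncard →
      ∃ E' ≤ E, ConnOn S E' ∧ ∀ x ∈ S, (Odd (degIn E' x) ↔ x ∈ R)

/-- `(S, E)` is a subgraph of `G`. -/
def IsSubpair (G : Multigraph V) (S : Set V) (E : Multiset (Sym2 V)) : Prop :=
  E ≤ G.edges ∧ Within S E

/-- A multigraph is reduced if it has no collapsible subgraph with more than one vertex. -/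
def Reduced (G : Multigraph V) : Prop :=
  ∀ S E, G.IsSubpair S E → CollapsiblePair S E → S.ncard ≤ 1

/-- `(S, E)` is a maximal collapsible subgraph of `G`. -/
def MaxCollapsibleSub (G : Multigraph V) (S : Set V) (E : Multiset (Sym2 V)) : Prop :=
  G.IsSubpair S E ∧ CollapsiblePair S E ∧
    ∀ S' E', G.IsSubpair S' E' → CollapsiblePair S' E' → S ⊆ S' → E ≤ E' → S' = S ∧ E' = E

/-- `(S, E)` is a nontrivial maximal collapsible subgraph of `G`. -/
def NontrivMaxCollapsible (G : Multigraph V) (S : Set V) (E : Multiset (Sym2 V)) : Prop :=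
  G.MaxCollapsibleSub S E ∧ 1 < S.ncard

/-- The multiset of edges of `G` with both ends in `S`. -/
noncomputable def inducedEdges (G : Multigraph V) (S : Set V) : Multiset (Sym2 V) :=
  G.edges.filter fun e => ∀ v ∈ e, v ∈ S

/-- `S` is the vertex set of a maximal collapsible subgraph of `G`. -/
def IsMaxCollapsibleSet (G : Multigraph V) (S : Set V) : Prop :=
  CollapsiblePair S (G.inducedEdges S) ∧
    ∀ T : Set V, S ⊆ T → CollapsiblePair T (G.inducedEdges T) → T = S

/-- `G'` (on vertex type `W`) is the reduction of `G`, witnessed by the contraction map `f`: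
the fibres of `f` are exactly the (vertex sets of the) maximal collapsible subgraphs of `G`,
and the edges of `G'` are obtained by contracting each fibre to a point and deleting the
resulting loops. -/
def IsReduction (G : Multigraph V) (f : V → W) (G' : Multigraph W) : Prop :=
  Function.Surjective f ∧ (∀ w : W, G.IsMaxCollapsibleSet (f ⁻¹' {w})) ∧
    G'.edges = (G.edges.map (Sym2.map f)).filter fun e => ¬ e.IsDiag

/-- A multigraph is supereulerian if it has a spanning connected subgraph in which every
vertex has even degree. -/
def Supereulerian (G : Multigraph V) : Prop :=
  ∃ E' ≤ G.edges, ConnOn Set.univ E' ∧ ∀ x : V, Even (degIn E' x)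

/-- A multigraph is connected. -/
def Connected (G : Multigraph V) : Prop :=
  ConnOn Set.univ G.edges

/-- A multigraph is 3-edge-connected (edge connectivity at least 3): removing any at most two
edges leaves a spanning connected graph. -/
def ThreeEdgeConnected (G : Multigraph V) : Prop :=
  ∀ F : Multiset (Sym2 V), F ≤ G.edges → Multiset.card F ≤ 2 →
    ConnOn Set.univ (G.edges - F)

/-- A spanning tree: spanning connected with `|V| - 1` edges. -/
def IsSpanningTree [Fintype V] (E : Multiset (Sym2 V)) : Prop :=
  ConnOn Set.univ E ∧ Multiset.card E = Fintype.card V - 1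

/-- The edge multiset `E` contains two edge-disjoint spanning trees. -/
def HasTwoDisjointSpanningTrees [Fintype V] (E : Multiset (Sym2 V)) : Prop :=
  ∃ T₁ T₂ : Multiset (Sym2 V), T₁ + T₂ ≤ E ∧ IsSpanningTree T₁ ∧ IsSpanningTree T₂

/-- `F(G)`: the minimum number of extra (loopless) edges whose addition to `G` produces a
spanning supergraph having two edge-disjoint spanning trees. -/
noncomputable def FVal [Fintype V] (G : Multigraph V) : ℕ :=
  sInf {k : ℕ | ∃ Eadd : Multiset (Sym2 V), (∀ e ∈ Eadd, ¬ e.IsDiag) ∧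
    Multiset.card Eadd = k ∧ HasTwoDisjointSpanningTrees (G.edges + Eadd)}

/-- `σ̄₂(G)`: the minimum of `deg u + deg v` over edges `uv` of `G`. -/
noncomputable def sigma2bar (G : Multigraph V) : ℕ :=
  sInf {k : ℕ | ∃ u v : V, s(u, v) ∈ G.edges ∧ G.deg u + G.deg v = k}

/-- `G` contains a cycle of length four. -/
def HasFourCycle (G : Multigraph V) : Prop :=
  ∃ a b c d : V, a ≠ b ∧ a ≠ c ∧ a ≠ d ∧ b ≠ c ∧ b ≠ d ∧ c ≠ d ∧
    s(a, b) ∈ G.edges ∧ s(b, c) ∈ G.edges ∧ s(c, d) ∈ G.edges ∧ s(d, a) ∈ G.edges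

/-- `M` is a matching: distinct edges share no endpoint. -/
def IsMatching (M : Multiset (Sym2 V)) : Prop :=
  M.Nodup ∧ ∀ e ∈ M, ∀ f ∈ M, e ≠ f → ∀ x : V, x ∈ e → x ∉ f

/-- `{X, Y}` is a bipartition (of the full vertex set) for the edge multiset `E`:
every edge has one end in `X` and one end in `Y`. -/
def IsBipartition [Fintype V] (X Y : Finset V) (E : Multiset (Sym2 V)) : Prop :=
  Disjoint X Y ∧ X ∪ Y = Finset.univ ∧
    ∀ e ∈ E, (∃ a ∈ e, a ∈ X) ∧ (∃ b ∈ e, b ∈ Y)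

/-- The edge multiset of Catlin's π-reduction `G/π` obtained from the induced four-cycle
`u v z w`: remove the four cycle edges, identify `z` with `u` (forming `x = u`) and `w` with
`v` (forming `y = v`), and add the new edge `e_π = xy = s(u, v)`. -/
noncomputable def piEdges (G : Multigraph V) (u v z w : V) : Multiset (Sym2 V) :=
  ((G.edges - {s(u, v), s(v, z), s(z, w), s(w, u)}).map
      (Sym2.map fun a => if a = z then u else if a = w then v else a)) + {s(u, v)}

/-- `(S, E)` is the multigraph `Φ(c, t)`: a star `K_{1,t}` with centre `c` in which every
edge is doubled. -/
def IsPhi (S : Set V) (E : Multiset (Sym2 V)) (c : V) (t : ℕ) : Prop :=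
  ∃ A : Finset V, c ∉ A ∧ A.card = t ∧ S = insert c (↑A : Set V) ∧
    E = A.val.map (fun a => s(c, a)) + A.val.map (fun a => s(c, a))

/-- The multigraph associated with a simple graph. -/
noncomputable def ofSimple [Fintype V] (G : SimpleGraph V) : Multigraph V where
  edges := G.edgeSet.toFinset.val
  loopless := by
    intro e he
    have he' : e ∈ G.edgeSet := by simpa using he
    exact G.not_isDiag_of_mem_edgeSet he'

/-- Isomorphism of multigraphs. -/
def MIso {A B : Type} (G : Multigraph A) (H : Multigraph B) : Prop :=
  ∃ φ : A ≃ B, H.edges = G.edges.map (Sym2.map φ)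

end Multigraph

/-- Vertices of the Petersen graph: the 2-element subsets of a 5-element set. -/
abbrev PetersenVert : Type := {s : Finset (Fin 5) // s.card = 2}

/-- The Petersen graph (as the Kneser graph on 2-subsets of a 5-set). -/
def petersenSimple : SimpleGraph PetersenVert :=
  SimpleGraph.fromRel fun a b => Disjoint a.1 b.1

noncomputable def petersen : Multigraph PetersenVert :=
  Multigraph.ofSimple petersenSimple

/-- The graph `P₁₄`: obtained from the Petersen graph (outer cycle `0 1 2 3 4`, spokes
`i — i+5`, inner cycle `5 7 9 6 8 5`) by replacing the vertex `9` (whose neighbours were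
`4`, `7`, `6`) by a copy of `K_{2,3}` with degree-three vertices `9`, `10` and degree-two
vertices `11`, `12`, `13`, joined to `4`, `7`, `6` respectively. -/
def p14Simple : SimpleGraph (Fin 14) :=
  SimpleGraph.fromRel fun a b =>
    (a, b) ∈ ([(0, 1), (1, 2), (2, 3), (3, 4), (4, 0), (0, 5), (1, 6), (2, 7), (3, 8),
      (5, 7), (6, 8), (8, 5), (9, 11), (9, 12), (9, 13), (10, 11), (10, 12), (10, 13),
      (11, 4), (12, 7), (13, 6)] : List (Fin 14 × Fin 14))

noncomputable def p14 : Multigraph (Fin 14) :=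
  Multigraph.ofSimple p14Simple


set_option linter.unusedSectionVars false
set_option linter.unusedSimpArgs false
set_option linter.unusedVariables false


namespace Cat

variable {V ι : Type} [Fintype V] [Fintype ι]

/-- Boundary (parity vector) of an edge set. -/
noncomputable def bd (p q : ι → V) (X : Finset ι) (x : V) : ZMod 2 :=
  ∑ i ∈ X, ((if p i = x then 1 else 0) + (if q i = x then 1 else 0))

/-- `A` is a union of components of `X`. -/
def Cl (p q : ι → V) (X : Finset ι) (A : Set V) : Prop := ∀ i ∈ X, (p i ∈ A ↔ q i ∈ A)

/-- `X` connects the vertices of `W`. -/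
def Cn (p q : ι → V) (W : Finset V) (X : Finset ι) : Prop :=
  ∀ A : Set V, Cl p q X A → ∀ x ∈ W, ∀ y ∈ W, x ∈ A → y ∈ A

/-- Edges inside `W`. -/
noncomputable def Ins (p q : ι → V) (W : Finset V) : Finset ι :=
  Finset.univ.filter fun i => p i ∈ W ∧ q i ∈ W

/-- `W` induces a collapsible subgraph. -/
def Coll (p q : ι → V) (W : Finset V) : Prop :=
  ∀ R : V → ZMod 2, (∀ x, x ∉ W → R x = 0) → ∑ x, R x = 0 →
    ∃ X ⊆ Ins p q W, bd p q X = R ∧ Cn p q W X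

/-- The graph on `U` is reduced. -/
def Red (p q : ι → V) (U : Finset V) : Prop := ∀ W ⊆ U, Coll p q W → W.card ≤ 1

/-- Edge `i` joins `a` and `b`. -/
def E (p q : ι → V) (i : ι) (a b : V) : Prop := (p i = a ∧ q i = b) ∨ (p i = b ∧ q i = a)

def Adj (p q : ι → V) (a b : V) : Prop := a ≠ b ∧ ∃ i, E p q i a b

lemma z2 (a : ZMod 2) : a + a = 0 := CharTwo.add_self_eq_zero a

lemma z2c (a : ZMod 2) : a = 0 ∨ a = 1 := by revert a; decide

lemma mem_Ins {p q : ι → V} {W : Finset V} {i : ι} : i ∈ Ins p q W ↔ p i ∈ W ∧ q i ∈ W := by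
  simp [Ins]

lemma bd_union (p q : ι → V) {X Y : Finset ι} (h : Disjoint X Y) (x : V) :
    bd p q (X ∪ Y) x = bd p q X x + bd p q Y x := by
  unfold bd; rw [Finset.sum_union h]

lemma bd_not_mem (p q : ι → V) {X : Finset ι} {W : Finset V} (h : X ⊆ Ins p q W) {x : V}
    (hx : x ∉ W) : bd p q X x = 0 := by
  unfold bd
  apply Finset.sum_eq_zero
  intro i hi
  have := mem_Ins.1 (h hi)
  rw [if_neg, if_neg]; simp
  · rintro rfl; exact hx this.2
  · rintro rfl; exact hx this.1

lemma sum_bd (p q : ι → V) (X : Finset ι) : ∑ x, bd p q X x = 0 := by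
  unfold bd
  rw [Finset.sum_comm]
  apply Finset.sum_eq_zero
  intro i _
  rw [Finset.sum_add_distrib]
  simp [z2]

/-- Pushforward of the boundary. -/
lemma bd_push (p q : ι → V) (g : V → V) (X : Finset ι) (y : V) :
    bd (g ∘ p) (g ∘ q) X y = ∑ x with g x = y, bd p q X x := by
  unfold bd
  rw [Finset.sum_comm]
  apply Finset.sum_congr rfl
  intro i _
  rw [Finset.sum_add_distrib]
  congr 1 <;> simp [Finset.sum_ite_eq]

lemma coll_singleton (p q : ι → V) (a : V) : Coll p q {a} := by
  intro R hR hs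
  refine ⟨∅, by simp, ?_, ?_⟩
  · have : R a = 0 := by
      rw [← hs]; symm
      apply Finset.sum_eq_single
      · intro b _ hb; exact hR b (by simpa using hb)
      · simp
    funext x
    by_cases hx : x = a
    · subst hx; simp [bd, this]
    · rw [hR x (by simpa using hx)]; simp [bd]
  · intro A _ x hx y hy h
    simp at hx hy; subst hx; subst hy; exact h

lemma lift_coll (p q : ι → V) (g : V → V) (W' : Finset V)
    (hf : ∀ y ∈ W', Coll p q (Finset.univ.filter fun x => g x = y))
    (hc : Coll (g ∘ p) (g ∘ q) W') :
    Coll p q (Finset.univ.filter fun x => g x ∈ W') := by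
  intro R hR hs
  obtain ⟨X', hX', hb, hcn⟩ := hc (fun y => ∑ x with g x = y, R x) (by
      intro y hy
      apply Finset.sum_eq_zero
      intro x hx
      apply hR
      simp at hx ⊢
      rw [hx]; exact hy) (by
      rw [← hs]; exact Finset.sum_fiberwise _ _ _)
  set X0 := X'.filter (fun i => g (p i) ≠ g (q i)) with hX0
  have hb0 : ∀ y, bd (g ∘ p) (g ∘ q) X0 y = bd (g ∘ p) (g ∘ q) X' y := by
    intro y
    unfold bd
    rw [hX0, Finset.sum_filter]
    apply Finset.sum_congr rfl
    intro i _
    by_cases h : g (p i) = g (q i)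
    · simp [h, z2]
    · simp [h]
  have key : ∀ y, ∃ Xy : Finset ι, y ∈ W' →
      Xy ⊆ Ins p q (Finset.univ.filter fun x => g x = y) ∧
      bd p q Xy = (fun x => if g x = y then R x + bd p q X0 x else 0) ∧
      Cn p q (Finset.univ.filter fun x => g x = y) Xy := by
    intro y
    by_cases hy : y ∈ W'
    · obtain ⟨Xy, h1, h2, h3⟩ := hf y hy (fun x => if g x = y then R x + bd p q X0 x else 0)
        (by intro x hx; simp at hx; simp [hx]) (by
          rw [← Finset.sum_filter, Finset.sum_add_distrib, ← bd_push, hb0, hb]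
          exact z2 _)
      exact ⟨Xy, fun _ => ⟨h1, h2, h3⟩⟩
    · exact ⟨∅, fun h => absurd h hy⟩
  choose Y hY using key
  have hX0W : ∀ i ∈ X0, g (p i) ∈ W' ∧ g (q i) ∈ W' := by
    intro i hi
    have := mem_Ins.1 (hX' (Finset.mem_filter.1 hi).1)
    simpa using this
  have hYm : ∀ y ∈ W', ∀ i ∈ Y y, g (p i) = y ∧ g (q i) = y := by
    intro y hy i hi
    have := mem_Ins.1 ((hY y hy).1 hi)
    simpa using this
  refine ⟨X0 ∪ W'.biUnion Y, ?_, ?_, ?_⟩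
  · intro i hi
    rw [mem_Ins]
    simp only [Finset.mem_filter, Finset.mem_univ, true_and]
    rcases Finset.mem_union.1 hi with h | h
    · exact hX0W i h
    · obtain ⟨y, hy, hiy⟩ := Finset.mem_biUnion.1 h
      have := hYm y hy i hiy
      rw [this.1, this.2]; exact ⟨hy, hy⟩
  · funext x
    rw [bd_union]
    · have : bd p q (W'.biUnion Y) x = ∑ y ∈ W', bd p q (Y y) x := by
        unfold bd
        rw [Finset.sum_biUnion]
        intro y hy y' hy' hne
        rw [Function.onFun, Finset.disjoint_left]
        intro i hi hi'
        exact hne ((hYm y hy i hi).1.symm.trans (hYm y' hy' i hi').1)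
      rw [this]
      have h2 : ∑ y ∈ W', bd p q (Y y) x = ∑ y ∈ W', if g x = y then R x + bd p q X0 x else 0 := by
        apply Finset.sum_congr rfl
        intro y hy
        rw [(hY y hy).2.1]
      rw [h2, Finset.sum_ite_eq]
      by_cases hx : g x ∈ W'
      · rw [if_pos hx, add_comm (R x), ← add_assoc, z2, zero_add]
      · rw [if_neg hx, hR x (by simpa using hx), add_zero]
        apply bd_not_mem p q (W := Finset.univ.filter fun x => g x ∈ W') _ (by simpa using hx)
        intro i hi
        rw [mem_Ins]; simpa using hX0W i hi
    · rw [Finset.disjoint_left]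
      intro i hi hi'
      obtain ⟨y, hy, hiy⟩ := Finset.mem_biUnion.1 hi'
      have h1 := hYm y hy i hiy
      exact (Finset.mem_filter.1 hi).2 (h1.1.trans h1.2.symm)
  · intro A hA x hx y hy hxA
    have hfib : ∀ a b, g a ∈ W' → g a = g b → a ∈ A → b ∈ A := by
      intro a b ha hab haA
      refine (hY (g a) ha).2.2 A ?_ a (by simp) b (by simp [hab]) haA
      intro i hi
      exact hA i (Finset.mem_union_right _ (Finset.mem_biUnion.2 ⟨_, ha, hi⟩))
    simp only [Finset.mem_filter, Finset.mem_univ, true_and] at hx hy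
    have := hcn {b | ∃ a ∈ A, g a = b} (by
      intro i hi
      by_cases hl : g (p i) = g (q i)
      · simp [hl]
      · have hi0 : i ∈ X0 := Finset.mem_filter.2 ⟨hi, hl⟩
        have hw := hX0W i hi0
        have hpq := hA i (Finset.mem_union_left _ hi0)
        constructor
        · rintro ⟨a, ha, hga⟩
          refine ⟨q i, hpq.1 (hfib a _ ?_ hga ha), rfl⟩
          rw [hga]; exact hw.1
        · rintro ⟨a, ha, hga⟩
          refine ⟨p i, hpq.2 (hfib a _ ?_ hga ha), rfl⟩
          rw [hga]; exact hw.2) (g x) hx (g y) hy ⟨x, hxA, rfl⟩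
    obtain ⟨a, ha, hga⟩ := this
    exact hfib a y (by rw [hga]; exact hy) hga ha

end Cat

namespace Cat
variable {V ι : Type} [Fintype V] [Fintype ι]

lemma bd_empty (p q : ι → V) (x : V) : bd p q ∅ x = 0 := by simp [bd]

lemma bd_insert {p q : ι → V} {c : ι} {a b : V} (h : E p q c a b) {X : Finset ι} (hc : c ∉ X)
    (x : V) : bd p q (insert c X) x =
      ((if a = x then 1 else 0) + (if b = x then 1 else 0)) + bd p q X x := by
  unfold bd
  rw [Finset.sum_insert hc]
  rcases h with ⟨h1, h2⟩ | ⟨h1, h2⟩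
  · rw [h1, h2]
  · rw [h1, h2]; congr 1; exact add_comm _ _

lemma bd_single {p q : ι → V} {c : ι} {a b : V} (h : E p q c a b)
    (x : V) : bd p q {c} x =
      ((if a = x then 1 else 0) + (if b = x then 1 else 0)) := by
  have := bd_insert h (Finset.notMem_empty c) x
  simpa [bd_empty] using this

lemma Cl_E {p q : ι → V} {X : Finset ι} {A : Set V} (hA : Cl p q X A) {c : ι} (hc : c ∈ X)
    {a b : V} (h : E p q c a b) : a ∈ A ↔ b ∈ A := by
  have := hA c hc
  rcases h with ⟨h1, h2⟩ | ⟨h1, h2⟩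
  · rwa [h1, h2] at this
  · rw [h1, h2] at this; exact this.symm

lemma E_symm {p q : ι → V} {i : ι} {a b : V} (h : E p q i a b) : E p q i b a := by
  rcases h with h | h
  · exact Or.inr h
  · exact Or.inl h

lemma E_ins {p q : ι → V} {i : ι} {a b : V} (h : E p q i a b) {W : Finset V} (ha : a ∈ W)
    (hb : b ∈ W) : i ∈ Ins p q W := by
  rw [mem_Ins]
  rcases h with ⟨h1, h2⟩ | ⟨h1, h2⟩ <;> rw [h1, h2] <;> exact ⟨by assumption, by assumption⟩

lemma E_eq {p q : ι → V} {i : ι} {a b c d : V} (h : E p q i a b) (h' : E p q i c d) :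
    (a = c ∧ b = d) ∨ (a = d ∧ b = c) := by
  rcases h with ⟨h1, h2⟩ | ⟨h1, h2⟩ <;> rcases h' with ⟨h3, h4⟩ | ⟨h3, h4⟩ <;> grind

lemma Adj_symm {p q : ι → V} {a b : V} (h : Adj p q a b) : Adj p q b a :=
  ⟨h.1.symm, h.2.imp fun _ h => E_symm h⟩

lemma coll_par {p q : ι → V} {i j : ι} {a b : V} (hab : a ≠ b) (hij : i ≠ j)
    (hi : E p q i a b) (hj : E p q j a b) : Coll p q {a, b} := by
  intro R hR hs
  have hsum : R a + R b = 0 := by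
    rw [← hs, ← Finset.sum_pair hab]
    apply Finset.sum_subset (Finset.subset_univ _)
    intro x _ hx; exact hR x hx
  have hi' : i ∈ Ins p q {a, b} := E_ins hi (by simp) (by simp)
  have hj' : j ∈ Ins p q {a, b} := E_ins hj (by simp) (by simp)
  have hcn : ∀ X : Finset ι, i ∈ X → Cn p q {a, b} X := by
    intro X hX A hA x hx y hy hxA
    have := Cl_E hA hX hi
    simp at hx hy
    rcases hx with rfl | rfl <;> rcases hy with rfl | rfl <;> tauto
  rcases z2c (R a) with h0 | h0
  · refine ⟨{i, j}, ?_, ?_, hcn _ (by simp)⟩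
    · intro k hk; simp at hk; rcases hk with rfl | rfl <;> assumption
    · funext x
      rw [bd_insert hi (by simpa using hij), bd_single hj, z2]
      by_cases hx : x = a
      · rw [hx, h0]
      · by_cases hx' : x = b
        · rw [hx']; rw [h0, zero_add] at hsum; rw [hsum]
        · rw [hR x (by simp [hx, hx'])]
  · refine ⟨{i}, by simpa using hi', ?_, hcn _ (by simp)⟩
    have hb : R b = 1 := by
      rcases z2c (R b) with h | h
      · rw [h0, h] at hsum; exact absurd hsum (by decide)
      · exact h
    funext x
    rw [bd_single hi]
    by_cases hx : x = a
    · rw [hx, h0]; simp [hab.symm]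
    · by_cases hx' : x = b
      · rw [hx', hb]; simp [hab]
      · rw [hR x (by simp [hx, hx'])]; simp [Ne.symm hx, Ne.symm hx']

lemma coll_triangle {p q : ι → V} {i j k : ι} {a b c : V} (hab : a ≠ b) (hbc : b ≠ c) (hac : a ≠ c)
    (hi : E p q i a b) (hj : E p q j b c) (hk : E p q k c a) : Coll p q {a, b, c} := by
  intro R hR hs
  have hsum : R a + (R b + R c) = 0 := by
    rw [← hs, ← Finset.sum_pair hbc, ← Finset.sum_insert (by simp [hab, hac])]
    apply Finset.sum_subset (Finset.subset_univ _)
    intro x _ hx; exact hR x hx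
  have hij : i ≠ j := by rintro rfl; rcases E_eq hi hj with h | h <;> grind
  have hjk : j ≠ k := by rintro rfl; rcases E_eq hj hk with h | h <;> grind
  have hik : i ≠ k := by rintro rfl; rcases E_eq hi hk with h | h <;> grind
  have hi' : i ∈ Ins p q {a, b, c} := E_ins hi (by simp) (by simp)
  have hj' : j ∈ Ins p q {a, b, c} := E_ins hj (by simp) (by simp)
  have hk' : k ∈ Ins p q {a, b, c} := E_ins hk (by simp) (by simp)
  have hcn : ∀ X : Finset ι, (i ∈ X ∧ j ∈ X) ∨ (j ∈ X ∧ k ∈ X) ∨ (i ∈ X ∧ k ∈ X) →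
      Cn p q {a, b, c} X := by
    intro X hX A hA x hx y hy hxA
    have : (a ∈ A ↔ b ∈ A) ∧ (b ∈ A ↔ c ∈ A) := by
      rcases hX with ⟨h1, h2⟩ | ⟨h1, h2⟩ | ⟨h1, h2⟩
      · exact ⟨Cl_E hA h1 hi, Cl_E hA h2 hj⟩
      · have := Cl_E hA h1 hj
        have := Cl_E hA h2 hk
        tauto
      · have := Cl_E hA h1 hi
        have := Cl_E hA h2 hk
        tauto
    simp at hx hy
    rcases hx with rfl | rfl | rfl <;> rcases hy with rfl | rfl | rfl <;> tauto
  have fin : ∀ X : Finset ι, X ⊆ {i, j, k} → (i ∈ X ∧ j ∈ X) ∨ (j ∈ X ∧ k ∈ X) ∨ (i ∈ X ∧ k ∈ X) →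
      bd p q X a = R a → bd p q X b = R b → bd p q X c = R c →
      ∃ X ⊆ Ins p q {a, b, c}, bd p q X = R ∧ Cn p q {a, b, c} X := by
    intro X hX h h1 h2 h3
    have hXs : X ⊆ Ins p q {a, b, c} := by
      intro l hl; have := hX hl; simp at this; rcases this with rfl | rfl | rfl <;> assumption
    refine ⟨X, hXs, ?_, hcn X h⟩
    funext x
    by_cases hx : x ∈ ({a, b, c} : Finset V)
    · simp at hx; rcases hx with rfl | rfl | rfl <;> assumption
    · rw [hR x hx, bd_not_mem p q hXs hx]
  have e11 : (1:ZMod 2) + 1 = 0 := z2 1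
  rcases z2c (R b) with hb | hb <;> rcases z2c (R c) with hc | hc
  · have ha : R a = 0 := by rw [hb, hc] at hsum; simpa using hsum
    apply fin {i, j, k} (by simp) (by simp) <;>
      rw [bd_insert hi (by simp [hij, hik]), bd_insert hj (by simp [hjk]), bd_single hk] <;>
      simp [ha, hb, hc, hab, hbc, hac, hab.symm, hbc.symm, hac.symm, e11]
  · have ha : R a = 1 := by
      rcases z2c (R a) with h | h
      · rw [hb, hc, h] at hsum; exact absurd hsum (by decide)
      · exact h
    apply fin {i, j} (by intro x; simp; tauto) (by simp) <;>
      rw [bd_insert hi (by simp [hij]), bd_single hj] <;>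
      simp [ha, hb, hc, hab, hbc, hac, hab.symm, hbc.symm, hac.symm, e11]
  · have ha : R a = 1 := by
      rcases z2c (R a) with h | h
      · rw [hb, hc, h] at hsum; exact absurd hsum (by decide)
      · exact h
    apply fin {j, k} (by intro x; simp; tauto) (by simp) <;>
      rw [bd_insert hj (by simp [hjk]), bd_single hk] <;>
      simp [ha, hb, hc, hab, hbc, hac, hab.symm, hbc.symm, hac.symm, e11]
  · have ha : R a = 0 := by rw [hb, hc] at hsum; rw [e11] at hsum; simpa using hsum
    apply fin {i, k} (by intro x; simp; tauto) (by simp) <;>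
      rw [bd_insert hi (by simp [hik]), bd_single hk] <;>
      simp [ha, hb, hc, hab, hbc, hac, hab.symm, hbc.symm, hac.symm, e11]

/-- Data of a 4-cycle. -/
structure C4 (p q : ι → V) (u v z w : V) (c1 c2 c3 c4 : ι) : Prop where
  uv : u ≠ v
  uz : u ≠ z
  uw : u ≠ w
  vz : v ≠ z
  vw : v ≠ w
  zw : z ≠ w
  e1 : E p q c1 u v
  e2 : E p q c2 v z
  e3 : E p q c3 z w
  e4 : E p q c4 w u

/-- The identification map. -/
noncomputable def hh (u v z w : V) (a : V) : V := if a = z then u else if a = w then v else a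

/-- End of edges in `G/π`. -/
noncomputable def piE (u v z w : V) (c1 c2 c3 c4 : ι) (f : ι → V) (e : V) (i : ι) : V :=
  if i = c1 then e else if i = c2 ∨ i = c3 ∨ i = c4 then u else hh u v z w (f i)

lemma C4.ne {p q : ι → V} {u v z w : V} {c1 c2 c3 c4 : ι} (h : C4 p q u v z w c1 c2 c3 c4) :
    c1 ≠ c2 ∧ c1 ≠ c3 ∧ c1 ≠ c4 ∧ c2 ≠ c3 ∧ c2 ≠ c4 ∧ c3 ≠ c4 := by
  obtain ⟨h1,h2,h3,h4,h5,h6,e1,e2,e3,e4⟩ := h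
  refine ⟨?_, ?_, ?_, ?_, ?_, ?_⟩
  · rintro rfl; rcases E_eq e1 e2 with h | h <;> grind
  · rintro rfl; rcases E_eq e1 e3 with h | h <;> grind
  · rintro rfl; rcases E_eq e1 e4 with h | h <;> grind
  · rintro rfl; rcases E_eq e2 e3 with h | h <;> grind
  · rintro rfl; rcases E_eq e2 e4 with h | h <;> grind
  · rintro rfl; rcases E_eq e3 e4 with h | h <;> grind
end Cat

namespace Cat
variable {V ι : Type} [Fintype V] [Fintype ι]

lemma z2e (a b : ZMod 2) (h : a + b = 0) : b = a := by revert a b; decide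

set_option maxHeartbeats 1000000 in
lemma pi_coll {p q : ι → V} {u v z w : V} {c1 c2 c3 c4 : ι} (h : C4 p q u v z w c1 c2 c3 c4)
    {L : Finset V} (hu : u ∈ L) (hv : v ∈ L) (hz : z ∉ L) (hw : w ∉ L)
    (hc : Coll (piE u v z w c1 c2 c3 c4 p u) (piE u v z w c1 c2 c3 c4 q v) L) :
    Coll p q (insert z (insert w L)) := by
  obtain ⟨n12, n13, n14, n23, n24, n34⟩ := h.ne
  obtain ⟨huv,huz,huw,hvz,hvw,hzw,e1,e2,e3,e4⟩ := h
  set p' := piE u v z w c1 c2 c3 c4 p u with hp'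
  set q' := piE u v z w c1 c2 c3 c4 q v with hq'
  intro R hR hs
  set g := hh u v z w with hg
  have gu : g u = u := by simp [hg, hh, huz, huw]
  have gv : g v = v := by simp [hg, hh, hvz, hvw]
  have gz : g z = u := by simp [hg, hh]
  have gw : g w = v := by simp [hg, hh, hzw.symm]
  have go : ∀ a, a ≠ z → a ≠ w → g a = a := by intro a h1 h2; simp [hg, hh, h1, h2]
  have gL : ∀ a, g a ∈ L → a ∈ insert z (insert w L) := by
    intro a ha
    by_cases h1 : a = z
    · simp [h1]
    by_cases h2 : a = w
    · simp [h2]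
    rw [go a h1 h2] at ha; simp [ha]
  have gL' : ∀ a, a ∈ insert z (insert w L) → g a ∈ L := by
    intro a ha
    by_cases h1 : a = z
    · rw [h1, gz]; exact hu
    by_cases h2 : a = w
    · rw [h2, gw]; exact hv
    rw [go a h1 h2]; simpa [h1, h2] using ha
  obtain ⟨X', hX', hb, hcn⟩ := hc (fun y => ∑ x with g x = y, R x) (by
      intro y hy
      apply Finset.sum_eq_zero
      intro x hx
      apply hR
      simp only [Finset.mem_filter, Finset.mem_univ, true_and] at hx
      intro hx'
      exact hy (hx ▸ gL' x hx')) (by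
      rw [← hs]; exact Finset.sum_fiberwise _ _ _)
  set cyc : Finset ι := {c1, c2, c3, c4} with hcyc
  set X0 := X'.filter (fun i => i ∉ cyc) with hX0
  have m1 : c1 ∈ cyc := by simp [hcyc]
  have m2 : c2 ∈ cyc := by simp [hcyc]
  have m3 : c3 ∈ cyc := by simp [hcyc]
  have m4 : c4 ∈ cyc := by simp [hcyc]
  have pn : ∀ i, i ∉ cyc → p' i = g (p i) ∧ q' i = g (q i) := by
    intro i hi
    simp [hcyc] at hi
    simp [hp', hq', piE, hi, hg]
  have p1 : p' c1 = u ∧ q' c1 = v := by simp [hp', hq', piE]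
  have pl : ∀ i ∈ cyc, i ≠ c1 → p' i = u ∧ q' i = u := by
    intro i hi h1
    have : i = c2 ∨ i = c3 ∨ i = c4 := by simp [hcyc] at hi; tauto
    simp [hp', hq', piE, h1, this]
  set ε : ZMod 2 := if c1 ∈ X' then 1 else 0 with hε
  have hbX : ∀ y, bd p' q' X' y = bd (g ∘ p) (g ∘ q) X0 y +
      ε * ((if u = y then 1 else 0) + (if v = y then 1 else 0)) := by
    intro y
    have : bd p' q' X' y = bd p' q' X0 y + bd p' q' (X'.filter (fun i => i ∈ cyc)) y := by
      unfold bd; rw [hX0, add_comm]; exact (Finset.sum_filter_add_sum_filter_not _ _ _).symm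
    rw [this]
    congr 1
    · unfold bd
      apply Finset.sum_congr rfl
      intro i hi
      have := pn i (Finset.mem_filter.1 hi).2
      rw [this.1, this.2]; rfl
    · unfold bd
      by_cases h1 : c1 ∈ X'
      · rw [Finset.sum_eq_single c1]
        · rw [p1.1, p1.2, hε, if_pos h1, one_mul]
        · intro i hi hne
          have := pl i (Finset.mem_filter.1 hi).2 hne
          rw [this.1, this.2]; exact z2 _
        · intro hn; exact absurd (Finset.mem_filter.2 ⟨h1, m1⟩) hn
      · rw [hε, if_neg h1, zero_mul]
        apply Finset.sum_eq_zero
        intro i hi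
        have hi' := Finset.mem_filter.1 hi
        have := pl i hi'.2 (by rintro rfl; exact h1 hi'.1)
        rw [this.1, this.2]; exact z2 _
  set D : V → ZMod 2 := fun x => R x + bd p q X0 x with hD
  have hDs : ∀ y, ∑ x with g x = y, D x =
      ε * ((if u = y then 1 else 0) + (if v = y then 1 else 0)) := by
    intro y
    have h1 := hbX y
    rw [hb, bd_push] at h1
    beta_reduce at h1
    simp only [hD]
    rw [Finset.sum_add_distrib, h1, add_right_comm, z2, zero_add]
  have fu : (Finset.univ.filter fun x => g x = u) = {u, z} := by
    ext x
    simp only [Finset.mem_filter, Finset.mem_univ, true_and, Finset.mem_insert,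
      Finset.mem_singleton]
    constructor
    · intro hx
      by_cases h1 : x = z
      · exact Or.inr h1
      by_cases h2 : x = w
      · rw [h2, gw] at hx; exact absurd hx.symm huv
      rw [go x h1 h2] at hx; exact Or.inl hx
    · rintro (rfl | rfl) <;> assumption
  have fv : (Finset.univ.filter fun x => g x = v) = {v, w} := by
    ext x
    simp only [Finset.mem_filter, Finset.mem_univ, true_and, Finset.mem_insert,
      Finset.mem_singleton]
    constructor
    · intro hx
      by_cases h1 : x = w
      · exact Or.inr h1
      by_cases h2 : x = z
      · rw [h2, gz] at hx; exact absurd hx huv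
      rw [go x h2 h1] at hx; exact Or.inl hx
    · rintro (rfl | rfl) <;> assumption
  have Duz : D u + D z = ε := by
    have := hDs u
    rw [fu, Finset.sum_pair huz] at this
    rw [this]; simp [huv.symm]
  have Dvw : D v + D w = ε := by
    have := hDs v
    rw [fv, Finset.sum_pair hvw] at this
    rw [this]; simp [huv]
  have D0 : ∀ x, x ∉ ({u, v, z, w} : Finset V) → D x = 0 := by
    intro x hx
    simp at hx
    have := hDs x
    rw [show (Finset.univ.filter fun y => g y = x) = {x} from ?_, Finset.sum_singleton] at this
    · rw [this]; simp [Ne.symm hx.1, Ne.symm hx.2.1]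
    · ext y
      simp only [Finset.mem_filter, Finset.mem_univ, true_and, Finset.mem_singleton]
      constructor
      · intro hy
        by_cases h1 : y = w
        · rw [h1, gw] at hy; exact absurd hy.symm hx.2.1
        by_cases h2 : y = z
        · rw [h2, gz] at hy; exact absurd hy.symm hx.1
        rw [go y h2 h1] at hy; exact hy
      · rintro rfl; exact go _ hx.2.2.1 hx.2.2.2
  have fin : ∀ C : Finset ι, C ⊆ cyc → bd p q C u = D u → bd p q C v = D v → bd p q C z = D z →
      bd p q C w = D w →
      (∀ A : Set V, Cl p q X0 A → Cl p q C A → (u ∈ A ↔ v ∈ A) ∧ (u ∈ A ↔ z ∈ A) ∧ (u ∈ A ↔ w ∈ A)) →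
      ∃ X ⊆ Ins p q (insert z (insert w L)), bd p q X = R ∧ Cn p q (insert z (insert w L)) X := by
    intro C hC hbu hbv hbz hbw hA
    have hC4 : C ⊆ Ins p q {u, v, z, w} := by
      intro i hi
      have := hC hi
      simp only [hcyc, Finset.mem_insert, Finset.mem_singleton] at this
      rcases this with rfl | rfl | rfl | rfl
      · exact E_ins e1 (by simp) (by simp)
      · exact E_ins e2 (by simp) (by simp)
      · exact E_ins e3 (by simp) (by simp)
      · exact E_ins e4 (by simp) (by simp)
    have hCD : ∀ x, bd p q C x = D x := by
      intro x
      by_cases hx : x ∈ ({u, v, z, w} : Finset V)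
      · simp at hx; rcases hx with rfl | rfl | rfl | rfl <;> assumption
      · rw [D0 x hx, bd_not_mem p q hC4 hx]
    refine ⟨X0 ∪ C, ?_, ?_, ?_⟩
    · intro i hi
      rcases Finset.mem_union.1 hi with hi | hi
      · have hi' := Finset.mem_filter.1 hi
        have h1 := mem_Ins.1 (hX' hi'.1)
        have h2 := pn i hi'.2
        rw [h2.1, h2.2] at h1
        exact mem_Ins.2 ⟨gL _ h1.1, gL _ h1.2⟩
      · have h1 := mem_Ins.1 (hC4 hi)
        have : ({u, v, z, w} : Finset V) ⊆ insert z (insert w L) := by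
          intro x hx; simp at hx; simp; rcases hx with rfl | rfl | rfl | rfl <;> simp [*]
        exact mem_Ins.2 ⟨this h1.1, this h1.2⟩
    · funext x
      rw [bd_union, hCD]
      · simp only [hD]; rw [add_comm (R x), ← add_assoc, z2, zero_add]
      · rw [Finset.disjoint_left]; intro i hi hi'
        exact (Finset.mem_filter.1 hi).2 (hC hi')
    · intro A hclA x hx y hy hxA
      obtain ⟨huv', huz', huw'⟩ := hA A (fun i hi => hclA i (Finset.mem_union_left _ hi))
        (fun i hi => hclA i (Finset.mem_union_right _ hi))
      have gA : ∀ a, g a ∈ A ↔ a ∈ A := by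
        intro a
        by_cases h1 : a = z
        · rw [h1, gz]; exact huz'
        by_cases h2 : a = w
        · rw [h2, gw]; tauto
        rw [go a h1 h2]
      have := hcn A (by
        intro i hi
        by_cases hic : i ∈ cyc
        · by_cases h1 : i = c1
          · rw [h1, p1.1, p1.2]; exact huv'
          · rw [(pl i hic h1).1, (pl i hic h1).2]
        · rw [(pn i hic).1, (pn i hic).2, gA, gA]
          exact hclA i (Finset.mem_union_left _ (Finset.mem_filter.2 ⟨hi, hic⟩)))
        (g x) (gL' x hx) (g y) (gL' y hy) ((gA x).2 hxA)
      exact (gA y).1 this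
  have e11 : (1:ZMod 2) + 1 = 0 := z2 1
  have n01 : (0:ZMod 2) ≠ 1 := by decide
  have hbv : ∀ C : Finset ι, C ⊆ cyc → ∀ x, bd p q C x =
      (if c1 ∈ C then (if u = x then 1 else 0) + (if v = x then 1 else 0) else 0) +
      ((if c2 ∈ C then (if v = x then 1 else 0) + (if z = x then 1 else 0) else 0) +
      ((if c3 ∈ C then (if z = x then 1 else 0) + (if w = x then 1 else 0) else 0) +
      (if c4 ∈ C then (if w = x then 1 else 0) + (if u = x then 1 else 0) else 0))) := by
    intro C hC x
    have h1 : bd p q C x = ∑ i ∈ cyc, if i ∈ C then bd p q {i} x else 0 := by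
      rw [← Finset.sum_filter, Finset.filter_mem_eq_inter, Finset.inter_eq_right.2 hC]
      simp [bd]
    rw [h1, hcyc, Finset.sum_insert (by simp [n12, n13, n14]), Finset.sum_insert (by simp [n23, n24]),
      Finset.sum_insert (by simp [n34]), Finset.sum_singleton, bd_single e1, bd_single e2,
      bd_single e3, bd_single e4]
  have hul : ∀ (C : Finset ι) (A : Set V), Cl p q C A → (c1 ∈ C → (u ∈ A ↔ v ∈ A)) ∧
      (c2 ∈ C → (v ∈ A ↔ z ∈ A)) ∧ (c3 ∈ C → (z ∈ A ↔ w ∈ A)) ∧ (c4 ∈ C → (w ∈ A ↔ u ∈ A)) :=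
    fun C A hA => ⟨fun hx => Cl_E hA hx e1, fun hx => Cl_E hA hx e2, fun hx => Cl_E hA hx e3,
      fun hx => Cl_E hA hx e4⟩
  -- links
  have hlink : ε = 0 → (∀ A, Cl p q X0 A → u ∈ A → v ∈ A) ∨ (∀ A, Cl p q X0 A → u ∈ A → w ∈ A) ∨
      (∀ A, Cl p q X0 A → z ∈ A → v ∈ A) ∨ (∀ A, Cl p q X0 A → z ∈ A → w ∈ A) := by
    intro hε0
    by_contra hcon
    push Not at hcon
    obtain ⟨⟨A1, a1, a2, a3⟩, ⟨A2, b1, b2, b3⟩, ⟨A3, c1', c2', c3'⟩, ⟨A4, d1, d2, d3⟩⟩ := hcon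
    have hc1 : c1 ∉ X' := by intro hh; rw [hε, if_pos hh] at hε0; exact n01 hε0.symm
    set A : Set V := {y | (∀ A, Cl p q X0 A → u ∈ A → y ∈ A) ∨ (∀ A, Cl p q X0 A → z ∈ A → y ∈ A)}
      with hAdef
    have hAu : u ∈ A := Or.inl fun _ _ h => h
    have hAz : z ∈ A := Or.inr fun _ _ h => h
    have hAv : v ∉ A := by
      rintro (h | h)
      · exact a3 (h A1 a1 a2)
      · exact c3' (h A3 c1' c2')
    have hAw : w ∉ A := by
      rintro (h | h)
      · exact b3 (h A2 b1 b2)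
      · exact d3 (h A4 d1 d2)
    have gA : ∀ a, g a ∈ A ↔ a ∈ A := by
      intro a
      by_cases h1 : a = z
      · rw [h1, gz]; tauto
      by_cases h2 : a = w
      · rw [h2, gw]; tauto
      rw [go a h1 h2]
    refine hAv (hcn A ?_ u hu v hv hAu)
    intro i hi
    by_cases hic : i ∈ cyc
    · have h1 : i ≠ c1 := by rintro rfl; exact hc1 hi
      rw [(pl i hic h1).1, (pl i hic h1).2]
    · rw [(pn i hic).1, (pn i hic).2, gA, gA]
      have hi0 : i ∈ X0 := Finset.mem_filter.2 ⟨hi, hic⟩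
      constructor
      · rintro (h | h)
        · exact Or.inl fun B hB hh => (hB i hi0).1 (h B hB hh)
        · exact Or.inr fun B hB hh => (hB i hi0).1 (h B hB hh)
      · rintro (h | h)
        · exact Or.inl fun B hB hh => (hB i hi0).2 (h B hB hh)
        · exact Or.inr fun B hB hh => (hB i hi0).2 (h B hB hh)
  have sy : ∀ a b : V, (∀ A, Cl p q X0 A → a ∈ A → b ∈ A) → ∀ A, Cl p q X0 A → (a ∈ A ↔ b ∈ A) := by
    intro a b hab A hA
    constructor
    · exact hab A hA
    · intro hb
      by_contra hna
      exact hab Aᶜ (fun i hi => not_congr (hA i hi)) hna hb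
  have fin2 : ∀ C : Finset ι, C ⊆ cyc →
      ((if c1 ∈ C then 1 else 0) + (if c4 ∈ C then 1 else 0) : ZMod 2) = D u →
      ((if c1 ∈ C then 1 else 0) + (if c2 ∈ C then 1 else 0) : ZMod 2) = D v →
      ((if c2 ∈ C then 1 else 0) + (if c3 ∈ C then 1 else 0) : ZMod 2) = D z →
      ((if c3 ∈ C then 1 else 0) + (if c4 ∈ C then 1 else 0) : ZMod 2) = D w →
      (∀ A : Set V, Cl p q X0 A → (c1 ∈ C → (u ∈ A ↔ v ∈ A)) →
      (c2 ∈ C → (v ∈ A ↔ z ∈ A)) → (c3 ∈ C → (z ∈ A ↔ w ∈ A)) → (c4 ∈ C → (w ∈ A ↔ u ∈ A)) →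
        (u ∈ A ↔ v ∈ A) ∧ (u ∈ A ↔ z ∈ A) ∧ (u ∈ A ↔ w ∈ A)) →
      ∃ X ⊆ Ins p q (insert z (insert w L)), bd p q X = R ∧ Cn p q (insert z (insert w L)) X := by
    intro C hC h1 h2 h3 h4 hA
    apply fin C hC
    · rw [hbv C hC, ← h1]; simp [huv.symm, huz.symm, huw.symm]
    · rw [hbv C hC, ← h2]; simp [huv, hvz.symm, hvw.symm]
    · rw [hbv C hC, ← h3]; simp [huz, hvz, hzw.symm]
    · rw [hbv C hC, ← h4]; simp [huw, hvw, hzw]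
    · intro A h0 hCA
      have := hul C A hCA
      exact hA A h0 this.1 this.2.1 this.2.2.1 this.2.2.2
  by_cases hε1 : c1 ∈ X'
  · have hε' : ε = 1 := by rw [hε, if_pos hε1]
    rw [hε'] at Duz Dvw
    rcases z2c (D u) with d1 | d1 <;> rcases z2c (D v) with d2 | d2 <;>
      rw [d1] at Duz <;> rw [d2] at Dvw
    · have d3 : D z = 1 := by simpa using Duz
      have d4 : D w = 1 := by simpa using Dvw
      apply fin2 {c1, c2, c4} (by simp only [Finset.insert_subset_iff, Finset.singleton_subset_iff, m1, m2, m3, m4, and_self]) <;> simp [n12, n13, n14, n23, n24, n34, n12.symm, n13.symm, n14.symm, n23.symm, n24.symm, n34.symm, d1, d2, d3, d4, e11]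
      intro A _; clear * -; tauto
    · have d3 : D z = 1 := by simpa using Duz
      have d4 : D w = 0 := by simpa using Dvw
      apply fin2 {c1, c3, c4} (by simp only [Finset.insert_subset_iff, Finset.singleton_subset_iff, m1, m2, m3, m4, and_self]) <;> simp [n12, n13, n14, n23, n24, n34, n12.symm, n13.symm, n14.symm, n23.symm, n24.symm, n34.symm, d1, d2, d3, d4, e11]
      intro A _; clear * -; tauto
    · have d3 : D z = 0 := by simpa using Duz
      have d4 : D w = 1 := by simpa using Dvw
      apply fin2 {c1, c2, c3} (by simp only [Finset.insert_subset_iff, Finset.singleton_subset_iff, m1, m2, m3, m4, and_self]) <;> simp [n12, n13, n14, n23, n24, n34, n12.symm, n13.symm, n14.symm, n23.symm, n24.symm, n34.symm, d1, d2, d3, d4, e11]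
      intro A _; clear * -; tauto
    · have d3 : D z = 0 := by simpa using Duz
      have d4 : D w = 0 := by simpa using Dvw
      apply fin2 {c2, c3, c4} (by simp only [Finset.insert_subset_iff, Finset.singleton_subset_iff, m1, m2, m3, m4, and_self]) <;> simp [n12, n13, n14, n23, n24, n34, n12.symm, n13.symm, n14.symm, n23.symm, n24.symm, n34.symm, d1, d2, d3, d4, e11]
      intro A _; clear * -; tauto
  · have hε' : ε = 0 := by rw [hε, if_neg hε1]
    have hl := hlink hε'
    rw [hε'] at Duz Dvw
    have d3 : D z = D u := z2e _ _ Duz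
    have d4 : D w = D v := z2e _ _ Dvw
    rcases z2c (D u) with d1 | d1 <;> rcases z2c (D v) with d2 | d2 <;>
      rw [d1] at d3 <;> rw [d2] at d4
    · apply fin2 {c1, c2, c3, c4} (by simp [hcyc]) <;> simp [d1, d2, d3, d4, e11]
      intro A _; clear * -; tauto
    · have hlk : (∀ A, Cl p q X0 A → (u ∈ A ↔ v ∈ A)) ∨ (∀ A, Cl p q X0 A → (u ∈ A ↔ w ∈ A)) ∨
          (∀ A, Cl p q X0 A → (z ∈ A ↔ v ∈ A)) ∨ (∀ A, Cl p q X0 A → (z ∈ A ↔ w ∈ A)) := by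
        rcases hl with h | h | h | h
        · exact Or.inl (sy _ _ h)
        · exact Or.inr (Or.inl (sy _ _ h))
        · exact Or.inr (Or.inr (Or.inl (sy _ _ h)))
        · exact Or.inr (Or.inr (Or.inr (sy _ _ h)))
      rcases or_assoc.2 hlk with hlk | hlk
      · apply fin2 {c2, c3} (by simp only [Finset.insert_subset_iff, Finset.singleton_subset_iff, m1, m2, m3, m4, and_self]) <;> simp [n12, n13, n14, n23, n24, n34, n12.symm, n13.symm, n14.symm, n23.symm, n24.symm, n34.symm, d1, d2, d3, d4, e11]
        intro A hA
        rcases hlk with hlk | hlk <;> have := hlk A hA <;> revert this <;> clear * - <;> tauto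
      · apply fin2 {c1, c4} (by simp only [Finset.insert_subset_iff, Finset.singleton_subset_iff, m1, m2, m3, m4, and_self]) <;> simp [n12, n13, n14, n23, n24, n34, n12.symm, n13.symm, n14.symm, n23.symm, n24.symm, n34.symm, d1, d2, d3, d4, e11]
        intro A hA
        rcases hlk with hlk | hlk <;> have := hlk A hA <;> revert this <;> clear * - <;> tauto
    · have hlk : ((∀ A, Cl p q X0 A → (u ∈ A ↔ v ∈ A)) ∨ (∀ A, Cl p q X0 A → (z ∈ A ↔ v ∈ A))) ∨
          ((∀ A, Cl p q X0 A → (u ∈ A ↔ w ∈ A)) ∨ (∀ A, Cl p q X0 A → (z ∈ A ↔ w ∈ A))) := by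
        rcases hl with h | h | h | h
        · exact Or.inl (Or.inl (sy _ _ h))
        · exact Or.inr (Or.inl (sy _ _ h))
        · exact Or.inl (Or.inr (sy _ _ h))
        · exact Or.inr (Or.inr (sy _ _ h))
      rcases hlk with hlk | hlk
      · apply fin2 {c3, c4} (by simp only [Finset.insert_subset_iff, Finset.singleton_subset_iff, m1, m2, m3, m4, and_self]) <;> simp [n12, n13, n14, n23, n24, n34, n12.symm, n13.symm, n14.symm, n23.symm, n24.symm, n34.symm, d1, d2, d3, d4, e11]
        intro A hA
        rcases hlk with hlk | hlk <;> have := hlk A hA <;> revert this <;> clear * - <;> tauto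
      · apply fin2 {c1, c2} (by simp only [Finset.insert_subset_iff, Finset.singleton_subset_iff, m1, m2, m3, m4, and_self]) <;> simp [n12, n13, n14, n23, n24, n34, n12.symm, n13.symm, n14.symm, n23.symm, n24.symm, n34.symm, d1, d2, d3, d4, e11]
        intro A hA
        rcases hlk with hlk | hlk <;> have := hlk A hA <;> revert this <;> clear * - <;> tauto
    · have hlk : ((∀ A, Cl p q X0 A → (u ∈ A ↔ v ∈ A)) ∨ (∀ A, Cl p q X0 A → (z ∈ A ↔ w ∈ A))) ∨
          ((∀ A, Cl p q X0 A → (u ∈ A ↔ w ∈ A)) ∨ (∀ A, Cl p q X0 A → (z ∈ A ↔ v ∈ A))) := by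
        rcases hl with h | h | h | h
        · exact Or.inl (Or.inl (sy _ _ h))
        · exact Or.inr (Or.inl (sy _ _ h))
        · exact Or.inr (Or.inr (sy _ _ h))
        · exact Or.inl (Or.inr (sy _ _ h))
      rcases hlk with hlk | hlk
      · apply fin2 {c2, c4} (by simp only [Finset.insert_subset_iff, Finset.singleton_subset_iff, m1, m2, m3, m4, and_self]) <;> simp [n12, n13, n14, n23, n24, n34, n12.symm, n13.symm, n14.symm, n23.symm, n24.symm, n34.symm, d1, d2, d3, d4, e11]
        intro A hA
        rcases hlk with hlk | hlk <;> have := hlk A hA <;> revert this <;> clear * - <;> tauto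
      · apply fin2 {c1, c3} (by simp only [Finset.insert_subset_iff, Finset.singleton_subset_iff, m1, m2, m3, m4, and_self]) <;> simp [n12, n13, n14, n23, n24, n34, n12.symm, n13.symm, n14.symm, n23.symm, n24.symm, n34.symm, d1, d2, d3, d4, e11]
        intro A hA
        rcases hlk with hlk | hlk <;> have := hlk A hA <;> revert this <;> clear * - <;> tauto
end Cat

namespace Cat
variable {V ι : Type} [Fintype V] [Fintype ι]

lemma Red.mono {p q : ι → V} {U W : Finset V} (h : Red p q U) (hW : W ⊆ U) : Red p q W :=
  fun W' hW' hc => h W' (hW'.trans hW) hc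

lemma Red.par {p q : ι → V} {U : Finset V} (h : Red p q U) {a b : V} (ha : a ∈ U) (hb : b ∈ U)
    (hab : a ≠ b) {i j : ι} (hi : E p q i a b) (hj : E p q j a b) : i = j := by
  by_contra hij
  have := h {a, b} (by intro x; simp; rintro (rfl | rfl) <;> assumption) (coll_par hab hij hi hj)
  rw [Finset.card_pair hab] at this; omega

lemma Red.tri {p q : ι → V} {U : Finset V} (h : Red p q U) {a b c : V} (ha : a ∈ U) (hb : b ∈ U)
    (hc : c ∈ U) (hab : Adj p q a b) (hbc : Adj p q b c) (hac : Adj p q a c) : False := by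
  obtain ⟨n1, i, hi⟩ := hab
  obtain ⟨n2, j, hj⟩ := hbc
  obtain ⟨n3, k, hk⟩ := hac
  have := h {a, b, c} (by intro x; simp; rintro (rfl | rfl | rfl) <;> assumption)
    (coll_triangle n1 n2 n3 hi hj (E_symm hk))
  rw [Finset.card_insert_of_notMem (by simp [n1, n3]), Finset.card_pair n2] at this; omega

lemma piE_other {p q : ι → V} {u v z w : V} {c1 c2 c3 c4 : ι} {i : ι} (h1 : i ≠ c1) (h2 : i ≠ c2)
    (h3 : i ≠ c3) (h4 : i ≠ c4) {a b : V} (h : E p q i a b) :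
    E (piE u v z w c1 c2 c3 c4 p u) (piE u v z w c1 c2 c3 c4 q v) i (hh u v z w a) (hh u v z w b) := by
  unfold E piE
  simp only [h1, h2, h3, h4, or_self, if_false]
  rcases h with ⟨h1, h2⟩ | ⟨h1, h2⟩ <;> rw [h1, h2] <;> simp

lemma E_comp {p q : ι → V} (g : V → V) {i : ι} {a b : V} (h : E p q i a b) :
    E (g ∘ p) (g ∘ q) i (g a) (g b) := by
  rcases h with ⟨h1, h2⟩ | ⟨h1, h2⟩
  · left; simp [h1, h2]
  · right; simp [h1, h2]

lemma E_ne {p q : ι → V} {i j : ι} {a b c d : V} (hi : E p q i a b) (hj : E p q j c d)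
    (h : (a ≠ c ∨ b ≠ d) ∧ (a ≠ d ∨ b ≠ c)) : i ≠ j := by
  rintro rfl
  rcases E_eq hi hj with h' | h' <;> tauto

lemma Red.K33m {p q : ι → V} {U : Finset V} (h : Red p q U) {x1 x2 x3 y1 y2 y3 : V}
    (hx1 : x1 ∈ U) (hx2 : x2 ∈ U) (hx3 : x3 ∈ U) (hy1 : y1 ∈ U) (hy2 : y2 ∈ U) (hy3 : y3 ∈ U)
    (n12 : x1 ≠ x2) (n13 : x1 ≠ x3) (n23 : x2 ≠ x3)
    (m12 : y1 ≠ y2) (m13 : y1 ≠ y3) (m23 : y2 ≠ y3) (hxy : x3 ≠ y3)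
    (a11 : Adj p q x1 y1) (a12 : Adj p q x1 y2) (a13 : Adj p q x1 y3)
    (a21 : Adj p q x2 y1) (a22 : Adj p q x2 y2) (a23 : Adj p q x2 y3)
    (a31 : Adj p q x3 y1) (a32 : Adj p q x3 y2) : False := by
  obtain ⟨k11, i11, e11⟩ := a11
  obtain ⟨k12, i12, e12⟩ := a12
  obtain ⟨k13, i13, e13⟩ := a13
  obtain ⟨k21, i21, e21⟩ := a21
  obtain ⟨k22, i22, e22⟩ := a22
  obtain ⟨k23, i23, e23⟩ := a23
  obtain ⟨k31, i31, e31⟩ := a31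
  obtain ⟨k32, i32, e32⟩ := a32
  have hC : C4 p q x1 y1 x3 y2 i11 i31 i32 i12 :=
    ⟨k11, n13, k12, k31.symm, m12, k32, e11, E_symm e31, e32, E_symm e12⟩
  set p' := piE x1 y1 x3 y2 i11 i31 i32 i12 p x1 with hp'
  set q' := piE x1 y1 x3 y2 i11 i31 i32 i12 q y1 with hq'
  have g1 : hh x1 y1 x3 y2 x1 = x1 := by simp [hh, n13, k12]
  have g2 : hh x1 y1 x3 y2 x2 = x2 := by simp [hh, n23, k22]
  have g3 : hh x1 y1 x3 y2 y1 = y1 := by simp [hh, k31.symm, m12]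
  have g4 : hh x1 y1 x3 y2 y2 = y1 := by simp [hh, k32.symm]
  have g5 : hh x1 y1 x3 y2 y3 = y3 := by simp [hh, hxy.symm, m23.symm]
  have E1 : E p' q' i11 x1 y1 := by left; simp [hp', hq', piE]
  have E2 : E p' q' i13 x1 y3 := by
    have := piE_other (u := x1) (v := y1) (z := x3) (w := y2) (c1 := i11) (c2 := i31) (c3 := i32)
      (c4 := i12) (E_ne e13 e11 (by tauto)) (E_ne e13 e31 (by tauto)) (E_ne e13 e32 (by tauto))
      (E_ne e13 e12 (by grind)) e13
    rwa [g1, g5] at this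
  have E3 : E p' q' i21 x2 y1 := by
    have := piE_other (u := x1) (v := y1) (z := x3) (w := y2) (c1 := i11) (c2 := i31) (c3 := i32)
      (c4 := i12) (E_ne e21 e11 (by tauto)) (E_ne e21 e31 (by tauto)) (E_ne e21 e32 (by tauto))
      (E_ne e21 e12 (by tauto)) e21
    rwa [g2, g3] at this
  have E4 : E p' q' i22 x2 y1 := by
    have := piE_other (u := x1) (v := y1) (z := x3) (w := y2) (c1 := i11) (c2 := i31) (c3 := i32)
      (c4 := i12) (E_ne e22 e11 (by tauto)) (E_ne e22 e31 (by tauto)) (E_ne e22 e32 (by tauto))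
      (E_ne e22 e12 (by tauto)) e22
    rwa [g2, g4] at this
  have E5 : E p' q' i23 x2 y3 := by
    have := piE_other (u := x1) (v := y1) (z := x3) (w := y2) (c1 := i11) (c2 := i31) (c3 := i32)
      (c4 := i12) (E_ne e23 e11 (by tauto)) (E_ne e23 e31 (by tauto)) (E_ne e23 e32 (by tauto))
      (E_ne e23 e12 (by tauto)) e23
    rwa [g2, g5] at this
  set g : V → V := fun x => if x = x2 then y1 else x with hg
  have gx1 : g x1 = x1 := by simp [hg, n12]
  have gx2 : g x2 = y1 := by simp [hg]
  have gy1 : g y1 = y1 := by simp [hg]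
  have gy3 : g y3 = y3 := by simp [hg, k23.symm]
  have F1 := E_comp g E1
  have F2 := E_comp g E2
  have F3 := E_comp g E5
  rw [gx1, gy1] at F1
  rw [gx1, gy3] at F2
  rw [gx2, gy3] at F3
  have hcoll := lift_coll p' q' g {x1, y1, y3} (by
    intro y hy
    simp only [Finset.mem_insert, Finset.mem_singleton] at hy
    rcases hy with rfl | rfl | rfl
    · convert coll_singleton p' q' y using 1
      ext x; simp [hg]; grind
    · convert coll_par k21 (E_ne e21 e22 (by tauto)) E3 E4 using 1
      ext x; simp [hg]; grind
    · convert coll_singleton p' q' y using 1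
      ext x; simp [hg]; grind)
    (coll_triangle k11 m13 k13 F1 F3 (E_symm F2))
  have hL : (Finset.univ.filter fun x => g x ∈ ({x1, y1, y3} : Finset V)) = {x1, x2, y1, y3} := by
    ext x; simp [hg]; grind
  rw [hL] at hcoll
  have := h _ ?_ (pi_coll hC (by simp) (by simp) (by simp; tauto) (by simp; tauto) hcoll)
  · have h2 : ({x1, x2} : Finset V) ⊆ insert x3 (insert y2 {x1, x2, y1, y3}) := by
      intro x; simp; tauto
    have := Finset.card_le_card h2
    rw [Finset.card_pair n12] at this; omega
  · intro x; simp; rintro (rfl | rfl | rfl | rfl | rfl | rfl) <;> assumption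

lemma exists_reduction (p q : ι → V) (U : Finset V) : ∃ g : V → V, (∀ x, x ∉ U → g x = x) ∧
    (∀ x ∈ U, g x ∈ U) ∧ (∀ y ∈ U.image g, Coll p q (Finset.univ.filter fun x => g x = y)) ∧
    Red (g ∘ p) (g ∘ q) (U.image g) := by
  have hex : ∃ n, ∃ g : V → V, ((∀ x, x ∉ U → g x = x) ∧
    (∀ x ∈ U, g x ∈ U) ∧ (∀ y ∈ U.image g, Coll p q (Finset.univ.filter fun x => g x = y))) ∧
    (U.image g).card = n := by
    refine ⟨_, id, ⟨fun _ _ => rfl, fun _ h => h, ?_⟩, rfl⟩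
    intro y _
    convert coll_singleton p q y using 1
    ext x; simp
  obtain ⟨g, ⟨h1, h2, h3⟩, h4⟩ := Nat.find_spec hex
  refine ⟨g, h1, h2, h3, ?_⟩
  intro W' hW' hc
  by_contra hcard
  push Not at hcard
  obtain ⟨y0, hy0⟩ : W'.Nonempty := Finset.card_pos.1 (by omega)
  have hIU : U.image g ⊆ U := by
    intro y hy; obtain ⟨x, hx, rfl⟩ := Finset.mem_image.1 hy; exact h2 x hx
  have hlt : (U.image (fun x => if g x ∈ W' then y0 else g x)).card < (U.image g).card := by
    have hs : U.image (fun x => if g x ∈ W' then y0 else g x) ⊆ insert y0 (U.image g \ W') := by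
      intro y hy
      obtain ⟨x, hx, rfl⟩ := Finset.mem_image.1 hy
      by_cases hg : g x ∈ W'
      · simp [hg]
      · simp only [hg, if_false, Finset.mem_insert, Finset.mem_sdiff, not_false_iff, and_true]
        exact Or.inr (Finset.mem_image_of_mem g hx)
    have := Finset.card_le_card hs
    have h5 := Finset.card_insert_le y0 (U.image g \ W')
    rw [Finset.card_sdiff_of_subset hW'] at h5
    have := Finset.card_le_card hW'
    omega
  refine absurd hlt (not_lt.2 ?_)
  rw [h4]
  apply Nat.find_min' hex
  refine ⟨_, ⟨?_, ?_, ?_⟩, rfl⟩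
  · intro x hx
    have : g x ∉ W' := by rw [h1 x hx]; exact fun h => hx (hIU (hW' h))
    show (if g x ∈ W' then y0 else g x) = x
    rw [if_neg this, h1 x hx]
  · intro x hx
    by_cases hg : g x ∈ W'
    · simp [hg]; exact hIU (hW' hy0)
    · simp [hg]; exact h2 x hx
  · intro y hy
    by_cases hyy : y = y0
    · convert lift_coll p q g W' (fun y hy => h3 y (hW' hy)) hc using 1
      ext x
      simp only [Finset.mem_filter, Finset.mem_univ, true_and]
      by_cases hg : g x ∈ W'
      · simp [hg, hyy]
      · simp only [hg, if_false, iff_false, hyy]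
        rintro rfl; exact hg hy0
    · obtain ⟨x, hx, rfl⟩ := Finset.mem_image.1 hy
      have hg : g x ∉ W' := by intro hg; simp [hg] at hyy
      simp only [hg, if_false] at hyy ⊢
      convert h3 (g x) (Finset.mem_image_of_mem g hx) using 1
      ext x'
      simp only [Finset.mem_filter, Finset.mem_univ, true_and]
      by_cases hg' : g x' ∈ W'
      · simp only [hg', if_true]
        constructor
        · intro h; exact absurd h.symm hyy
        · intro h; rw [h] at hg'; exact absurd hg' hg
      · simp [hg']
end Cat

namespace Cat
variable {V ι : Type} [Fintype V] [Fintype ι]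

/-- Set of non-loop edges inside `W`. -/
noncomputable def eds (p q : ι → V) (W : Finset V) : Finset ι :=
  Finset.univ.filter fun i => p i ∈ W ∧ q i ∈ W ∧ p i ≠ q i

noncomputable def ed (p q : ι → V) (W : Finset V) : ℕ := (eds p q W).card

/-- Set of edges between `A` and `B`. -/
noncomputable def crs (p q : ι → V) (A B : Finset V) : Finset ι :=
  Finset.univ.filter fun i => (p i ∈ A ∧ q i ∈ B) ∨ (p i ∈ B ∧ q i ∈ A)

noncomputable def ff (p q : ι → V) (W : Finset V) : ℤ := 2 * W.card - 2 - ed p q W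

lemma mem_eds {p q : ι → V} {W : Finset V} {i : ι} :
    i ∈ eds p q W ↔ p i ∈ W ∧ q i ∈ W ∧ p i ≠ q i := by simp [eds]

lemma mem_crs {p q : ι → V} {A B : Finset V} {i : ι} :
    i ∈ crs p q A B ↔ (p i ∈ A ∧ q i ∈ B) ∨ (p i ∈ B ∧ q i ∈ A) := by simp [crs]

lemma ed_union {p q : ι → V} {A B : Finset V} (h : Disjoint A B) :
    ed p q (A ∪ B) = ed p q A + ed p q B + (crs p q A B).card := by
  unfold ed
  rw [← Finset.card_union_of_disjoint, ← Finset.card_union_of_disjoint]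
  · congr 1
    ext i
    have h1 := Finset.disjoint_left.1 h
    simp only [Finset.mem_union, mem_eds, mem_crs]
    constructor
    · tauto
    · rintro ((h | h) | h)
      · tauto
      · tauto
      · refine ⟨by tauto, by tauto, ?_⟩
        intro hpq; rw [hpq] at h; have := @h1 (q i); tauto
  · rw [Finset.disjoint_left]
    intro i
    have h1 := Finset.disjoint_left.1 h
    simp only [Finset.mem_union, mem_eds, mem_crs]
    have := @h1 (q i)
    have := @h1 (p i)
    tauto
  · rw [Finset.disjoint_left]
    intro i
    have h1 := Finset.disjoint_left.1 h
    simp only [mem_eds]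
    have := @h1 (q i)
    tauto

lemma ff_union {p q : ι → V} {A B : Finset V} (h : Disjoint A B) :
    ff p q (A ∪ B) = ff p q A + ff p q B + 2 - (crs p q A B).card := by
  unfold ff
  rw [ed_union h, Finset.card_union_of_disjoint h]
  push_cast; ring

lemma ff_image (p q : ι → V) (U : Finset V) (g : V → V) (hg : ∀ x, g x ∈ U.image g → x ∈ U) :
    ff p q U = ff (g ∘ p) (g ∘ q) (U.image g) +
      ∑ y ∈ U.image g, ff p q (Finset.univ.filter fun x => g x = y) := by
  have hU : ∀ y ∈ U.image g, (Finset.univ.filter fun x => g x = y) = U.filter fun x => g x = y := by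
    intro y hy; ext x
    simp only [Finset.mem_filter, Finset.mem_univ, true_and]
    constructor
    · intro h; exact ⟨hg x (h ▸ hy), h⟩
    · exact fun h => h.2
  have hc : U.card = ∑ y ∈ U.image g, (Finset.univ.filter fun x => g x = y).card := by
    rw [Finset.card_eq_sum_card_image g U]
    apply Finset.sum_congr rfl
    intro y hy; rw [hU y hy]
  have he : ed p q U = ed (g ∘ p) (g ∘ q) (U.image g) +
      ∑ y ∈ U.image g, ed p q (Finset.univ.filter fun x => g x = y) := by
    unfold ed
    rw [← Finset.card_biUnion, ← Finset.card_union_of_disjoint]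
    · congr 1
      ext i
      simp only [Finset.mem_union, mem_eds, Finset.mem_biUnion, Finset.mem_filter, Finset.mem_univ,
        true_and, Function.comp]
      constructor
      · rintro ⟨h1, h2, h3⟩
        by_cases h4 : g (p i) = g (q i)
        · exact Or.inr ⟨g (q i), Finset.mem_image_of_mem g h2, h4, rfl, h3⟩
        · exact Or.inl ⟨Finset.mem_image_of_mem g h1, Finset.mem_image_of_mem g h2, h4⟩
      · rintro (⟨h1, h2, h3⟩ | ⟨y, hy, h1, h2, h3⟩)
        · exact ⟨hg _ h1, hg _ h2, fun h => h3 (by rw [h])⟩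
        · exact ⟨hg _ (h1 ▸ hy), hg _ (h2 ▸ hy), h3⟩
    · rw [Finset.disjoint_left]
      intro i
      simp only [mem_eds, Finset.mem_biUnion, Finset.mem_filter, Finset.mem_univ,
        true_and, Function.comp]
      rintro ⟨h1, h2, h3⟩ ⟨y, hy, h4, h5, h6⟩
      exact h3 (h4.trans h5.symm)
    · intro y _ y' _ hne
      rw [Function.onFun, Finset.disjoint_left]
      intro i
      simp only [mem_eds, Finset.mem_filter, Finset.mem_univ, true_and]
      rintro ⟨h1, h2, h3⟩ ⟨h4, h5, h6⟩
      exact hne (h1.symm.trans h4)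
  unfold ff
  rw [he]
  simp only [Finset.sum_sub_distrib, ← Finset.mul_sum]
  push_cast
  have hc' : (U.card : ℤ) = ∑ y ∈ U.image g, ((Finset.univ.filter fun x => g x = y).card : ℤ) := by
    rw [hc]; push_cast; rfl
  rw [← hc']
  simp
  ring

lemma ed_one {p q : ι → V} {W : Finset V} (h : W.card ≤ 1) : ed p q W = 0 := by
  unfold ed
  rw [Finset.card_eq_zero, Finset.eq_empty_iff_forall_notMem]
  intro i hi
  rw [mem_eds] at hi
  exact hi.2.2 (Finset.card_le_one.1 h _ hi.1 _ hi.2.1)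

lemma eds_E {p q : ι → V} {a b : V} {i : ι} (h : i ∈ eds p q {a, b}) : E p q i a b := by
  rw [mem_eds] at h
  simp at h
  unfold E
  grind

lemma Red.ed_two {p q : ι → V} {U W : Finset V} (hr : Red p q U) (hW : W ⊆ U) (h : W.card = 2) :
    ed p q W ≤ 1 := by
  obtain ⟨a, b, hab, rfl⟩ := Finset.card_eq_two.1 h
  unfold ed
  rw [Finset.card_le_one]
  intro i hi j hj
  exact hr.par (hW (by simp)) (hW (by simp)) hab (eds_E hi) (eds_E hj)

lemma ed_pair_zero {p q : ι → V} {a b : V} (hab : a ≠ b) (h : ¬ Adj p q a b) : ed p q {a, b} = 0 := by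
  unfold ed
  rw [Finset.card_eq_zero, Finset.eq_empty_iff_forall_notMem]
  intro i hi
  exact h ⟨hab, i, eds_E hi⟩

lemma Red.f_nonneg {p q : ι → V} {U W : Finset V} (hr : Red p q U) (hW : W ⊆ U) (h1 : 1 ≤ W.card)
    (h3 : 3 ≤ W.card → 2 ≤ ff p q W) : 0 ≤ ff p q W := by
  by_cases h : 3 ≤ W.card
  · linarith [h3 h]
  · unfold ff
    by_cases h2 : W.card = 2
    · have := hr.ed_two hW h2
      rw [h2]; push_cast; omega
    · have : W.card = 1 := by omega
      rw [ed_one (by omega), this]; simp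

lemma C4.nadj {p q : ι → V} {U : Finset V} (hr : Red p q U) {u v z w : V} {c1 c2 c3 c4 : ι}
    (h : C4 p q u v z w c1 c2 c3 c4) (hu : u ∈ U) (hv : v ∈ U) (hz : z ∈ U) (hw : w ∈ U) :
    ¬ Adj p q u z ∧ ¬ Adj p q v w := by
  obtain ⟨h1,h2,h3,h4,h5,h6,e1,e2,e3,e4⟩ := h
  constructor
  · intro ha
    exact hr.tri hu hv hz ⟨h1, _, e1⟩ ⟨h4, _, e2⟩ ha
  · intro ha
    exact hr.tri hv hu hw ⟨h1.symm, _, E_symm e1⟩ ⟨h3, _, E_symm e4⟩ ha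

/-- Result of the `π`-reduction followed by the reduction. -/
structure PS (p q : ι → V) (U : Finset V) (u v z w : V) (c1 c2 c3 c4 : ι) (p' q' : ι → V)
    (U' : Finset V) (φ : V → V) : Prop where
  red : Red p' q' U'
  two : 2 ≤ U'.card
  le : U'.card + 2 ≤ U.card
  fle : ff p' q' U' ≤ ff p q U - 1
  mem : ∀ x ∈ U, φ x ∈ U'
  out : ∀ x, x ∉ U → φ x = x
  sub : U' ⊆ U
  surj : ∀ y ∈ U', ∃ x ∈ U, φ x = y
  hz : φ z = φ u
  hw : φ w = φ v
  p1 : p' c1 = φ u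
  q1 : q' c1 = φ v
  loop : ∀ i, i = c2 ∨ i = c3 ∨ i = c4 → p' i = q' i
  other : ∀ i, i ≠ c1 → i ≠ c2 → i ≠ c3 → i ≠ c4 → p' i = φ (p i) ∧ q' i = φ (q i)
  inj : U'.card + 2 = U.card → ∀ x ∈ U, ∀ y ∈ U, x ≠ z → x ≠ w → y ≠ z → y ≠ w → φ x = φ y → x = y

lemma hh_cases (u v z w a : V) : (a = z ∧ hh u v z w a = u) ∨ (a ≠ z ∧ a = w ∧ hh u v z w a = v) ∨
    (a ≠ z ∧ a ≠ w ∧ hh u v z w a = a) := by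
  unfold hh; by_cases h1 : a = z
  · simp [h1]
  · by_cases h2 : a = w
    · subst h2; simp [h1]
    · simp [h1, h2]

lemma pi_ed_both {p q : ι → V} {u v z w : V} {c1 c2 c3 c4 : ι} (h : C4 p q u v z w c1 c2 c3 c4)
    (huz : ¬ Adj p q u z) (hvw : ¬ Adj p q v w)
    {L : Finset V} (hu : u ∈ L) (hv : v ∈ L) (hz : z ∉ L) (hw : w ∉ L) :
    ed (piE u v z w c1 c2 c3 c4 p u) (piE u v z w c1 c2 c3 c4 q v) L + 3 =
      ed p q (insert z (insert w L)) := by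
  obtain ⟨n12, n13, n14, n23, n24, n34⟩ := h.ne
  obtain ⟨k1,k2,k3,k4,k5,k6,e1,e2,e3,e4⟩ := h
  have hS : eds p q (insert z (insert w L)) = eds (piE u v z w c1 c2 c3 c4 p u)
      (piE u v z w c1 c2 c3 c4 q v) L ∪ {c2, c3, c4} := by
    ext i
    simp only [Finset.mem_union, mem_eds, Finset.mem_insert, Finset.mem_singleton]
    by_cases i1 : i = c1
    · subst i1
      have : piE u v z w i c2 c3 c4 p u i = u ∧ piE u v z w i c2 c3 c4 q v i = v := by simp [piE]
      rw [this.1, this.2]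
      have : (p i = u ∧ q i = v) ∨ (p i = v ∧ q i = u) := e1
      grind
    by_cases i2 : i = c2
    · have : (p i = v ∧ q i = z) ∨ (p i = z ∧ q i = v) := i2 ▸ e2
      grind
    by_cases i3 : i = c3
    · have : (p i = z ∧ q i = w) ∨ (p i = w ∧ q i = z) := i3 ▸ e3
      grind
    by_cases i4 : i = c4
    · have : (p i = w ∧ q i = u) ∨ (p i = u ∧ q i = w) := i4 ▸ e4
      grind
    have : piE u v z w c1 c2 c3 c4 p u i = hh u v z w (p i) ∧
        piE u v z w c1 c2 c3 c4 q v i = hh u v z w (q i) := by simp [piE, *]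
    rw [this.1, this.2]
    have a1 : ¬ (p i = u ∧ q i = z) := fun h => huz ⟨k2, i, Or.inl h⟩
    have a2 : ¬ (p i = z ∧ q i = u) := fun h => huz ⟨k2, i, Or.inr h⟩
    have a3 : ¬ (p i = v ∧ q i = w) := fun h => hvw ⟨k5, i, Or.inl h⟩
    have a4 : ¬ (p i = w ∧ q i = v) := fun h => hvw ⟨k5, i, Or.inr h⟩
    rcases hh_cases u v z w (p i) with h1 | h1 | h1 <;>
      rcases hh_cases u v z w (q i) with h2 | h2 | h2 <;> grind
  unfold ed
  rw [hS, Finset.card_union_of_disjoint]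
  · congr 1
    rw [Finset.card_insert_of_notMem (by simp [n23, n24]), Finset.card_pair n34]
  · rw [Finset.disjoint_right]
    intro i hi
    simp only [Finset.mem_insert, Finset.mem_singleton] at hi
    have i1 : i ≠ c1 := by rintro rfl; tauto
    rw [mem_eds]
    simp [piE, i1, hi]

lemma pi_ed_le {p q : ι → V} {u v z w : V} {c1 c2 c3 c4 : ι} 
    {L L' : Finset V} (huv : ¬ (u ∈ L ∧ v ∈ L))
    (hL : ∀ a, hh u v z w a ∈ L → a ∈ L') :
    ed (piE u v z w c1 c2 c3 c4 p u) (piE u v z w c1 c2 c3 c4 q v) L ≤ ed p q L' := by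
  apply Finset.card_le_card
  intro i
  simp only [mem_eds]
  by_cases i1 : i = c1
  · subst i1
    have : piE u v z w i c2 c3 c4 p u i = u ∧ piE u v z w i c2 c3 c4 q v i = v := by simp [piE]
    rw [this.1, this.2]
    tauto
  by_cases i2 : i = c2 ∨ i = c3 ∨ i = c4
  · simp [piE, i1, i2]
  have : piE u v z w c1 c2 c3 c4 p u i = hh u v z w (p i) ∧
      piE u v z w c1 c2 c3 c4 q v i = hh u v z w (q i) := by simp [piE, *]
  rw [this.1, this.2]
  rintro ⟨h1, h2, h3⟩
  exact ⟨hL _ h1, hL _ h2, fun h => h3 (by rw [h])⟩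

lemma pi_block {p q : ι → V} {U : Finset V} (hr : Red p q U) {u v z w : V} {c1 c2 c3 c4 : ι}
    (h : C4 p q u v z w c1 c2 c3 c4) (hu : u ∈ U) (hv : v ∈ U) (hz : z ∈ U) (hw : w ∈ U)
    (hsub : ∀ W ⊂ U, 3 ≤ W.card → 2 ≤ ff p q W)
    {L : Finset V} (hL : L ⊆ (U.erase z).erase w) (hne : L ≠ (U.erase z).erase w)
    (h1 : 1 ≤ L.card) :
    0 ≤ ff (piE u v z w c1 c2 c3 c4 p u) (piE u v z w c1 c2 c3 c4 q v) L := by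
  obtain ⟨na1, na2⟩ := h.nadj hr hu hv hz hw
  have hzL : z ∉ L := fun h => by have := hL h; simp at this
  have hwL : w ∉ L := fun h => by have := hL h; simp at this
  have hLU : L ⊆ U := fun x hx => by have := hL hx; simp at this; exact this.2.2
  have hLss : L ⊂ U := ⟨hLU, fun hh => hzL (hh hz)⟩
  by_cases hone : L.card = 1
  · unfold ff; rw [ed_one (by omega), hone]; simp
  by_cases huL : u ∈ L <;> by_cases hvL : v ∈ L
  · have he := pi_ed_both h na1 na2 huL hvL hzL hwL
    have hss : insert z (insert w L) ⊂ U := by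
      refine ⟨?_, ?_⟩
      · intro x; simp; rintro (rfl | rfl | hx)
        · exact hz
        · exact hw
        · exact hLU hx
      · intro hh
        apply hne
        apply Finset.Subset.antisymm hL
        intro x hx
        simp only [Finset.mem_erase] at hx
        have := hh hx.2.2
        simp at this; tauto
    have hcard : (insert z (insert w L)).card = L.card + 2 := by
      rw [Finset.card_insert_of_notMem (by simp [h.zw, hzL]), Finset.card_insert_of_notMem hwL]
    have := hsub _ hss (by omega)
    unfold ff at this ⊢
    rw [hcard] at this
    push_cast at this
    omega
  · have he := pi_ed_le (p := p) (q := q) (u := u) (v := v) (z := z) (w := w) (c1 := c1) (c2 := c2)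
      (c3 := c3) (c4 := c4) (L := L) (L' := insert z L) (by tauto) (by
        intro a ha
        rcases hh_cases u v z w a with h' | h' | h' <;> grind)
    have hss : insert z L ⊂ U := by
      refine ⟨?_, ?_⟩
      · intro x; simp; rintro (rfl | hx)
        · exact hz
        · exact hLU hx
      · intro hh
        have := hh hv
        simp [h.vz, hvL] at this
    have hcard : (insert z L).card = L.card + 1 := by
      rw [Finset.card_insert_of_notMem hzL]
    have := hsub _ hss (by omega)
    unfold ff at this ⊢
    rw [hcard] at this
    push_cast at this
    omega
  · have he := pi_ed_le (p := p) (q := q) (u := u) (v := v) (z := z) (w := w) (c1 := c1) (c2 := c2)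
      (c3 := c3) (c4 := c4) (L := L) (L' := insert w L) (by tauto) (by
        intro a ha
        rcases hh_cases u v z w a with h' | h' | h' <;> grind)
    have hss : insert w L ⊂ U := by
      refine ⟨?_, ?_⟩
      · intro x; simp; rintro (rfl | hx)
        · exact hw
        · exact hLU hx
      · intro hh
        have := hh hu
        simp [h.uw, huL] at this
    have hcard : (insert w L).card = L.card + 1 := by
      rw [Finset.card_insert_of_notMem hwL]
    have := hsub _ hss (by omega)
    unfold ff at this ⊢
    rw [hcard] at this
    push_cast at this
    omega
  · have he := pi_ed_le (p := p) (q := q) (u := u) (v := v) (z := z) (w := w) (c1 := c1) (c2 := c2)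
      (c3 := c3) (c4 := c4) (L := L) (L' := L) (by tauto) (by
        intro a ha
        rcases hh_cases u v z w a with h' | h' | h' <;> grind)
    have := hr.f_nonneg hLU h1 (hsub L hLss)
    unfold ff at this ⊢
    omega

lemma pi_step {p q : ι → V} {U : Finset V} (hr : Red p q U) {u v z w : V} {c1 c2 c3 c4 : ι}
    (h : C4 p q u v z w c1 c2 c3 c4) (hu : u ∈ U) (hv : v ∈ U) (hz : z ∈ U) (hw : w ∈ U)
    (hsub : ∀ W ⊂ U, 3 ≤ W.card → 2 ≤ ff p q W) :
    ∃ p' q' U' φ, PS p q U u v z w c1 c2 c3 c4 p' q' U' φ := by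
  obtain ⟨na1, na2⟩ := h.nadj hr hu hv hz hw
  set P := piE u v z w c1 c2 c3 c4 p u with hP
  set Q := piE u v z w c1 c2 c3 c4 q v with hQ
  set U0 := (U.erase z).erase w with hU0
  have mU0 : ∀ x, x ∈ U0 ↔ x ≠ w ∧ x ≠ z ∧ x ∈ U := by intro x; simp [hU0]
  obtain ⟨g, g1, g2, g3, g4⟩ := exists_reduction P Q U0
  have hu0 : u ∈ U0 := by rw [mU0]; exact ⟨h.uw, h.uz, hu⟩
  have hv0 : v ∈ U0 := by rw [mU0]; exact ⟨h.vw, h.vz, hv⟩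
  have hz0 : z ∉ U0 := by rw [mU0]; tauto
  have hw0 : w ∉ U0 := by rw [mU0]; tauto
  have hUins : insert z (insert w U0) = U := by
    ext x; simp only [Finset.mem_insert, mU0]
    constructor
    · rintro (rfl | rfl | hx)
      · exact hz
      · exact hw
      · exact hx.2.2
    · tauto
  have hcard : U.card = U0.card + 2 := by
    rw [← hUins, Finset.card_insert_of_notMem (by simp [h.zw, hz0]),
      Finset.card_insert_of_notMem hw0]
  have hIU : U0.image g ⊆ U0 := by
    intro y hy; obtain ⟨x, hx, rfl⟩ := Finset.mem_image.1 hy; exact g2 x hx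
  have hgU : ∀ x, g x ∈ U0.image g → x ∈ U0 := by
    intro x hx
    by_contra hxn
    rw [g1 x hxn] at hx
    exact hxn (hIU hx)
  have hpos : 1 ≤ (U0.image g).card :=
    Finset.card_pos.2 ⟨g u, Finset.mem_image_of_mem g hu0⟩
  have hUc : 2 ≤ U.card := by
    have : ({u, v} : Finset V) ⊆ U := by intro x; simp; rintro (rfl | rfl) <;> assumption
    have := Finset.card_le_card this
    rw [Finset.card_pair h.uv] at this; exact this
  have htwo : 2 ≤ (U0.image g).card := by
    by_contra hlt
    have h1 : (U0.image g).card ≤ 1 := by omega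
    have hall : (Finset.univ.filter fun x => g x = g u) = U0 := by
      ext x
      simp only [Finset.mem_filter, Finset.mem_univ, true_and]
      constructor
      · intro hx; exact hgU x (hx ▸ Finset.mem_image_of_mem g hu0)
      · intro hx; exact Finset.card_le_one.1 h1 _ (Finset.mem_image_of_mem g hx) _
          (Finset.mem_image_of_mem g hu0)
    have hc := g3 (g u) (Finset.mem_image_of_mem g hu0)
    rw [hall] at hc
    have := pi_coll h hu0 hv0 hz0 hw0 hc
    rw [hUins] at this
    have := hr U (Finset.Subset.refl _) this
    omega
  have hfK : ff P Q U0 = ff p q U - 1 := by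
    have := pi_ed_both h na1 na2 hu0 hv0 hz0 hw0
    rw [hUins, ← hP, ← hQ] at this
    unfold ff; rw [hcard]; push_cast; omega
  have hsum : 0 ≤ ∑ y ∈ U0.image g, ff P Q (Finset.univ.filter fun x => g x = y) := by
    apply Finset.sum_nonneg
    intro y hy
    apply pi_block hr h hu hv hz hw hsub
    · intro x hx
      simp only [Finset.mem_filter, Finset.mem_univ, true_and] at hx
      exact hgU x (hx ▸ hy)
    · intro heq
      have : U0.image g ⊆ {y} := by
        intro y' hy'
        obtain ⟨x, hx, rfl⟩ := Finset.mem_image.1 hy'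
        rw [hU0, ← heq] at hx
        simp at hx; simp [hx]
      have := Finset.card_le_card this
      simp at this; omega
    · obtain ⟨x, hx, rfl⟩ := Finset.mem_image.1 hy
      exact Finset.card_pos.2 ⟨x, by simp⟩
  have hfi := ff_image P Q U0 g hgU
  have hhU : ∀ x ∈ U, hh u v z w x ∈ U0 := by
    intro x hx
    rcases hh_cases u v z w x with h' | h' | h'
    · rw [h'.2]; exact hu0
    · rw [h'.2.2]; exact hv0
    · rw [h'.2.2, mU0]; exact ⟨h'.2.1, h'.1, hx⟩
  have hh0 : ∀ x, x ≠ z → x ≠ w → hh u v z w x = x := by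
    intro x h1 h2; simp [hh, h1, h2]
  refine ⟨g ∘ P, g ∘ Q, U0.image g, fun x => g (hh u v z w x), ?_⟩
  constructor
  · exact g4
  · exact htwo
  · have := Finset.card_image_le (f := g) (s := U0); omega
  · linarith
  · intro x hx; exact Finset.mem_image_of_mem g (hhU x hx)
  · intro x hx
    have : hh u v z w x = x := hh0 x (by rintro rfl; exact hx hz) (by rintro rfl; exact hx hw)
    simp only [this]
    exact g1 x (by rw [mU0]; tauto)
  · intro x hx; exact ((mU0 x).1 (hIU hx)).2.2
  · intro y hy
    obtain ⟨x, hx, rfl⟩ := Finset.mem_image.1 hy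
    have := (mU0 x).1 hx
    exact ⟨x, this.2.2, by simp only [hh0 x this.2.1 this.1]⟩
  · have h1 : hh u v z w z = u := by simp [hh]
    simp only [h1, hh0 u h.uz h.uw]
  · have h1 : hh u v z w w = v := by simp [hh, h.zw.symm]
    simp only [h1, hh0 v h.vz h.vw]
  · simp only [hh0 u h.uz h.uw]; simp [hP, piE]
  · simp only [hh0 v h.vz h.vw]; simp [hQ, piE]
  · intro i hi
    have : i ≠ c1 := by
      have := h.ne
      rintro rfl; tauto
    simp [hP, hQ, piE, this, hi]
  · intro i h1 h2 h3 h4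
    simp [hP, hQ, piE, h1, h2, h3, h4]
  · intro hc x hx y hy x1 x2 y1 y2 hxy
    simp only [hh0 x x1 x2, hh0 y y1 y2] at hxy
    have hinj : Set.InjOn g U0 := Finset.card_image_iff.1 (by omega)
    exact hinj (by simp [mU0, *]) (by simp [mU0, *]) hxy
end Cat

namespace Cat
variable {V ι : Type} [Fintype V] [Fintype ι]

noncomputable def dg (p q : ι → V) (W : Finset V) (y : V) : ℕ := (W.filter fun x => Adj p q y x).card

noncomputable def inc (p q : ι → V) (W : Finset V) (y : V) : Finset ι :=
  (eds p q W).filter fun i => p i = y ∨ q i = y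

lemma inc_card {p q : ι → V} {U W : Finset V} (hr : Red p q U) (hW : W ⊆ U) {y : V} (hy : y ∈ W) :
    (inc p q W y).card = dg p q W y := by
  unfold dg
  apply Finset.card_bij (fun i _ => if p i = y then q i else p i)
  · intro i hi
    simp only [inc, Finset.mem_filter, mem_eds] at hi
    simp only [Finset.mem_filter]
    by_cases h : p i = y
    · simp only [h, if_true]
      refine ⟨hi.1.2.1, ?_, i, Or.inl ⟨h, rfl⟩⟩
      rw [← h]; exact hi.1.2.2
    · simp only [h, if_false]
      have hq : q i = y := by tauto
      refine ⟨hi.1.1, ?_, i, Or.inr ⟨rfl, hq⟩⟩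
      rw [← hq]; exact hi.1.2.2.symm
  · intro i hi j hj hij
    have key : ∀ i ∈ inc p q W y, E p q i y (if p i = y then q i else p i) ∧
        y ≠ (if p i = y then q i else p i) ∧ (if p i = y then q i else p i) ∈ U := by
      intro i hi
      simp only [inc, Finset.mem_filter, mem_eds] at hi
      by_cases h : p i = y
      · simp only [h, if_true]
        refine ⟨Or.inl ⟨h, rfl⟩, ?_, hW hi.1.2.1⟩
        rw [← h]; exact hi.1.2.2
      · simp only [h, if_false]
        have hq : q i = y := by tauto
        refine ⟨Or.inr ⟨rfl, hq⟩, ?_, hW hi.1.1⟩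
        rw [← hq]; exact hi.1.2.2.symm
    obtain ⟨a1, a2, a3⟩ := key i hi
    obtain ⟨b1, b2, b3⟩ := key j hj
    beta_reduce at hij
    rw [← hij] at b1
    exact hr.par (hW hy) a3 a2 a1 b1
  · intro x hx
    simp only [Finset.mem_filter] at hx
    obtain ⟨hxW, hne, i, hi⟩ := hx
    refine ⟨i, ?_, ?_⟩
    · simp only [inc, Finset.mem_filter, mem_eds]
      rcases hi with ⟨h1, h2⟩ | ⟨h1, h2⟩ <;> rw [h1, h2] <;> simp [hne, hne.symm, hy, hxW]
    · rcases hi with ⟨h1, h2⟩ | ⟨h1, h2⟩ <;> rw [h1, h2] <;> simp [hne.symm]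

lemma handshake {p q : ι → V} {U W : Finset V} (hr : Red p q U) (hW : W ⊆ U) :
    ∑ y ∈ W, dg p q W y = 2 * ed p q W := by
  rw [Finset.sum_congr rfl fun y hy => (inc_card hr hW hy).symm]
  unfold inc
  have hdc := Finset.sum_card_bipartiteAbove_eq_sum_card_bipartiteBelow
    (s := eds p q W) (t := W) (r := fun i y => p i = y ∨ q i = y)
  refine Eq.trans (Eq.trans ?_ hdc.symm) ?_
  · apply Finset.sum_congr rfl
    intro y _
    congr 1
  unfold ed
  rw [mul_comm, ← smul_eq_mul, ← Finset.sum_const]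
  apply Finset.sum_congr rfl
  intro i hi
  rw [mem_eds] at hi
  have : Finset.bipartiteAbove (fun i y => p i = y ∨ q i = y) W i = {p i, q i} := by
    ext x; simp [Finset.bipartiteAbove]; grind
  rw [this, Finset.card_pair hi.2.2]

lemma ed_erase {p q : ι → V} {U W : Finset V} (hr : Red p q U) (hW : W ⊆ U) {y : V} (hy : y ∈ W) :
    ed p q W = ed p q (W.erase y) + dg p q W y := by
  rw [← inc_card hr hW hy]
  unfold ed
  rw [← Finset.card_union_of_disjoint]
  · congr 1
    ext i
    simp only [inc, mem_eds, Finset.mem_union, Finset.mem_erase, Finset.mem_filter]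
    tauto
  · rw [Finset.disjoint_left]
    intro i
    simp only [inc, mem_eds, Finset.mem_erase, Finset.mem_filter]
    tauto

lemma ff_erase {p q : ι → V} {U W : Finset V} (hr : Red p q U) (hW : W ⊆ U) {y : V} (hy : y ∈ W) :
    ff p q (W.erase y) = ff p q W - 2 + dg p q W y := by
  have h := ed_erase hr hW hy
  have h2 := Finset.card_erase_add_one hy
  unfold ff
  rw [h, ← h2]; push_cast; ring

def HasC4 (p q : ι → V) (U : Finset V) : Prop :=
  ∃ u v z w c1 c2 c3 c4, u ∈ U ∧ v ∈ U ∧ z ∈ U ∧ w ∈ U ∧ C4 p q u v z w c1 c2 c3 c4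

def IsK2t (p q : ι → V) (U : Finset V) : Prop :=
  ∃ a ∈ U, ∃ b ∈ U, a ≠ b ∧ ∀ x ∈ U, x ≠ a → x ≠ b → Adj p q x a ∧ Adj p q x b

lemma PS.cut {p q : ι → V} {U : Finset V} {u v z w : V} {c1 c2 c3 c4 : ι} {p' q' : ι → V}
    {U' : Finset V} {φ : V → V} (h : C4 p q u v z w c1 c2 c3 c4)
    (hs : PS p q U u v z w c1 c2 c3 c4 p' q' U' φ) {y : V}
    (hyu : y = φ u ↔ y = φ v) :
    crs p q (U.filter fun x => φ x = y) (U.filter fun x => φ x ≠ y) ⊆ inc p' q' U' y := by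
  intro i hi
  rw [mem_crs] at hi
  simp only [Finset.mem_filter] at hi
  have key : ∀ a b, E p q i a b → (φ a = y ↔ φ b = y) → False := by
    intro a b hE hab
    rcases hE with ⟨h1, h2⟩ | ⟨h1, h2⟩ <;> rw [h1, h2] at hi <;> tauto
  have hz := hs.hz
  have hw := hs.hw
  have hyu' : φ u = y ↔ φ v = y := by rw [eq_comm, hyu, eq_comm]
  have n1 : i ≠ c1 := by rintro rfl; exact key _ _ h.e1 hyu'
  have n2 : i ≠ c2 := by rintro rfl; exact key _ _ h.e2 (by rw [hz]; exact hyu'.symm)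
  have n3 : i ≠ c3 := by rintro rfl; exact key _ _ h.e3 (by rw [hz, hw]; exact hyu')
  have n4 : i ≠ c4 := by rintro rfl; exact key _ _ h.e4 (by rw [hw]; exact hyu'.symm)
  obtain ⟨o1, o2⟩ := hs.other i n1 n2 n3 n4
  simp only [inc, Finset.mem_filter, mem_eds]
  rw [o1, o2]
  rcases hi with ⟨⟨a1, a2⟩, b1, b2⟩ | ⟨⟨a1, a2⟩, b1, b2⟩
  · exact ⟨⟨hs.mem _ a1, hs.mem _ b1, fun h => b2 (h ▸ a2)⟩, Or.inl a2⟩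
  · exact ⟨⟨hs.mem _ a1, hs.mem _ b1, fun h => a2 (h.trans b2)⟩, Or.inr b2⟩

lemma filter_disj (U : Finset V) (P : V → Prop) :
    Disjoint (U.filter fun x => P x) (U.filter fun x => ¬ P x) ∧
    (U.filter fun x => P x) ∪ (U.filter fun x => ¬ P x) = U :=
  ⟨Finset.disjoint_filter_filter_not _ _ _, Finset.filter_union_filter_not_eq _ _⟩

lemma two_case {p q : ι → V} {U : Finset V} {u v z w : V} {c1 c2 c3 c4 : ι} {p' q' : ι → V}
    {U' : Finset V} {φ : V → V} (h : C4 p q u v z w c1 c2 c3 c4)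
    (hu : u ∈ U) (hv : v ∈ U) (hz : z ∈ U) (hw : w ∈ U)
    (hs : PS p q U u v z w c1 c2 c3 c4 p' q' U' φ) (h2 : U'.card = 2) :
    ∃ A B, Disjoint A B ∧ A ∪ B = U ∧ B.Nonempty ∧ u ∈ A ∧ z ∈ A ∧
      ((v ∈ A ∧ w ∈ A ∧ (crs p q A B).card ≤ 1) ∨
       (v ∈ B ∧ w ∈ B ∧ crs p q A B ⊆ {c1, c2, c3, c4})) := by
  obtain ⟨d1, d2⟩ := filter_disj U (fun x => φ x = φ u)
  refine ⟨_, _, d1, d2, ?_, ?_, ?_, ?_⟩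
  · obtain ⟨y, hy, hne⟩ := Finset.exists_mem_ne (by omega : 1 < U'.card) (φ u)
    obtain ⟨x, hx, rfl⟩ := hs.surj y hy
    exact ⟨x, by simp [hx, hne]⟩
  · simp [hu]
  · simp [hz, hs.hz]
  · by_cases huv : φ v = φ u
    · left
      refine ⟨by simp [hv, huv], by simp [hw, hs.hw, huv], ?_⟩
      have h1 := Finset.card_le_card (hs.cut h (y := φ u) (by simp [huv]))
      have h3 : (inc p' q' U' (φ u)).card ≤ 1 := by
        refine le_trans ?_ (hs.red.ed_two (Finset.Subset.refl _) h2)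
        exact Finset.card_le_card (Finset.filter_subset _ _)
      exact h1.trans h3
    · right
      refine ⟨by simp [hv, huv], by simp [hw, hs.hw, huv], ?_⟩
      intro i hi
      by_contra hn
      simp only [Finset.mem_insert, Finset.mem_singleton, not_or] at hn
      obtain ⟨o1, o2⟩ := hs.other i hn.1 hn.2.1 hn.2.2.1 hn.2.2.2
      rw [mem_crs] at hi
      simp only [Finset.mem_filter] at hi
      have hU' : ∀ y ∈ U', y ≠ φ u → y = φ v := by
        intro y hy hne
        by_contra hne2
        have : ({y, φ u, φ v} : Finset V) ⊆ U' := by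
          intro x; simp; rintro (rfl | rfl | rfl)
          · exact hy
          · exact hs.mem _ hu
          · exact hs.mem _ hv
        have := Finset.card_le_card this
        rw [Finset.card_insert_of_notMem (by simp [hne, hne2]), Finset.card_pair (Ne.symm huv)] at this
        omega
      have hE : E p' q' i (φ u) (φ v) := by
        rcases hi with ⟨⟨a1, a2⟩, b1, b2⟩ | ⟨⟨a1, a2⟩, b1, b2⟩
        · left; rw [o1, o2]; exact ⟨a2, hU' _ (hs.mem _ b1) b2⟩
        · right; rw [o1, o2]; exact ⟨hU' _ (hs.mem _ a1) a2, b2⟩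
      exact hn.1 (hs.red.par (hs.mem _ hu) (hs.mem _ hv) (Ne.symm huv) hE (Or.inl ⟨hs.p1, hs.q1⟩))

lemma PS.ff_two {p' q' : ι → V} {U' : Finset V} (hr : Red p' q' U') (h2 : U'.card = 2) :
    1 ≤ ff p' q' U' := by
  have := hr.ed_two (Finset.Subset.refl _) h2
  unfold ff; rw [h2]; push_cast; omega

lemma LemmaM {p q : ι → V} {U : Finset V} (hr : Red p q U) (hC : HasC4 p q U)
    (hsub : ∀ W ⊂ U, 3 ≤ W.card → 2 ≤ ff p q W)
    (hK : ∀ (p' q' : ι → V) (U' : Finset V), Red p' q' U' → U'.card + 2 ≤ U.card → 3 ≤ U'.card →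
      2 ≤ ff p' q' U') : 2 ≤ ff p q U := by
  obtain ⟨u, v, z, w, c1, c2, c3, c4, hu, hv, hz, hw, h⟩ := hC
  obtain ⟨p', q', U', φ, hs⟩ := pi_step hr h hu hv hz hw hsub
  by_contra hlt
  have := hs.fle
  have := hs.two
  by_cases h2 : U'.card = 2
  · have := PS.ff_two hs.red h2
    omega
  · have := hK p' q' U' hs.red hs.le (by omega)
    omega

lemma K2t_two {p q : ι → V} {W : Finset V} (hk : IsK2t p q W) {u z : V} (hu : u ∈ W) (hz : z ∈ W)
    (huz : u ≠ z) (hn : ¬ Adj p q u z) :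
    (∀ x ∈ W, x ≠ u → x ≠ z → Adj p q x u ∧ Adj p q x z) ∨
    ∃ a ∈ W, ∃ b ∈ W, ∃ l ∈ W, a ≠ b ∧ l ≠ u ∧ l ≠ z ∧ Adj p q u a ∧ Adj p q u b ∧ Adj p q z a ∧
      Adj p q z b ∧ Adj p q l a ∧ Adj p q l b := by
  obtain ⟨a, ha, b, hb, hab, hall⟩ := hk
  by_cases h1 : u = a
  · by_cases h2 : z = b
    · left; subst h1; subst h2; exact hall
    · exact absurd (Adj_symm (h1 ▸ (hall z hz (h1 ▸ huz.symm) h2).1)) hn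
  by_cases h1' : u = b
  · by_cases h2 : z = a
    · left; subst h1'; subst h2
      intro x hx n1 n2; exact (hall x hx n2 n1).symm
    · exact absurd (Adj_symm (h1' ▸ (hall z hz h2 (h1' ▸ huz.symm)).2)) hn
  have hu' := hall u hu h1 h1'
  have hza : z ≠ a := by rintro rfl; exact hn hu'.1
  have hzb : z ≠ b := by rintro rfl; exact hn hu'.2
  have hz' := hall z hz hza hzb
  by_cases hl : ∃ l ∈ W, l ≠ a ∧ l ≠ b ∧ l ≠ u ∧ l ≠ z
  · obtain ⟨l, hl, l1, l2, l3, l4⟩ := hl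
    have := hall l hl l1 l2
    right
    exact ⟨a, ha, b, hb, l, hl, hab, l3, l4, hu'.1, hu'.2, hz'.1, hz'.2, this.1, this.2⟩
  · left
    push Not at hl
    intro x hx n1 n2
    by_cases x1 : x = a
    · subst x1; exact ⟨Adj_symm hu'.1, Adj_symm hz'.1⟩
    by_cases x2 : x = b
    · subst x2; exact ⟨Adj_symm hu'.2, Adj_symm hz'.2⟩
    exact absurd (hl x hx x1 x2 n1) n2

lemma K2t_common {p q : ι → V} {W : Finset V} (hk : IsK2t p q W) (h3 : 3 ≤ W.card) {u z : V}
    (hu : u ∈ W) (hz : z ∈ W)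
    (huz : u ≠ z) (hn : ¬ Adj p q u z) : ∃ a ∈ W, Adj p q a u ∧ Adj p q a z := by
  rcases K2t_two hk hu hz huz hn with h | ⟨a, ha, b, hb, l, hl, h1, h2, h3, h4, h5, h6, h7, h8, h9⟩
  · obtain ⟨x, hx, hx1⟩ : ∃ x ∈ W, x ∉ ({u, z} : Finset V) := by
      apply Finset.exists_mem_notMem_of_card_lt_card
      rw [Finset.card_pair huz]; omega
    simp at hx1
    exact ⟨x, hx, h x hx hx1.1 hx1.2⟩
  · exact ⟨a, ha, Adj_symm h4, Adj_symm h6⟩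

lemma TCfin {p q : ι → V} {U A B : Finset V} (hr : Red p q U) (hd : Disjoint A B) (hU : A ∪ B = U)
    {u v z w : V} (hu : u ∈ A) (hz : z ∈ A) (huz : u ≠ z) (hn : ¬ Adj p q u z)
    (hv : v ∈ B) (hw : w ∈ B) (hvw : v ≠ w) (hB : B.card = 2)
    (a1 : Adj p q u v) (a2 : Adj p q u w) (a3 : Adj p q z v) (a4 : Adj p q z w)
    (hA : 3 ≤ A.card → IsK2t p q A) : IsK2t p q U := by
  have hAU : A ⊆ U := hU ▸ Finset.subset_union_left
  have hBU : B ⊆ U := hU ▸ Finset.subset_union_right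
  have hBe : B = {v, w} := by
    symm; apply Finset.eq_of_subset_of_card_le
    · intro x; simp; rintro (rfl | rfl) <;> assumption
    · rw [Finset.card_pair hvw]; omega
  have key : (∀ x ∈ A, x ≠ u → x ≠ z → Adj p q x u ∧ Adj p q x z) → IsK2t p q U := by
    intro hall
    refine ⟨u, hAU hu, z, hAU hz, huz, ?_⟩
    intro x hx n1 n2
    rw [← hU, Finset.mem_union] at hx
    rcases hx with hx | hx
    · exact hall x hx n1 n2
    · rw [hBe] at hx; simp at hx
      rcases hx with rfl | rfl
      · exact ⟨Adj_symm a1, Adj_symm a3⟩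
      · exact ⟨Adj_symm a2, Adj_symm a4⟩
  have hdis : ∀ a ∈ A, ∀ b ∈ B, a ≠ b := by
    rintro a ha b hb rfl; exact Finset.disjoint_left.1 hd ha hb
  by_cases h3 : 3 ≤ A.card
  · rcases K2t_two (hA h3) hu hz huz hn with h | ⟨a, ha, b, hb, l, hl, h1, h2, h3, h4, h5, h6, h7, h8, h9⟩
    · exact key h
    · exfalso
      exact hr.K33m (hAU hu) (hAU hz) (hAU hl) (hAU ha) (hAU hb) (hBU hv) huz h2.symm h3.symm h1
        (hdis _ ha _ hv) (hdis _ hb _ hv) (hdis _ hl _ hv) h4 h5 a1 h6 h7 a3 h8 h9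
  · apply key
    intro x hx n1 n2
    exfalso
    have : ({x, u, z} : Finset V) ⊆ A := by
      intro y; simp; rintro (rfl | rfl | rfl) <;> assumption
    have := Finset.card_le_card this
    rw [Finset.card_insert_of_notMem (by simp [n1, n2]), Finset.card_pair huz] at this
    omega

lemma card_ge_two {A : Finset V} {u z : V} (hu : u ∈ A) (hz : z ∈ A) (h : u ≠ z) : 2 ≤ A.card := by
  have := Finset.one_lt_card.2 ⟨u, hu, z, hz, h⟩; omega

lemma f_pair {p q : ι → V} {A : Finset V} {u z : V} (hu : u ∈ A) (hz : z ∈ A) (huz : u ≠ z)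
    (hn : ¬ Adj p q u z) (h3 : 3 ≤ A.card → 2 ≤ ff p q A) : 2 ≤ ff p q A := by
  by_cases h : 3 ≤ A.card
  · exact h3 h
  · have h2 := card_ge_two hu hz huz
    have : A = {u, z} := by
      symm; apply Finset.eq_of_subset_of_card_le
      · intro x; simp; rintro (rfl | rfl) <;> assumption
      · rw [Finset.card_pair huz]; omega
    unfold ff
    rw [this, ed_pair_zero huz hn, Finset.card_pair huz]; simp

lemma TC {p q : ι → V} {U : Finset V} (hr : Red p q U) (hC : HasC4 p q U)
    (hsub : ∀ W ⊂ U, 3 ≤ W.card → 2 ≤ ff p q W ∧ (ff p q W = 2 → IsK2t p q W))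
    (hK : ∀ (p' q' : ι → V) (U' : Finset V), Red p' q' U' → U'.card + 2 ≤ U.card → 3 ≤ U'.card →
      2 ≤ ff p' q' U') (hf : ff p q U ≤ 2) : ff p q U = 2 ∧ IsK2t p q U := by
  refine ⟨le_antisymm hf (LemmaM hr hC (fun W hW h => (hsub W hW h).1) hK), ?_⟩
  obtain ⟨u, v, z, w, c1, c2, c3, c4, hu, hv, hz, hw, h⟩ := hC
  obtain ⟨p', q', U', φ, hs⟩ := pi_step hr h hu hv hz hw (fun W hW h => (hsub W hW h).1)
  have h1 := hs.fle
  have h2 := hs.two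
  have hU'2 : U'.card = 2 := by
    by_contra hne
    have := hK p' q' U' hs.red hs.le (by omega)
    omega
  obtain ⟨na1, na2⟩ := h.nadj hr hu hv hz hw
  obtain ⟨A, B, hd, hU, hBn, huA, hzA, hcase⟩ := two_case h hu hv hz hw hs hU'2
  have hfU := ff_union (p := p) (q := q) hd
  rw [hU] at hfU
  have hAU : A ⊆ U := hU ▸ Finset.subset_union_left
  have hBU : B ⊆ U := hU ▸ Finset.subset_union_right
  have hAss : A ⊂ U := by
    refine ⟨hAU, fun hh => ?_⟩
    obtain ⟨b, hb⟩ := hBn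
    exact Finset.disjoint_left.1 hd (hh (hBU hb)) hb
  have hBss : B ⊂ U := ⟨hBU, fun hh => Finset.disjoint_left.1 hd huA (hh hu)⟩
  rcases hcase with ⟨hvA, hwA, hc⟩ | ⟨hvB, hwB, hc⟩
  · exfalso
    have hA3 : 3 ≤ A.card := by
      have : ({u, v, z} : Finset V) ⊆ A := by
        intro y; simp; rintro (rfl | rfl | rfl) <;> assumption
      have := Finset.card_le_card this
      rw [Finset.card_insert_of_notMem (by simp [h.uv, h.uz]), Finset.card_pair h.vz] at this
      exact this
    have hfA := (hsub A hAss hA3).1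
    have hfB := hr.f_nonneg hBU (Finset.card_pos.2 hBn) (fun h => (hsub B hBss h).1)
    omega
  · have hc4 : (crs p q A B).card ≤ 4 := by
      refine (Finset.card_le_card hc).trans ?_
      exact Finset.card_le_four
    have fA := f_pair huA hzA h.uz na1 (fun h => (hsub A hAss h).1)
    have fB := f_pair hvB hwB h.vw na2 (fun h => (hsub B hBss h).1)
    have kA : 3 ≤ A.card → IsK2t p q A := fun h3 => (hsub A hAss h3).2 (by omega)
    have kB : 3 ≤ B.card → IsK2t p q B := fun h3 => (hsub B hBss h3).2 (by omega)
    have a1 : Adj p q u v := ⟨h.uv, _, h.e1⟩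
    have a2 : Adj p q u w := ⟨h.uw, _, E_symm h.e4⟩
    have a3 : Adj p q z v := ⟨h.vz.symm, _, E_symm h.e2⟩
    have a4 : Adj p q z w := ⟨h.zw, _, h.e3⟩
    have A2 := card_ge_two huA hzA h.uz
    have B2 := card_ge_two hvB hwB h.vw
    by_cases hB : B.card = 2
    · exact TCfin hr hd hU huA hzA h.uz na1 hvB hwB h.vw hB a1 a2 a3 a4 kA
    by_cases hA : A.card = 2
    · exact TCfin hr hd.symm (by rw [Finset.union_comm]; exact hU) hvB hwB h.vw na2 huA hzA h.uz hA
        (Adj_symm a1) (Adj_symm a3) (Adj_symm a2) (Adj_symm a4) kB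
    exfalso
    obtain ⟨a, ha, aa⟩ := K2t_common (kA (by omega)) (by omega) huA hzA h.uz na1
    obtain ⟨b, hb, bb⟩ := K2t_common (kB (by omega)) (by omega) hvB hwB h.vw na2
    have hdis : ∀ a ∈ A, ∀ b ∈ B, a ≠ b := by
      rintro a ha b hb rfl; exact Finset.disjoint_left.1 hd ha hb
    exact hr.K33m hu hz (hBU hb) hv hw (hAU ha) h.uz (hdis _ huA _ hb) (hdis _ hzA _ hb) h.vw
      (hdis _ ha _ hvB).symm (hdis _ ha _ hwB).symm (hdis _ ha _ hb).symm a1 a2 (Adj_symm aa.1)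
      a3 a4 (Adj_symm aa.2) bb.1 bb.2
end Cat

namespace Cat
variable {V ι : Type} [Fintype V] [Fintype ι]

lemma hasC4_of {p q : ι → V} {U : Finset V} {u v z w : V} (hu : u ∈ U) (hv : v ∈ U) (hz : z ∈ U)
    (hw : w ∈ U) (huz : u ≠ z) (hvw : v ≠ w) (a1 : Adj p q u v) (a2 : Adj p q v z)
    (a3 : Adj p q z w) (a4 : Adj p q w u) : HasC4 p q U := by
  obtain ⟨k1, c1, e1⟩ := a1
  obtain ⟨k2, c2, e2⟩ := a2
  obtain ⟨k3, c3, e3⟩ := a3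
  obtain ⟨k4, c4, e4⟩ := a4
  exact ⟨u, v, z, w, c1, c2, c3, c4, hu, hv, hz, hw, k1, huz, k4.symm, k2, hvw, k3, e1, e2, e3, e4⟩

/-- number of neighbours in `D` of vertex `c` is `dg p q D c`; pairs are counted at most once. -/
lemma pigeon {p q : ι → V} (S Q : Finset V)
    (h : ∀ u ∈ S, ∀ z ∈ S, ∀ v ∈ Q, ∀ w ∈ Q, u ≠ z → v ≠ w → Adj p q v u → Adj p q v z →
      Adj p q w u → Adj p q w z → False) :
    ∑ c ∈ Q, (dg p q S c * dg p q S c - dg p q S c) ≤ S.card * S.card - S.card := by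
  rw [← Finset.offDiag_card]
  have : ∀ c ∈ Q, dg p q S c * dg p q S c - dg p q S c =
      (S.filter fun x => Adj p q c x).offDiag.card := by
    intro c _; rw [Finset.offDiag_card]; rfl
  rw [Finset.sum_congr rfl this, ← Finset.card_biUnion]
  · apply Finset.card_le_card
    intro x hx
    simp only [Finset.mem_biUnion, Finset.mem_offDiag, Finset.mem_filter] at hx
    obtain ⟨c, hc, h1, h2, h3⟩ := hx
    simp [h1.1, h2.1, h3]
  · intro v hv w hw hvw
    rw [Function.onFun, Finset.disjoint_left]
    intro x h1 h2
    simp only [Finset.mem_offDiag, Finset.mem_filter] at h1 h2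
    exact h _ h1.1.1 _ h1.2.1.1 v hv w hw h1.2.2 hvw h1.1.2 h1.2.1.2 h2.1.2 h2.2.1.2

lemma dcount (p q : ι → V) (A B : Finset V) :
    ∑ a ∈ A, dg p q B a = ∑ b ∈ B, dg p q A b := by
  have hdc := Finset.sum_card_bipartiteAbove_eq_sum_card_bipartiteBelow
    (s := A) (t := B) (r := fun a b => Adj p q a b)
  refine Eq.trans hdc ?_
  apply Finset.sum_congr rfl
  intro b _
  unfold dg Finset.bipartiteBelow
  congr 1
  ext a
  simp only [Finset.mem_filter]
  exact and_congr_right fun _ => ⟨Adj_symm, Adj_symm⟩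

lemma dg_le (p q : ι → V) {A B : Finset V} (h : A ⊆ B) (x : V) : dg p q A x ≤ dg p q B x :=
  Finset.card_le_card (Finset.filter_subset_filter _ h)

lemma nbrSum {p q : ι → V} {U : Finset V} (hr : Red p q U) (hC : ¬ HasC4 p q U) {v : V} (hv : v ∈ U) :
    ∑ x ∈ U.filter (fun x => Adj p q v x), dg p q U x + 1 ≤ U.card := by
  set N := U.filter (fun x => Adj p q v x) with hN
  have h1 : ∀ x ∈ N, dg p q U x = ((U.filter fun y => Adj p q x y).erase v).card + 1 := by
    intro x hx
    rw [hN, Finset.mem_filter] at hx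
    rw [Finset.card_erase_add_one]; rfl
    simp [hv, Adj_symm hx.2]
  rw [Finset.sum_congr rfl h1, Finset.sum_add_distrib, ← Finset.card_biUnion]
  · have hsub : insert v (N ∪ N.biUnion fun x => (U.filter fun y => Adj p q x y).erase v) ⊆ U := by
      intro y hy
      simp only [Finset.mem_insert, Finset.mem_union, Finset.mem_biUnion, Finset.mem_erase,
        Finset.mem_filter, hN] at hy
      rcases hy with rfl | h | ⟨x, _, h⟩
      · exact hv
      · exact h.1
      · exact h.2.1
    have hc := Finset.card_le_card hsub
    rw [Finset.card_insert_of_notMem, Finset.card_union_of_disjoint] at hc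
    · simp only [Finset.sum_const, smul_eq_mul, mul_one]; omega
    · rw [Finset.disjoint_left]
      intro y hy hy'
      simp only [Finset.mem_biUnion, Finset.mem_erase, Finset.mem_filter, hN] at hy hy'
      obtain ⟨x, hx, h⟩ := hy'
      exact hr.tri hv hx.1 hy.1 hx.2 h.2.2 hy.2
    · simp only [Finset.mem_union, Finset.mem_biUnion, Finset.mem_erase,
        Finset.mem_filter, hN]
      rintro (h | ⟨x, _, h⟩)
      · exact h.2.1 rfl
      · exact h.1 rfl
  · intro x hx x' hx' hne
    rw [Function.onFun, Finset.disjoint_left]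
    intro y hy hy'
    simp only [Finset.mem_erase, Finset.mem_filter, hN, Finset.mem_coe] at hy hy' hx hx'
    exact hC (hasC4_of hv hx.1 hy.2.1 hx'.1 hy.1.symm hne hx.2 hy.2.2 (Adj_symm hy'.2.2)
      (Adj_symm hx'.2))

def Tprop (p q : ι → V) (W : Finset V) : Prop :=
  3 ≤ W.card → 2 ≤ ff p q W ∧ (ff p q W = 2 → IsK2t p q W)

lemma exists_two {N : Finset V} (h : 2 ≤ N.card) : ∃ a ∈ N, ∃ b ∈ N, a ≠ b := by
  obtain ⟨a, ha, b, hb, hab⟩ := Finset.one_lt_card.1 h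
  exact ⟨a, ha, b, hb, hab⟩

lemma three_case {p q : ι → V} {U : Finset V} (hr : Red p q U) (h3 : U.card = 3)
    (hf : ff p q U ≤ 2) : ff p q U = 2 ∧ IsK2t p q U := by
  have hs := handshake hr (Finset.Subset.refl U)
  have hed : 2 ≤ ed p q U := by unfold ff at hf; rw [h3] at hf; push_cast at hf; omega
  obtain ⟨x, hx, hdx⟩ : ∃ x ∈ U, 2 ≤ dg p q U x := by
    by_contra hcon
    push Not at hcon
    have : ∑ y ∈ U, dg p q U y ≤ ∑ y ∈ U, 1 := Finset.sum_le_sum fun y hy => by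
      have := hcon y hy; omega
    simp only [Finset.sum_const, smul_eq_mul, mul_one] at this
    omega
  obtain ⟨a, ha, b, hb, hab⟩ := exists_two hdx
  simp only [Finset.mem_filter] at ha hb
  have hU : U.erase x = {a, b} := by
    symm; apply Finset.eq_of_subset_of_card_le
    · intro y; simp only [Finset.mem_insert, Finset.mem_singleton, Finset.mem_erase]
      rintro (rfl | rfl)
      · exact ⟨ha.2.1.symm, ha.1⟩
      · exact ⟨hb.2.1.symm, hb.1⟩
    · rw [Finset.card_pair hab, Finset.card_erase_of_mem hx]; omega
  have hnab : ¬ Adj p q a b := fun h => hr.tri hx ha.1 hb.1 ha.2 h hb.2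
  have he := ed_erase hr (Finset.Subset.refl U) hx
  rw [hU, ed_pair_zero hab hnab] at he
  have hd2 : dg p q U x ≤ 2 := by
    have : dg p q U x ≤ (U.erase x).card := by
      apply Finset.card_le_card
      intro y hy
      simp only [Finset.mem_filter, Finset.mem_erase] at hy ⊢
      exact ⟨hy.2.1.symm, hy.1⟩
    rw [hU, Finset.card_pair hab] at this; exact this
  refine ⟨?_, a, ha.1, b, hb.1, hab, ?_⟩
  · unfold ff; rw [h3]; push_cast; omega
  · intro y hy n1 n2
    have : y = x := by
      by_contra hne
      have : y ∈ U.erase x := Finset.mem_erase.2 ⟨hne, hy⟩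
      rw [hU] at this; simp at this; tauto
    subst this; exact ⟨ha.2, hb.2⟩

lemma min3 {p q : ι → V} {U : Finset V} (hr : Red p q U) (hC : ¬ HasC4 p q U) (h4 : 4 ≤ U.card)
    (hf : ff p q U ≤ 2) (hsub : ∀ W ⊂ U, Tprop p q W) : ∀ x ∈ U, 3 ≤ dg p q U x := by
  intro x hx
  by_contra hlt
  have hfe := ff_erase hr (Finset.Subset.refl U) hx
  have hce := Finset.card_erase_of_mem hx
  have hW := hsub (U.erase x) (Finset.erase_ssubset hx) (by omega)
  have hk := hW.2 (by omega)
  have hdx : 2 ≤ dg p q U x := by omega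
  obtain ⟨a, ha, b, hb, hab, hall⟩ := hk
  obtain ⟨c, hc, hcn⟩ : ∃ c ∈ U.erase x, c ∉ ({a, b} : Finset V) := by
    apply Finset.exists_mem_notMem_of_card_lt_card
    rw [Finset.card_pair hab]; omega
  simp only [Finset.mem_insert, Finset.mem_singleton, not_or] at hcn
  have hca := hall c hc hcn.1 hcn.2
  have hE : ∀ y ∈ U.erase x, y ∈ U := fun y hy => (Finset.mem_erase.1 hy).2
  have honly : ∀ y ∈ U.erase x, y = a ∨ y = b ∨ y = c := by
    intro y hy
    by_contra hcon
    push Not at hcon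
    have hya := hall y hy hcon.1 hcon.2.1
    exact hC (hasC4_of (hE _ hy) (hE _ ha) (hE _ hc) (hE _ hb) hcon.2.2 hab hya.1 (Adj_symm hca.1)
      hca.2 (Adj_symm hya.2))
  obtain ⟨y1, hy1, y2, hy2, hne⟩ := exists_two hdx
  simp only [Finset.mem_filter] at hy1 hy2
  have o1 := honly y1 (Finset.mem_erase.2 ⟨hy1.2.1.symm, hy1.1⟩)
  have o2 := honly y2 (Finset.mem_erase.2 ⟨hy2.2.1.symm, hy2.1⟩)
  have hxc : x ≠ c := fun h => (Finset.mem_erase.1 hc).1 h.symm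
  have C : Adj p q x a → Adj p q x b → False := fun h1 h2 =>
    hC (hasC4_of hx (hE _ ha) (hE _ hc) (hE _ hb) hxc hab h1 (Adj_symm hca.1) hca.2 (Adj_symm h2))
  have Ta : Adj p q x a → Adj p q x c → False := fun h1 h2 =>
    hr.tri hx (hE _ hc) (hE _ ha) h2 hca.1 h1
  have Tb : Adj p q x b → Adj p q x c → False := fun h1 h2 =>
    hr.tri hx (hE _ hc) (hE _ hb) h2 hca.2 h1
  have h1 := hy1.2
  have h2 := hy2.2
  rcases o1 with rfl | rfl | rfl <;> rcases o2 with rfl | rfl | rfl <;> tauto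

lemma max_deg {p q : ι → V} {U : Finset V} (hr : Red p q U) (hC : ¬ HasC4 p q U)
    (hmin : ∀ x ∈ U, 3 ≤ dg p q U x) : ∀ x ∈ U, 3 * dg p q U x + 1 ≤ U.card := by
  intro x hx
  have h1 := nbrSum hr hC hx
  have h2 : (U.filter fun y => Adj p q x y).card • 3 ≤
      ∑ y ∈ U.filter (fun y => Adj p q x y), dg p q U y :=
    Finset.card_nsmul_le_sum _ _ _ fun y hy => hmin y (Finset.mem_filter.1 hy).1
  have h3 : (U.filter fun y => Adj p q x y).card = dg p q U x := rfl
  rw [h3, smul_eq_mul] at h2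
  omega

lemma sum34 {p q : ι → V} {U : Finset V} (hmin : ∀ x ∈ U, 3 ≤ dg p q U x)
    (hmax : ∀ x ∈ U, dg p q U x ≤ 4) :
    ∑ x ∈ U, dg p q U x = 3 * U.card + (U.filter fun x => dg p q U x = 4).card := by
  rw [Finset.card_filter, mul_comm, ← smul_eq_mul, ← Finset.sum_const, ← Finset.sum_add_distrib]
  apply Finset.sum_congr rfl
  intro x hx
  have := hmin x hx
  have := hmax x hx
  split_ifs <;> omega

lemma dg_split (p q : ι → V) (U : Finset V) (P : V → Prop) (x : V) :
    dg p q U x = dg p q (U.filter fun y => P y) x + dg p q (U.filter fun y => ¬ P y) x := by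
  unfold dg
  rw [← Finset.card_union_of_disjoint, ← Finset.filter_union, Finset.filter_union_filter_not_eq]
  exact Finset.disjoint_filter_filter (Finset.disjoint_filter_filter_not _ _ _)

lemma T13 : ∀ (n : ℕ), n ≤ 13 → ∀ (p q : ι → V) (U : Finset V), U.card = n → Red p q U →
    Tprop p q U := by
  intro n
  induction n using Nat.strong_induction_on with
  | _ n IH =>
  intro hn p q U hU hr h3
  have hsub : ∀ W ⊂ U, Tprop p q W := fun W hW =>
    IH W.card (hU ▸ Finset.card_lt_card hW) (by have := Finset.card_lt_card hW; omega) p q W rfl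
      (hr.mono hW.1)
  suffices hkey : ff p q U ≤ 2 → ff p q U = 2 ∧ IsK2t p q U by
    by_cases hf : ff p q U ≤ 2
    · have := hkey hf
      exact ⟨this.1.ge, fun _ => this.2⟩
    · exact ⟨by omega, by intro h; omega⟩
  intro hf
  by_cases hC : HasC4 p q U
  · exact TC hr hC hsub (fun p' q' U' hr' hc h3' => (IH U'.card (by omega) (by omega) p' q' U' rfl
      hr' h3').1) hf
  by_cases h3' : U.card = 3
  · exact three_case hr h3' hf
  exfalso
  have hmin := min3 hr hC (by omega) hf hsub
  have hmax := max_deg hr hC hmin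
  have hs := handshake hr (Finset.Subset.refl U)
  have hed : 4 * U.card ≤ 2 * ed p q U + 8 := by unfold ff at hf; omega
  have hmax4 : ∀ x ∈ U, dg p q U x ≤ 4 := fun x hx => by have := hmax x hx; omega
  have hs34 := sum34 hmin hmax4
  obtain ⟨x0, hx0⟩ : U.Nonempty := Finset.card_pos.1 (by omega)
  have h10 := hmax x0 hx0
  have hm0 := hmin x0 hx0
  set D := U.filter fun x => dg p q U x = 4 with hD
  by_cases h12 : U.card ≤ 12
  · have : D = ∅ := by
      rw [Finset.eq_empty_iff_forall_notMem]
      intro x hx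
      rw [hD, Finset.mem_filter] at hx
      have := hmax x hx.1
      omega
    rw [this] at hs34
    simp only [Finset.card_empty, add_zero] at hs34
    omega
  have h13 : U.card = 13 := by omega
  set C := U.filter fun x => ¬ dg p q U x = 4 with hCd
  have hcard : D.card + C.card = 13 := by
    rw [← h13]; exact Finset.card_filter_add_card_filter_not _
  have hDC : ∀ x ∈ D, dg p q C x = 4 := by
    intro x hx
    rw [hD, Finset.mem_filter] at hx
    have hsplit : dg p q U x = dg p q D x + dg p q C x := by
      have := dg_split p q U (fun y => dg p q U y = 4) x
      convert this using 2
      · congr 1; ext y; simp only [hD, Finset.mem_filter]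
      · congr 1; ext y; simp only [hCd, Finset.mem_filter]
    have h0 : dg p q D x = 0 := by
      unfold dg
      rw [Finset.card_eq_zero, Finset.eq_empty_iff_forall_notMem]
      intro y hy
      simp only [hD, Finset.mem_filter] at hy
      have h1 := nbrSum hr hC hx.1
      have hyN : y ∈ U.filter (fun y => Adj p q x y) := Finset.mem_filter.2 ⟨hy.1.1, hy.2⟩
      rw [← Finset.add_sum_erase _ _ hyN] at h1
      have h2 : ((U.filter fun y => Adj p q x y).erase y).card • 3 ≤
          ∑ y ∈ (U.filter (fun y => Adj p q x y)).erase y, dg p q U y :=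
        Finset.card_nsmul_le_sum _ _ _ fun y hy =>
          hmin y (Finset.mem_filter.1 (Finset.mem_erase.1 hy).2).1
      rw [Finset.card_erase_of_mem hyN, smul_eq_mul] at h2
      have h3 : (U.filter fun y => Adj p q x y).card = dg p q U x := rfl
      rw [h3, hx.2] at h2
      have := hy.1.2
      omega
    omega
  have hdc := dcount p q D C
  rw [Finset.sum_congr rfl hDC, Finset.sum_const, smul_eq_mul] at hdc
  have hCD3 : ∀ c ∈ C, dg p q D c ≤ 3 := by
    intro c hc
    rw [hCd, Finset.mem_filter] at hc
    have h1 := dg_le p q (Finset.filter_subset (fun x => dg p q U x = 4) U) c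
    rw [← hD] at h1
    have := hmax4 c hc.1
    omega
  have hle : ∑ c ∈ C, dg p q D c ≤ C.card • 3 := Finset.sum_le_card_nsmul C _ 3 hCD3
  rw [smul_eq_mul] at hle
  have hpg := pigeon (p := p) (q := q) D C (by
    intro u hu z hz v hv w hw huz hvw a1 a2 a3 a4
    have hDU : D ⊆ U := Finset.filter_subset _ _
    have hCU : C ⊆ U := Finset.filter_subset _ _
    exact hC (hasC4_of (hDU hu) (hCU hv) (hDU hz) (hCU hw) huz hvw (Adj_symm a1) a2 (Adj_symm a4) a3))
  have hD5 : D.card = 5 := by omega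
  have hC8 : C.card = 8 := by omega
  have hlow : ∑ c ∈ C, 3 * dg p q D c ≤ ∑ c ∈ C, ((dg p q D c * dg p q D c - dg p q D c) + 4) := by
    apply Finset.sum_le_sum
    intro c hc
    have := hCD3 c hc
    generalize dg p q D c = k at *
    interval_cases k <;> simp
  rw [← Finset.mul_sum, Finset.sum_add_distrib, Finset.sum_const, ← hdc, hD5, hC8] at hlow
  rw [hD5] at hpg
  simp only [smul_eq_mul] at hlow
  omega

lemma T13' {p q : ι → V} {U : Finset V} (hr : Red p q U) (h : U.card ≤ 13) : Tprop p q U :=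
  T13 U.card h p q U rfl hr

lemma T14 {p q : ι → V} {U : Finset V} (hr : Red p q U) (h : U.card ≤ 14) (h3 : 3 ≤ U.card) :
    2 ≤ ff p q U := by
  by_cases h13 : U.card ≤ 13
  · exact (T13' hr h13 h3).1
  have h14 : U.card = 14 := by omega
  have hsub : ∀ W ⊂ U, Tprop p q W := fun W hW =>
    T13' (hr.mono hW.1) (by have := Finset.card_lt_card hW; omega)
  by_cases hC : HasC4 p q U
  · exact LemmaM hr hC (fun W hW h3 => (hsub W hW h3).1) (fun p' q' U' hr' hc h3' =>
      (T13' hr' (by omega) h3').1)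
  by_contra hf
  have hmin := min3 hr hC (by omega) (by omega) hsub
  have hmax := max_deg hr hC hmin
  have hs := handshake hr (Finset.Subset.refl U)
  have hed : 4 * U.card ≤ 2 * ed p q U + 6 := by unfold ff at hf; omega
  have hmax4 : ∀ x ∈ U, dg p q U x ≤ 4 := fun x hx => by have := hmax x hx; omega
  have hs34 := sum34 hmin hmax4
  set D := U.filter fun x => dg p q U x = 4 with hD
  set C := U.filter fun x => ¬ dg p q U x = 4 with hCd
  have hcard : D.card + C.card = 14 := by
    rw [← h14]; exact Finset.card_filter_add_card_filter_not _
  have hDC : ∀ x ∈ D, 3 ≤ dg p q C x := by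
    intro x hx
    rw [hD, Finset.mem_filter] at hx
    have hsplit : dg p q U x = dg p q D x + dg p q C x := by
      have := dg_split p q U (fun y => dg p q U y = 4) x
      convert this using 2
      · congr 1; ext y; simp only [hD, Finset.mem_filter]
      · congr 1; ext y; simp only [hCd, Finset.mem_filter]
    have h1 := nbrSum hr hC hx.1
    have h0 : 3 * (U.filter (fun y => Adj p q x y)).card + dg p q D x ≤
        ∑ y ∈ U.filter (fun y => Adj p q x y), dg p q U y := by
      have : dg p q D x =
          ((U.filter (fun y => Adj p q x y)).filter (fun y => dg p q U y = 4)).card := by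
        unfold dg; rw [hD, Finset.filter_filter, Finset.filter_filter]
        congr 1; ext y; simp only [Finset.mem_filter]; unfold dg; tauto
      rw [this, Finset.card_filter (fun y => dg p q U y = 4), mul_comm, ← smul_eq_mul,
        ← Finset.sum_const, ← Finset.sum_add_distrib]
      apply Finset.sum_le_sum
      intro y hy
      have := hmin y (Finset.mem_filter.1 hy).1
      split_ifs <;> omega
    have h3 : (U.filter fun y => Adj p q x y).card = dg p q U x := rfl
    rw [h3] at h0
    omega
  have hdc := dcount p q D C
  have hCD3 : ∀ c ∈ C, dg p q D c ≤ 3 := by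
    intro c hc
    rw [hCd, Finset.mem_filter] at hc
    have h1 := dg_le p q (Finset.filter_subset (fun x => dg p q U x = 4) U) c
    rw [← hD] at h1
    have := hmax4 c hc.1
    omega
  have hle : ∑ c ∈ C, dg p q D c ≤ C.card • 3 := Finset.sum_le_card_nsmul C _ 3 hCD3
  have hge : D.card • 3 ≤ ∑ c ∈ D, dg p q C c := Finset.card_nsmul_le_sum D _ 3 hDC
  rw [smul_eq_mul] at hle hge
  omega
end Cat

namespace Cat
variable {V ι : Type} [Fintype V] [Fintype ι]

lemma K2t_leaf {p q : ι → V} {W : Finset V} (hr : Red p q W) {a b x : V} (ha : a ∈ W)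
    (hall : ∀ x ∈ W, x ≠ a → x ≠ b → Adj p q x a ∧ Adj p q x b) (hx : x ∈ W) (hxa : x ≠ a)
    (hxb : x ≠ b) : dg p q W x ≤ 2 := by
  refine le_trans (Finset.card_le_card (t := {a, b}) ?_) Finset.card_le_two
  intro y hy
  rw [Finset.mem_filter] at hy
  by_contra hn
  simp only [Finset.mem_insert, Finset.mem_singleton, not_or] at hn
  exact hr.tri hx hy.1 ha hy.2 (hall y hy.1 hn.1 hn.2).1 (hall x hx hxa hxb).1

lemma K2t_low {p q : ι → V} {W : Finset V} (hr : Red p q W) (hk : IsK2t p q W) (h3 : 3 ≤ W.card)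
    (u z : V) : ∃ y ∈ W, y ≠ u ∧ y ≠ z ∧ dg p q W y ≤ 2 := by
  obtain ⟨a, ha, b, hb, hab, hall⟩ := hk
  by_cases hl : ∃ x ∈ W, x ≠ a ∧ x ≠ b ∧ x ≠ u ∧ x ≠ z
  · obtain ⟨x, hx, h1, h2, h3, h4⟩ := hl
    exact ⟨x, hx, h3, h4, K2t_leaf hr ha hall hx h1 h2⟩
  push Not at hl
  obtain ⟨y, hy, hyn⟩ : ∃ y ∈ W, y ∉ ({u, z} : Finset V) := by
    apply Finset.exists_mem_notMem_of_card_lt_card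
    have : ({u, z} : Finset V).card ≤ 2 := Finset.card_le_two
    omega
  obtain ⟨x, hx, hxn⟩ : ∃ x ∈ W, x ∉ ({a, b} : Finset V) := by
    apply Finset.exists_mem_notMem_of_card_lt_card
    have : ({a, b} : Finset V).card ≤ 2 := Finset.card_le_two
    omega
  simp only [Finset.mem_insert, Finset.mem_singleton, not_or] at hyn hxn
  have hxab := hall x hx hxn.1 hxn.2
  have hnab : ¬ Adj p q a b := fun h => hr.tri hx ha hb hxab.1 h hxab.2
  refine ⟨y, hy, hyn.1, hyn.2, le_trans (Finset.card_le_card (t := {u, z}) ?_) Finset.card_le_two⟩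
  intro c hc
  rw [Finset.mem_filter] at hc
  by_contra hn
  simp only [Finset.mem_insert, Finset.mem_singleton, not_or] at hn
  have hcc : c = a ∨ c = b := by
    by_contra h; push Not at h; exact hn.2 (hl c hc.1 h.1 h.2 hn.1)
  have hyy : y = a ∨ y = b := by
    by_contra h; push Not at h; exact hyn.2 (hl y hy h.1 h.2 hyn.1)
  rcases hcc with rfl | rfl <;> rcases hyy with rfl | rfl
  · exact hc.2.1 rfl
  · exact hnab (Adj_symm hc.2)
  · exact hnab hc.2
  · exact hc.2.1 rfl

lemma K2t_singles {p q : ι → V} {W Q : Finset V} (hr : Red p q W) (hk : IsK2t p q W) (hQ : Q ⊆ W)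
    (h : ∀ x ∈ Q, 3 ≤ dg p q W x) : Q.card ≤ 2 := by
  obtain ⟨a, ha, b, hb, hab, hall⟩ := hk
  refine le_trans (Finset.card_le_card (t := {a, b}) ?_) Finset.card_le_two
  intro x hx
  by_contra hn
  simp only [Finset.mem_insert, Finset.mem_singleton, not_or] at hn
  have := K2t_leaf hr ha hall (hQ hx) hn.1 hn.2
  have := h x hx
  omega

lemma get_C4 {p q : ι → V} {S Q : Finset V} (h3 : ∀ x ∈ Q, 3 ≤ dg p q S x)
    (hc : S.card * S.card - S.card < 6 * Q.card) :
    ∃ u ∈ S, ∃ z ∈ S, ∃ v ∈ Q, ∃ w ∈ Q, u ≠ z ∧ v ≠ w ∧ Adj p q v u ∧ Adj p q v z ∧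
      Adj p q w u ∧ Adj p q w z := by
  by_contra hn
  have := pigeon (p := p) (q := q) S Q (by
    intro u hu z hz v hv w hw h1 h2 a1 a2 a3 a4
    exact hn ⟨u, hu, z, hz, v, hv, w, hw, h1, h2, a1, a2, a3, a4⟩)
  have h2 : Q.card • 6 ≤ ∑ c ∈ Q, (dg p q S c * dg p q S c - dg p q S c) := by
    apply Finset.card_nsmul_le_sum
    intro x hx
    have := h3 x hx
    apply Nat.le_sub_of_add_le
    nlinarith
  rw [smul_eq_mul] at h2
  omega

lemma pigeon2 {p q : ι → V} {W : Finset V} (hr : Red p q W) (hC : ¬ HasC4 p q W) (S Q : Finset V)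
    (hS : S ⊆ W) (hQ : Q ⊆ W) :
    ∑ c ∈ Q, (dg p q S c * dg p q S c - dg p q S c) + ∑ x ∈ S, dg p q S x
      ≤ S.card * S.card - S.card := by
  rw [← Finset.offDiag_card]
  have : ∀ c ∈ Q, dg p q S c * dg p q S c - dg p q S c =
      (S.filter fun x => Adj p q c x).offDiag.card := by
    intro c _; rw [Finset.offDiag_card]; rfl
  have hs : ∑ x ∈ S, dg p q S x = (S.offDiag.filter fun e => Adj p q e.1 e.2).card := by
    have : (S.offDiag.filter fun e : V × V => Adj p q e.1 e.2)
        = (S.sigma (fun x => S.filter fun y => Adj p q x y)).map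
          (Equiv.sigmaEquivProd V V).toEmbedding := by
      ext ⟨a, b⟩
      simp only [Finset.mem_filter, Finset.mem_offDiag, Finset.mem_map, Finset.mem_sigma]
      constructor
      · rintro ⟨⟨h1, h2, h3⟩, h4⟩
        exact ⟨⟨a, b⟩, ⟨h1, h2, h4⟩, rfl⟩
      · rintro ⟨⟨a', b'⟩, ⟨h1, h2, h4⟩, h⟩
        simp at h
        obtain ⟨rfl, rfl⟩ := h
        exact ⟨⟨h1, h2, h4.1⟩, h4⟩
    rw [this, Finset.card_map, Finset.card_sigma]
    rfl
  rw [Finset.sum_congr rfl this, ← Finset.card_biUnion, hs, ← Finset.card_union_of_disjoint]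
  · apply Finset.card_le_card
    intro x hx
    simp only [Finset.mem_union, Finset.mem_biUnion, Finset.mem_offDiag, Finset.mem_filter] at hx
    rcases hx with ⟨c, hc, h1, h2, h3⟩ | ⟨hx, -⟩
    · simp [h1.1, h2.1, h3]
    · simpa using hx
  · rw [Finset.disjoint_left]
    intro x hx hx2
    simp only [Finset.mem_biUnion, Finset.mem_offDiag, Finset.mem_filter] at hx hx2
    obtain ⟨c, hc, h1, h2, h3⟩ := hx
    exact hr.tri (hQ hc) (hS h1.1) (hS h2.1) h1.2 hx2.2 h2.2
  · intro v hv w hw hvw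
    rw [Function.onFun, Finset.disjoint_left]
    intro x h1 h2
    simp only [Finset.mem_offDiag, Finset.mem_filter] at h1 h2
    exact hC (hasC4_of (hS h1.1.1) (hQ hv) (hS h1.2.1.1) (hQ hw) h1.2.2 hvw (Adj_symm h1.1.2)
      h1.2.1.2 (Adj_symm h2.2.1.2) h2.1.2)

lemma dg_union (p q : ι → V) {S Q : Finset V} (h : Disjoint S Q) (x : V) :
    dg p q (S ∪ Q) x = dg p q S x + dg p q Q x := by
  unfold dg
  rw [Finset.filter_union, Finset.card_union_of_disjoint (Finset.disjoint_filter_filter h)]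

lemma hand2 {p q : ι → V} {S Q : Finset V} (h : Disjoint S Q) (hr : Red p q (S ∪ Q)) :
    2 * ed p q (S ∪ Q) = ∑ x ∈ S, dg p q S x + ∑ x ∈ Q, dg p q Q x + 2 * ∑ x ∈ Q, dg p q S x := by
  rw [← handshake hr (Finset.Subset.refl _), Finset.sum_union h]
  rw [Finset.sum_congr rfl fun x _ => dg_union p q h x, Finset.sum_add_distrib]
  rw [Finset.sum_congr rfl fun x _ => dg_union p q h x, Finset.sum_add_distrib]
  rw [dcount p q S Q]
  ring

lemma ed_ge {p q : ι → V} {S Q : Finset V} (h : Disjoint S Q) (hr : Red p q (S ∪ Q))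
    (h3 : ∀ x ∈ Q, 3 ≤ dg p q S x) : 3 * Q.card ≤ ed p q (S ∪ Q) := by
  have := hand2 h hr
  have h2 : Q.card • 3 ≤ ∑ x ∈ Q, dg p q S x := Finset.card_nsmul_le_sum _ _ _ h3
  rw [smul_eq_mul] at h2
  omega

lemma ff_le {p q : ι → V} {S Q : Finset V} (h : Disjoint S Q) (hr : Red p q (S ∪ Q))
    (h3 : ∀ x ∈ Q, 3 ≤ dg p q S x) : ff p q (S ∪ Q) ≤ 2 * S.card - 2 - Q.card := by
  have := ed_ge h hr h3
  unfold ff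
  rw [Finset.card_union_of_disjoint h]
  omega

lemma SubOK {p q : ι → V} (S Q : Finset V) (hr : Red p q Finset.univ) (hSQ : Disjoint S Q)
    (hQ : ∀ x ∈ Q, ∀ y ∈ Q, ¬ Adj p q x y) (hS : S.card = 7)
    (h3 : ∀ x ∈ Q, 3 ≤ dg p q S x) : ∀ (n : ℕ) (W : Finset V), W.card = n → W ⊆ S ∪ Q → n ≤ 16 →
    3 ≤ n → 2 ≤ ff p q W := by
  intro n
  induction n using Nat.strong_induction_on with
  | _ n IH =>
  intro W hn hW h16 hn3
  have hrW : Red p q W := hr.mono (Finset.subset_univ _)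
  by_cases h14 : W.card ≤ 14
  · exact T14 hrW h14 (by omega)
  by_cases hC : HasC4 p q W
  · apply LemmaM hrW hC
    · intro W' hW' h3'
      have := Finset.card_lt_card hW'
      exact IH W'.card (by omega) W' rfl (hW'.1.trans hW) (by omega) h3'
    · intro p' q' U' hr' hc h3'
      exact T14 hr' (by omega) h3'
  set S' := W ∩ S with hS'
  set Q' := W ∩ Q with hQ'
  have hWu : W = S' ∪ Q' := by rw [hS', hQ', ← Finset.inter_union_distrib_left]; exact (Finset.inter_eq_left.2 hW).symm
  have hdis : Disjoint S' Q' := hSQ.mono Finset.inter_subset_right Finset.inter_subset_right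
  have hcard : W.card = S'.card + Q'.card := by
    conv_lhs => rw [hWu]
    exact Finset.card_union_of_disjoint hdis
  have hSle : S'.card ≤ 7 := hS ▸ Finset.card_le_card Finset.inter_subset_right
  have hQ0 : ∑ x ∈ Q', dg p q Q' x = 0 := by
    apply Finset.sum_eq_zero
    intro x hx
    unfold dg
    rw [Finset.card_eq_zero, Finset.filter_eq_empty_iff]
    intro y hy
    exact hQ x (Finset.mem_inter.1 hx).2 y (Finset.mem_inter.1 hy).2
  have hp := pigeon2 hrW hC S' Q' Finset.inter_subset_left Finset.inter_subset_left
  have hh := hand2 hdis (hr.mono (Finset.subset_univ _))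
  rw [← hWu, hQ0] at hh
  by_cases h7 : S'.card = 7
  · exfalso
    have hSS : S' = S := Finset.eq_of_subset_of_card_le Finset.inter_subset_right (by omega)
    have h2 : Q'.card • 6 ≤ ∑ c ∈ Q', (dg p q S' c * dg p q S' c - dg p q S' c) := by
      apply Finset.card_nsmul_le_sum
      intro x hx
      have := h3 x (Finset.mem_inter.1 hx).2
      rw [hSS]
      apply Nat.le_sub_of_add_le
      nlinarith
    rw [smul_eq_mul] at h2
    rw [h7] at hp
    omega
  · have h2 : ∑ c ∈ Q', 2 * dg p q S' c ≤ ∑ c ∈ Q', ((dg p q S' c * dg p q S' c - dg p q S' c) + 2) := by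
      apply Finset.sum_le_sum
      intro x hx
      generalize dg p q S' x = d
      rcases Nat.lt_or_ge d 1 with h | h
      · interval_cases d; simp
      · have : d * d - d = d * (d - 1) := by rw [Nat.mul_sub, mul_one]
        rw [this]
        obtain ⟨e, rfl⟩ := Nat.exists_eq_add_of_le h
        rw [Nat.add_sub_cancel_left]
        nlinarith [Nat.le_mul_self e, e.zero_le]
    rw [← Finset.mul_sum, Finset.sum_add_distrib, Finset.sum_const, smul_eq_mul] at h2
    unfold ff
    have hs6 : S'.card ≤ 6 := by omega
    rw [hcard]
    have hq9 : 9 ≤ Q'.card := by omega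
    generalize S'.card = s at *
    interval_cases s <;> omega
end Cat

namespace Cat
variable {V ι : Type} [Fintype V] [Fintype ι]

lemma C4.rot {p q : ι → V} {u v z w : V} {c1 c2 c3 c4 : ι} (h : C4 p q u v z w c1 c2 c3 c4) :
    C4 p q v z w u c2 c3 c4 c1 :=
  ⟨h.vz, h.vw, h.uv.symm, h.zw, h.uz.symm, h.uw.symm, h.e2, h.e3, h.e4, h.e1⟩

lemma side {p q : ι → V} (hr : Red p q Finset.univ) {u v z w : V} {c1 c2 c3 c4 : ι}
    (h : C4 p q u v z w c1 c2 c3 c4) (hδ : ∀ x, 3 ≤ dg p q Finset.univ x) {A B : Finset V}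
    (hd : Disjoint A B) (hU : A ∪ B = Finset.univ) (hu : u ∈ A) (hz : z ∈ A) (hv : v ∈ B)
    (hw : w ∈ B) (hc : crs p q A B ⊆ {c1, c2, c3, c4}) :
    3 ≤ A.card ∧ ¬ IsK2t p q A := by
  have hun := fun x => Finset.mem_univ (α := V) x
  have hdA : ∀ y, 3 ≤ dg p q A y + dg p q B y := by
    intro y; rw [← dg_union p q hd, hU]; exact hδ y
  have hdis : ∀ a ∈ A, ∀ b ∈ B, a ≠ b := fun a ha b hb hab => Finset.disjoint_left.1 hd ha (hab ▸ hb)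
  have hedge : ∀ a ∈ A, ∀ b ∈ B, Adj p q a b → (a = u ∨ a = z) ∧ (b = v ∨ b = w) := by
    intro a ha b hb hab
    obtain ⟨hne, i, hi⟩ := hab
    have hm : i ∈ crs p q A B := by
      rw [mem_crs]; rcases hi with ⟨rfl, rfl⟩ | ⟨rfl, rfl⟩
      · exact Or.inl ⟨ha, hb⟩
      · exact Or.inr ⟨hb, ha⟩
    have := hc hm
    simp only [Finset.mem_insert, Finset.mem_singleton] at this
    have d1 := hdis a ha v hv
    have d2 := hdis a ha w hw
    rcases this with rfl | rfl | rfl | rfl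
    · rcases E_eq hi h.e1 with ⟨e, f⟩ | ⟨e, f⟩ <;> tauto
    · rcases E_eq hi h.e2 with ⟨e, f⟩ | ⟨e, f⟩ <;> tauto
    · rcases E_eq hi h.e3 with ⟨e, f⟩ | ⟨e, f⟩ <;> tauto
    · rcases E_eq hi h.e4 with ⟨e, f⟩ | ⟨e, f⟩ <;> tauto
  have hB2 : ∀ a ∈ A, dg p q B a ≤ 2 := by
    intro a ha
    refine le_trans (Finset.card_le_card (t := {v, w}) ?_) Finset.card_le_two
    intro y hy
    rw [Finset.mem_filter] at hy
    simpa using (hedge a ha y hy.1 hy.2).2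
  have hB0 : ∀ a ∈ A, a ≠ u → a ≠ z → dg p q B a = 0 := by
    intro a ha h1 h2
    unfold dg
    rw [Finset.card_eq_zero, Finset.filter_eq_empty_iff]
    intro y hy hay
    have := (hedge a ha y hy hay).1
    tauto
  have h3 : 3 ≤ A.card := by
    by_contra hlt
    have hsub : ({u, z} : Finset V) ⊆ A := by
      intro x; simp only [Finset.mem_insert, Finset.mem_singleton]; rintro (rfl | rfl) <;> assumption
    have hA : A = {u, z} := (Finset.eq_of_subset_of_card_le hsub (by
      rw [Finset.card_pair h.uz]; omega)).symm
    have h0 : dg p q A u = 0 := by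
      unfold dg
      rw [Finset.card_eq_zero, Finset.filter_eq_empty_iff]
      intro y hy hay
      rw [hA] at hy
      simp only [Finset.mem_insert, Finset.mem_singleton] at hy
      rcases hy with rfl | rfl
      · exact hay.1 rfl
      · exact (h.nadj hr (hun _) (hun _) (hun _) (hun _)).1 hay
    have := hB2 u hu
    have := hdA u
    omega
  refine ⟨h3, fun hk => ?_⟩
  obtain ⟨y, hy, h1, h2, hdy⟩ := K2t_low (hr.mono (Finset.subset_univ A)) hk h3 u z
  have := hB0 y hy h1 h2
  have := hdA y
  omega

lemma PS_C4 {p q : ι → V} {u v z w : V} {c1 c2 c3 c4 : ι} {p' q' : ι → V} {U' : Finset V}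
    {φ : V → V} (h : C4 p q u v z w c1 c2 c3 c4)
    (hs : PS p q Finset.univ u v z w c1 c2 c3 c4 p' q' U' φ) {S Q : Finset V}
    (hSQ : Disjoint S Q) (hS : S.card = 7) (hQ : 9 ≤ Q.card) (h3 : ∀ x ∈ Q, 3 ≤ dg p q S x)
    (hu : u ∈ S) (hz : z ∈ S) (hv : v ∈ Q) (hw : w ∈ Q)
    (hcard : U'.card + 2 = (Finset.univ : Finset V).card) : HasC4 p' q' U' := by
  have hun := fun x => Finset.mem_univ (α := V) x
  have hinj := hs.inj hcard
  have hdis : ∀ a ∈ S, ∀ b ∈ Q, a ≠ b := fun a ha b hb hab => Finset.disjoint_left.1 hSQ ha (hab ▸ hb)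
  -- adjacency transfers
  have hE : ∀ x ∈ Q, x ≠ v → x ≠ w → ∀ s ∈ S, ∀ i, E p q i x s → E p' q' i (φ x) (φ s) := by
    intro x hx hxv hxw s hs' i hi
    have hxu := hdis u hu x hx
    have hxz := hdis z hz x hx
    have n1 : i ≠ c1 := E_ne hi h.e1 (by tauto)
    have n2 : i ≠ c2 := E_ne hi h.e2 (by tauto)
    have n3 : i ≠ c3 := E_ne hi h.e3 (by tauto)
    have n4 : i ≠ c4 := E_ne hi h.e4 (by tauto)
    obtain ⟨o1, o2⟩ := hs.other i n1 n2 n3 n4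
    unfold E
    rw [o1, o2]
    rcases hi with ⟨rfl, rfl⟩ | ⟨rfl, rfl⟩ <;> simp
  have hne : ∀ x ∈ Q, x ≠ w → ∀ s ∈ S, φ x ≠ φ s := by
    intro x hx hxw s hs' heq
    have hxz := (hdis z hz x hx).symm
    by_cases hsz : s = z
    · rw [hsz, hs.hz] at heq
      exact hdis u hu x hx (hinj x (hun _) u (hun _) hxz hxw h.uz h.uw heq).symm
    · exact hdis s hs' x hx (hinj x (hun _) s (hun _) hxz hxw hsz (hdis s hs' w hw) heq).symm
  have hA : ∀ x ∈ Q, x ≠ v → x ≠ w → ∀ s ∈ S, Adj p q x s → Adj p' q' (φ x) (φ s) := by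
    rintro x hx hxv hxw s hs' ⟨-, i, hi⟩
    exact ⟨hne x hx hxw s hs', i, hE x hx hxv hxw s hs' i hi⟩
  have hinjS : ∀ x ∈ Q, x ≠ v → x ≠ w → ∀ s ∈ S, ∀ t ∈ S, Adj p q x s → Adj p q x t → φ s = φ t →
      s = t := by
    rintro x hx hxv hxw s hs' t ht ⟨nes, i, hi⟩ ⟨net, j, hj⟩ heq
    have e1 := hE x hx hxv hxw s hs' i hi
    have e2 := hE x hx hxv hxw t ht j hj
    rw [← heq] at e2
    have : i = j := hs.red.par (hs.mem x (hun _)) (hs.mem s (hun _)) (hne x hx hxw s hs') e1 e2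
    subst this
    rcases E_eq hi hj with h | h
    · exact h.2
    · exact absurd h.1 net
  set S1 := (S.erase z).image φ with hS1
  set Q0 := (Q.erase v).erase w with hQ0
  set Q1 := Q0.image φ with hQ1
  have hSc : S1.card ≤ 6 := by
    refine le_trans Finset.card_image_le ?_
    rw [Finset.card_erase_of_mem hz]; omega
  have hQm : ∀ x ∈ Q0, x ∈ Q ∧ x ≠ v ∧ x ≠ w := by
    intro x hx; simp only [hQ0, Finset.mem_erase] at hx; tauto
  have hQc : 7 ≤ Q1.card := by
    rw [hQ1, Finset.card_image_of_injOn]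
    · rw [hQ0, Finset.card_erase_of_mem (Finset.mem_erase.2 ⟨h.vw.symm, hw⟩),
        Finset.card_erase_of_mem hv]; omega
    · intro x hx y hy hxy
      have a := hQm x hx
      have b := hQm y hy
      exact hinj x (hun _) y (hun _) (hdis z hz x a.1).symm a.2.2 (hdis z hz y b.1).symm b.2.2 hxy
  have hd3 : ∀ y ∈ Q1, 3 ≤ dg p' q' S1 y := by
    intro y hy
    obtain ⟨x, hx, rfl⟩ := Finset.mem_image.1 hy
    obtain ⟨hx1, hx2, hx3⟩ := hQm x hx
    refine le_trans (h3 x hx1) ?_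
    have : dg p q S x = ((S.filter fun s => Adj p q x s).image φ).card := by
      rw [Finset.card_image_of_injOn]; rfl
      intro s hs' t ht heq
      simp only [Finset.coe_filter, Set.mem_setOf_eq] at hs' ht
      exact hinjS x hx1 hx2 hx3 s hs'.1 t ht.1 hs'.2 ht.2 heq
    rw [this]
    apply Finset.card_le_card
    intro t ht
    obtain ⟨s, hs', rfl⟩ := Finset.mem_image.1 ht
    rw [Finset.mem_filter] at hs'
    refine Finset.mem_filter.2 ⟨?_, hA x hx1 hx2 hx3 s hs'.1 hs'.2⟩
    by_cases hsz : s = z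
    · rw [hsz, hs.hz]
      exact Finset.mem_image_of_mem _ (Finset.mem_erase.2 ⟨h.uz, hu⟩)
    · exact Finset.mem_image_of_mem _ (Finset.mem_erase.2 ⟨hsz, hs'.1⟩)
  have hlt : S1.card * S1.card - S1.card < 6 * Q1.card := by
    generalize S1.card = k at *
    interval_cases k <;> omega
  obtain ⟨a, ha, b, hb, c, hc, d, hd, n1, n2, a1, a2, a3, a4⟩ := get_C4 hd3 hlt
  have hS1U : ∀ x ∈ S1, x ∈ U' := by
    intro x hx; obtain ⟨y, _, rfl⟩ := Finset.mem_image.1 hx; exact hs.mem y (hun _)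
  have hQ1U : ∀ x ∈ Q1, x ∈ U' := by
    intro x hx; obtain ⟨y, _, rfl⟩ := Finset.mem_image.1 hx; exact hs.mem y (hun _)
  exact hasC4_of (hS1U _ ha) (hQ1U _ hc) (hS1U _ hb) (hQ1U _ hd) n1 n2 (Adj_symm a1) a2
    (Adj_symm a4) a3

lemma seven {p q : ι → V} (hr : Red p q Finset.univ) {S Q : Finset V}
    (hcut : ∀ A B : Finset V, Disjoint A B → A ∪ B = Finset.univ → A.Nonempty → B.Nonempty →
      3 ≤ (crs p q A B).card)
    (hδ : ∀ x, 3 ≤ dg p q Finset.univ x)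
    (hSQ : Disjoint S Q) (hU : S ∪ Q = Finset.univ) (hS : S.card = 7)
    (hQc : Q.card = 9 ∨ Q.card = 10)
    (hQ : ∀ x ∈ Q, ∀ y ∈ Q, ¬ Adj p q x y)
    (h3 : ∀ x ∈ Q, 3 ≤ dg p q S x) : False := by
  have hun := fun x => Finset.mem_univ (α := V) x
  have hcard : (Finset.univ : Finset V).card = 7 + Q.card := by
    rw [← hU, Finset.card_union_of_disjoint hSQ, hS]
  have hf : ff p q Finset.univ ≤ 12 - Q.card := by
    have := ff_le hSQ (by rw [hU]; exact hr) h3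
    rw [hU, hS] at this
    push_cast at this
    omega
  have hsub : ∀ W ⊂ (Finset.univ : Finset V), 3 ≤ W.card → 2 ≤ ff p q W := by
    intro W hW h3'
    have := Finset.card_lt_card hW
    exact SubOK S Q hr hSQ hQ hS h3 W.card W rfl (by rw [hU]; exact Finset.subset_univ _)
      (by omega) h3'
  obtain ⟨u, hu, z, hz, v, hv, w, hw, huz, hvw, a1, a2, a3, a4⟩ :=
    get_C4 (p := p) (q := q) h3 (by rw [hS]; omega)
  have hdis : ∀ a ∈ S, ∀ b ∈ Q, a ≠ b := fun a ha b hb hab => Finset.disjoint_left.1 hSQ ha (hab ▸ hb)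
  obtain ⟨c1, e1⟩ := a1.2
  obtain ⟨c2, e2⟩ := a2.2
  obtain ⟨c3, e3⟩ := a4.2
  obtain ⟨c4, e4⟩ := a3.2
  have h : C4 p q u v z w c1 c2 c3 c4 := ⟨hdis u hu v hv, huz, hdis u hu w hw, (hdis z hz v hv).symm,
    hvw, hdis z hz w hw, E_symm e1, e2, E_symm e3, e4⟩
  obtain ⟨p', q', U', φ, hs⟩ := pi_step hr h (hun _) (hun _) (hun _) (hun _) hsub
  have hle := hs.le
  have hfle := hs.fle
  have h2 := hs.two
  -- two-vertex case
  by_cases hU2 : U'.card = 2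
  · obtain ⟨A, B, hd, hAB, hB, huA, hzA, hcase⟩ :=
      two_case h (hun _) (hun _) (hun _) (hun _) hs hU2
    have h3c := hcut A B hd hAB ⟨u, huA⟩ hB
    rcases hcase with ⟨_, _, hc⟩ | ⟨hvB, hwB, hc⟩
    · omega
    · have sA := side hr h hδ hd hAB huA hzA hvB hwB hc
      have hc' : crs p q B A ⊆ {c2, c3, c4, c1} := by
        intro i hi
        have : i ∈ crs p q A B := by rw [mem_crs] at hi ⊢; tauto
        have := hc this
        simp only [Finset.mem_insert, Finset.mem_singleton] at this ⊢
        tauto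
      have sB := side hr h.rot hδ hd.symm (by rw [Finset.union_comm]; exact hAB) hvB hwB hzA huA hc'
      have hc4 : (crs p q A B).card ≤ 4 := (Finset.card_le_card hc).trans Finset.card_le_four
      have hfu := ff_union (p := p) (q := q) hd
      rw [hAB] at hfu
      have hcc : A.card + B.card = 7 + Q.card := by
        rw [← hcard, ← hAB, Finset.card_union_of_disjoint hd]
      have fA := T14 (hr.mono (Finset.subset_univ A))
      have fB := T14 (hr.mono (Finset.subset_univ B))
      have kA := fun hx => T13' (hr.mono (Finset.subset_univ A)) hx sA.1
      have kB := fun hx => T13' (hr.mono (Finset.subset_univ B)) hx sB.1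
      have fA := fA (by omega) sA.1
      have fB := fB (by omega) sB.1
      have nA : A.card ≤ 13 → ff p q A ≠ 2 := fun hx hy => sA.2 ((kA hx).2 hy)
      have nB : B.card ≤ 13 → ff p q B ≠ 2 := fun hx hy => sB.2 ((kB hx).2 hy)
      rcases hQc with hQc | hQc
      · have := nA (by omega)
        have := nB (by omega)
        omega
      · by_cases hA8 : A.card ≤ 8
        · have := nA (by omega)
          omega
        · have := nB (by omega)
          omega
  rcases hQc with hQc | hQc
  · have hk : IsK2t p' q' U' := by
      by_cases h13 : U'.card ≤ 13
      · have := T13' hs.red h13 (by omega)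
        exact this.2 (by omega)
      · refine (TC hs.red (PS_C4 h hs hSQ hS (by omega) h3 hu hz hv hw (by omega)) ?_ ?_ (by omega)).2
        · intro W hW
          exact T13' (hs.red.mono hW.1) (by have := Finset.card_lt_card hW; omega)
        · intro p2 q2 U2 hr2 hc2 h32
          exact T14 hr2 (by omega) h32
    obtain ⟨y, hy, hyu, hyv, hdy⟩ := K2t_low hs.red hk (by omega) (φ u) (φ v)
    have hcc := Finset.card_le_card (PS.cut h hs (y := y) (by tauto))
    rw [inc_card hs.red (Finset.Subset.refl _) hy] at hcc
    have := hcut (Finset.univ.filter fun x => φ x = y) (Finset.univ.filter fun x => φ x ≠ y)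
      (Finset.disjoint_filter_filter_not _ _ _) (Finset.filter_union_filter_not_eq _ _)
      (by obtain ⟨x, _, hx⟩ := hs.surj y hy; exact ⟨x, by simp [hx]⟩)
      ⟨u, by simp [hyu.symm]⟩
    omega
  · have : 2 ≤ ff p' q' U' := by
      by_cases h14 : U'.card ≤ 14
      · exact T14 hs.red h14 (by omega)
      · apply LemmaM hs.red (PS_C4 h hs hSQ hS (by omega) h3 hu hz hv hw (by omega))
        · intro W hW h3'
          exact T14 (hs.red.mono hW.1) (by have := Finset.card_lt_card hW; omega) h3'
        · intro p2 q2 U2 hr2 hc2 h32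
          exact T14 hr2 (by omega) h32
    omega
end Cat

namespace Cat
variable {V ι : Type} [Fintype V] [Fintype ι]

/-- A barrier: many odd components after deleting `S`. -/
structure Bar (p q : ι → V) (S : Finset V) (𝒞 : Finset (Finset V)) : Prop where
  odd : ∀ C ∈ 𝒞, Odd C.card
  dS : ∀ C ∈ 𝒞, Disjoint C S
  dis : ∀ C ∈ 𝒞, ∀ D ∈ 𝒞, C ≠ D → Disjoint C D
  nbr : ∀ C ∈ 𝒞, ∀ x ∈ C, ∀ y, Adj p q x y → y ∈ C ∨ y ∈ S
  card : S.card + 2 ≤ 𝒞.card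

lemma Bar.split {p q : ι → V} {S : Finset V} {𝒞 : Finset (Finset V)} (h : Bar p q S 𝒞) {x y z : V}
    (hC : ({x, y, z} : Finset V) ∈ 𝒞) (hxy : x ≠ y) (hxz : x ≠ z) (hyz : y ≠ z)
    (hn : ¬ Adj p q x y) : ∃ S' 𝒞', Bar p q S' 𝒞' ∧ S'.card = S.card + 1 := by
  have hz : z ∉ S := fun hz => Finset.disjoint_left.1 (h.dS _ hC) (by simp) hz
  have hx : x ∉ S := fun hz => Finset.disjoint_left.1 (h.dS _ hC) (by simp) hz
  have hy : y ∉ S := fun hz => Finset.disjoint_left.1 (h.dS _ hC) (by simp) hz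
  have hout : ∀ D ∈ 𝒞.erase {x, y, z}, x ∉ D ∧ y ∉ D ∧ z ∉ D := by
    intro D hD
    rw [Finset.mem_erase] at hD
    have := h.dis D hD.2 _ hC hD.1
    rw [Finset.disjoint_right] at this
    exact ⟨this (by simp), this (by simp), this (by simp)⟩
  have n1 : ({y} : Finset V) ∉ 𝒞.erase {x, y, z} := fun hh => (hout _ hh).2.1 (by simp)
  have n2 : ({x} : Finset V) ∉ insert {y} (𝒞.erase {x, y, z}) := by
    rw [Finset.mem_insert, not_or]
    exact ⟨by simpa using hxy, fun hh => (hout _ hh).1 (by simp)⟩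
  have hn1 := h.nbr _ hC x (by simp)
  have hn2 := h.nbr _ hC y (by simp)
  refine ⟨insert z S, insert {x} (insert {y} (𝒞.erase {x, y, z})), ⟨?_, ?_, ?_, ?_, ?_⟩,
    Finset.card_insert_of_notMem hz⟩
  · intro C hC'
    simp only [Finset.mem_insert] at hC'
    rcases hC' with rfl | rfl | hC'
    · simp
    · simp
    · exact h.odd C (Finset.mem_erase.1 hC').2
  · intro C hC'
    simp only [Finset.mem_insert] at hC'
    rcases hC' with rfl | rfl | hC'
    · simp [hxz, hx]
    · simp [hyz, hy]
    · rw [Finset.disjoint_insert_right]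
      exact ⟨(hout C hC').2.2, h.dS C (Finset.mem_erase.1 hC').2⟩
  · intro C hC' D hD hCD
    simp only [Finset.mem_insert] at hC' hD
    rcases hC' with rfl | rfl | hC' <;> rcases hD with rfl | rfl | hD
    · exact absurd rfl hCD
    · simpa using hxy
    · simpa using (hout _ hD).1
    · simpa using hxy.symm
    · exact absurd rfl hCD
    · simpa using (hout _ hD).2.1
    · simpa using (hout _ hC').1
    · simpa using (hout _ hC').2.1
    · exact h.dis C (Finset.mem_erase.1 hC').2 D (Finset.mem_erase.1 hD).2 hCD
  · intro C hC' a ha b hab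
    simp only [Finset.mem_insert] at hC'
    rcases hC' with rfl | rfl | hC'
    · simp only [Finset.mem_singleton] at ha
      subst ha
      have := hn1 b hab
      simp only [Finset.mem_insert, Finset.mem_singleton] at this ⊢
      rcases this with (h | h | h) | h
      · exact Or.inl h
      · subst h; exact absurd hab hn
      · exact Or.inr (Or.inl h)
      · exact Or.inr (Or.inr h)
    · simp only [Finset.mem_singleton] at ha
      subst ha
      have := hn2 b hab
      simp only [Finset.mem_insert, Finset.mem_singleton] at this ⊢
      rcases this with (h | h | h) | h
      · subst h; exact absurd (Adj_symm hab) hn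
      · exact Or.inl h
      · exact Or.inr (Or.inl h)
      · exact Or.inr (Or.inr h)
    · rcases h.nbr C (Finset.mem_erase.1 hC').2 a ha b hab with h | h
      · exact Or.inl h
      · exact Or.inr (Finset.mem_insert_of_mem h)
  · rw [Finset.card_insert_of_notMem n2, Finset.card_insert_of_notMem n1,
      Finset.card_insert_of_notMem hz, Finset.card_erase_of_mem hC]
    have := h.card
    omega

lemma ff_singleton (p q : ι → V) {S : Finset V} (h : S.card = 1) : ∀ x ∈ S, dg p q S x = 0 := by
  obtain ⟨a, rfl⟩ := Finset.card_eq_one.1 h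
  intro x hx
  simp only [Finset.mem_singleton] at hx
  subst hx
  unfold dg
  rw [Finset.card_eq_zero, Finset.filter_eq_empty_iff]
  intro y hy hxy
  simp only [Finset.mem_singleton] at hy
  exact hxy.1 hy.symm

lemma no_bar {p q : ι → V} (hr : Red p q Finset.univ)
    (hcut : ∀ A B : Finset V, Disjoint A B → A ∪ B = Finset.univ → A.Nonempty → B.Nonempty →
      3 ≤ (crs p q A B).card)
    (hδ : ∀ x, 3 ≤ dg p q Finset.univ x) (hcard : Fintype.card V ≤ 17) :
    ∀ (m : ℕ) (S : Finset V) (𝒞 : Finset (Finset V)), Fintype.card V - S.card = m →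
      Bar p q S 𝒞 → False := by
  intro m
  induction m using Nat.strong_induction_on with
  | _ m IH =>
  intro S 𝒞 hm h
  have hun := fun x => Finset.mem_univ (α := V) x
  have hrm : ∀ W, Red p q W := fun W => hr.mono (Finset.subset_univ W)
  have hmax : ∀ S' 𝒞', Bar p q S' 𝒞' → S'.card = S.card + 1 → False := by
    intro S' 𝒞' h' hc
    have := Finset.card_le_univ S'
    exact IH (Fintype.card V - S'.card) (by omega) S' 𝒞' rfl h'
  have hC3 : ∀ C ∈ 𝒞, C.card ≠ 3 := by
    intro C hC hc
    obtain ⟨x, y, z, hxy, hxz, hyz, rfl⟩ := Finset.card_eq_three.1 hc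
    by_cases h1 : Adj p q x y
    · by_cases h2 : Adj p q x z
      · by_cases h3 : Adj p q y z
        · exact hr.tri (hun x) (hun y) (hun z) h1 h3 h2
        · have e : ({x, y, z} : Finset V) = {y, z, x} := by ext; simp; tauto
          rw [e] at hC
          obtain ⟨S', 𝒞', hb, hs⟩ := h.split hC hyz hxy.symm hxz.symm h3
          exact hmax _ _ hb hs
      · have e : ({x, y, z} : Finset V) = {x, z, y} := by ext; simp; tauto
        rw [e] at hC
        obtain ⟨S', 𝒞', hb, hs⟩ := h.split hC hxz hxy hyz.symm h2
        exact hmax _ _ hb hs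
    · obtain ⟨S', 𝒞', hb, hs⟩ := h.split hC hxy hxz hyz h1
      exact hmax _ _ hb hs
  have h15 : ∀ C ∈ 𝒞, C.card ≠ 1 → 5 ≤ C.card := by
    intro C hC h1
    have h3 := hC3 C hC
    obtain ⟨t, ht⟩ := h.odd C hC
    omega
  set 𝒞1 := 𝒞.filter fun C => C.card = 1 with h𝒞1
  set 𝒞5 := 𝒞.filter fun C => ¬ C.card = 1 with h𝒞5
  have hsplit : 𝒞1.card + 𝒞5.card = 𝒞.card := Finset.card_filter_add_card_filter_not _
  have hpd : (𝒞 : Set (Finset V)).PairwiseDisjoint id := fun C hC D hD hCD => h.dis C hC D hD hCD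
  have hbi : (𝒞.biUnion id).card = ∑ C ∈ 𝒞, C.card := Finset.card_biUnion hpd
  have hdisS : Disjoint S (𝒞.biUnion id) := by
    rw [Finset.disjoint_biUnion_right]; exact fun C hC => (h.dS C hC).symm
  have htot : S.card + ∑ C ∈ 𝒞, C.card ≤ 17 := by
    rw [← hbi, ← Finset.card_union_of_disjoint hdisS]
    exact (Finset.card_le_univ _).trans hcard
  have hsum : ∑ C ∈ 𝒞, C.card = ∑ C ∈ 𝒞1, C.card + ∑ C ∈ 𝒞5, C.card :=
    (Finset.sum_filter_add_sum_filter_not _ _ _).symm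
  have hsum1 : ∑ C ∈ 𝒞1, C.card = 𝒞1.card := by
    rw [Finset.sum_congr rfl (fun C hC => (Finset.mem_filter.1 hC).2), Finset.sum_const, smul_eq_mul, mul_one]
  have hsum5 : 𝒞5.card * 5 ≤ ∑ C ∈ 𝒞5, C.card := by
    rw [← smul_eq_mul]
    apply Finset.card_nsmul_le_sum
    intro C hC
    rw [h𝒞5, Finset.mem_filter] at hC
    exact h15 C hC.1 hC.2
  set Q := 𝒞1.biUnion id with hQ
  have hQc : Q.card = 𝒞1.card := by
    rw [hQ, Finset.card_biUnion (hpd.subset (by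
      intro C hC; exact (Finset.mem_filter.1 hC).1)), ← hsum1]; rfl
  have hQ1 : ∀ x ∈ Q, {x} ∈ 𝒞 := by
    intro x hx
    rw [hQ, Finset.mem_biUnion] at hx
    obtain ⟨C, hC, hxC⟩ := hx
    rw [h𝒞1, Finset.mem_filter] at hC
    obtain ⟨a, rfl⟩ := Finset.card_eq_one.1 hC.2
    simp only [id, Finset.mem_singleton] at hxC
    subst hxC
    exact hC.1
  have hQn : ∀ x ∈ Q, ∀ y, Adj p q x y → y ∈ S := by
    intro x hx y hxy
    rcases h.nbr _ (hQ1 x hx) x (by simp) y hxy with h' | h'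
    · simp only [Finset.mem_singleton] at h'
      exact absurd h'.symm hxy.1
    · exact h'
  have hQ3 : ∀ x ∈ Q, 3 ≤ dg p q S x := by
    intro x hx
    refine (hδ x).trans (Finset.card_le_card ?_)
    intro y hy
    rw [Finset.mem_filter] at hy ⊢
    exact ⟨hQn x hx y hy.2, hy.2⟩
  have hSQ : Disjoint S Q := hdisS.mono_right (Finset.biUnion_subset_biUnion_of_subset_left _
    (Finset.filter_subset _ _))
  have hk3 : 1 ≤ Q.card → 3 ≤ S.card := by
    intro hk
    obtain ⟨x, hx⟩ := Finset.card_pos.1 hk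
    exact (hQ3 x hx).trans (Finset.card_filter_le _ _)
  have hcardB := h.card
  rw [hsum, hsum1] at htot
  by_cases hs0 : S.card = 0
  · -- a component is separated
    have hS0 : S = ∅ := Finset.card_eq_zero.1 hs0
    obtain ⟨C, hC, D, hD, hCD⟩ := Finset.one_lt_card.1 (show 1 < 𝒞.card by omega)
    have hneC : C.Nonempty := Finset.card_pos.1 (h.odd C hC).pos
    have hneD : D.Nonempty := Finset.card_pos.1 (h.odd D hD).pos
    have := hcut C Cᶜ disjoint_compl_right (Finset.union_compl C) hneC (by
      obtain ⟨d, hd⟩ := hneD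
      exact ⟨d, Finset.mem_compl.2 (Finset.disjoint_right.1 (h.dis C hC D hD hCD) hd)⟩)
    have h0 : crs p q C Cᶜ = ∅ := by
      rw [Finset.eq_empty_iff_forall_notMem]
      intro i hi
      rw [mem_crs] at hi
      have key : ∀ a b, a ∈ C → b ∈ Cᶜ → E p q i a b → False := by
        intro a b ha hb hE
        rw [Finset.mem_compl] at hb
        rcases h.nbr C hC a ha b ⟨fun hab => hb (hab ▸ ha), i, hE⟩ with h' | h'
        · exact hb h'
        · rw [hS0] at h'; simp at h'
      rcases hi with ⟨h1, h2⟩ | ⟨h1, h2⟩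
      · exact key _ _ h1 h2 (Or.inl ⟨rfl, rfl⟩)
      · exact key _ _ h2 h1 (Or.inr ⟨rfl, rfl⟩)
    rw [h0] at this
    simp at this
  by_cases hs1 : S.card = 1
  · have hex : ∃ C ∈ 𝒞5, C.card = 5 := by
      by_contra hno
      push Not at hno
      have : 𝒞5.card * 7 ≤ ∑ C ∈ 𝒞5, C.card := by
        rw [← smul_eq_mul]
        apply Finset.card_nsmul_le_sum
        intro C hC
        have h5 := hno C hC
        rw [h𝒞5, Finset.mem_filter] at hC
        have := h15 C hC.1 hC.2
        obtain ⟨t, ht⟩ := h.odd C hC.1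
        omega
      omega
    obtain ⟨C, hC5, hC⟩ := hex
    have hCm := (Finset.mem_filter.1 hC5).1
    have hd := h.dS C hCm
    have f1 := T14 (hrm C) (by omega) (by omega)
    have hcu : (C ∪ S).card = 6 := by rw [Finset.card_union_of_disjoint hd, hC, hs1]
    have f2 := T14 (hrm (C ∪ S)) (by omega) (by omega)
    have hh := hand2 hd (hrm _)
    have hh2 := handshake (hrm C) (Finset.Subset.refl _)
    rw [hh2, dcount p q S C] at hh
    have hlow : C.card • 3 ≤ ∑ x ∈ C, (dg p q C x + dg p q S x) := by
      apply Finset.card_nsmul_le_sum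
      intro x hx
      rw [← dg_union p q hd]
      refine (hδ x).trans (Finset.card_le_card ?_)
      intro y hy
      rw [Finset.mem_filter] at hy ⊢
      exact ⟨Finset.mem_union.2 (h.nbr C hCm x hx y hy.2), hy.2⟩
    rw [Finset.sum_add_distrib, hh2, hC, smul_eq_mul] at hlow
    unfold ff at f1 f2
    rw [hcu] at f2
    rw [hC] at f1
    omega
  by_cases hs2 : S.card = 2
  · omega
  have hs3 : 3 ≤ S.card := by omega
  by_cases hb : 1 ≤ 𝒞5.card
  · have hWc : (S ∪ Q).card = S.card + Q.card := Finset.card_union_of_disjoint hSQ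
    have hT := T13' (hrm (S ∪ Q)) (by omega) (by omega)
    have hf := ff_le hSQ (hrm _) hQ3
    by_cases h2 : ff p q (S ∪ Q) = 2
    · have := K2t_singles (hrm _) (hT.2 h2) (Finset.subset_union_right (s₁ := S) (s₂ := Q))
        (fun x hx => (hQ3 x hx).trans (dg_le p q Finset.subset_union_left x))
      omega
    · have := hT.1
      omega
  by_cases hs7 : S.card = 7
  · have hcc := Finset.card_add_card_compl S
    have hQS : Q ⊆ Sᶜ := fun x hx => Finset.mem_compl.2 (Finset.disjoint_right.1 hSQ hx)
    have hQle := Finset.card_le_card hQS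
    have hind : ∀ x ∈ Sᶜ, ∀ y ∈ Sᶜ, ¬ Adj p q x y := by
      intro x hx y hy hxy
      have nx : x ∉ Q := fun hxQ => Finset.mem_compl.1 hy (hQn x hxQ y hxy)
      have ny : y ∉ Q := fun hyQ => Finset.mem_compl.1 hx (hQn y hyQ x (Adj_symm hxy))
      have : (insert x (insert y Q)) ⊆ Sᶜ := by
        intro t ht
        simp only [Finset.mem_insert] at ht
        rcases ht with rfl | rfl | ht
        · exact hx
        · exact hy
        · exact hQS ht
      have := Finset.card_le_card this
      rw [Finset.card_insert_of_notMem (by simp [hxy.1, nx]), Finset.card_insert_of_notMem ny] at this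
      omega
    refine seven hr (S := S) (Q := Sᶜ) hcut hδ disjoint_compl_right (Finset.union_compl S) hs7
      (by omega) hind ?_
    intro x hx
    refine (hδ x).trans (Finset.card_le_card ?_)
    intro y hy
    rw [Finset.mem_filter] at hy ⊢
    refine ⟨?_, hy.2⟩
    by_contra hyS
    exact hind x hx y (Finset.mem_compl.2 hyS) hy.2
  obtain ⟨Q', hQ', hQ'c⟩ := Finset.exists_subset_card_eq (show S.card + 2 ≤ Q.card by omega)
  have hSQ' : Disjoint S Q' := hSQ.mono_right hQ'
  have hQ3' : ∀ x ∈ Q', 3 ≤ dg p q S x := fun x hx => hQ3 x (hQ' hx)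
  have hWc : (S ∪ Q').card = S.card + Q'.card := Finset.card_union_of_disjoint hSQ'
  have hf := ff_le hSQ' (hrm _) hQ3'
  have hT := T14 (hrm (S ∪ Q')) (by omega) (by omega)
  by_cases hs6 : S.card = 6
  · obtain ⟨a, ha, b, hb, c, hc, d, hd, n1, n2, a1, a2, a3, a4⟩ :=
      get_C4 hQ3' (by rw [hQ'c, hs6]; omega)
    have hC4 : HasC4 p q (S ∪ Q') := hasC4_of (Finset.mem_union_left _ ha)
      (Finset.mem_union_right _ hc) (Finset.mem_union_left _ hb) (Finset.mem_union_right _ hd)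
      n1 n2 (Adj_symm a1) a2 (Adj_symm a4) a3
    have hk := (TC (hrm _) hC4 (fun W hW => T13' (hrm W) (by
      have := Finset.card_lt_card hW; omega)) (fun p' q' U' hr' hc' h3' => T14 hr' (by omega) h3')
      (by omega)).2
    have := K2t_singles (hrm _) hk (Finset.subset_union_right (s₁ := S) (s₂ := Q'))
        (fun x hx => (hQ3' x hx).trans (dg_le p q Finset.subset_union_left x))
    omega
  · omega
end Cat

namespace Cat
variable {V ι : Type} [Fintype V] [Fintype ι]

structure Fam {X : Type} (H : SimpleGraph X) (S : Finset X) (𝒞 : Finset (Finset X)) : Prop where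
  odd : ∀ C ∈ 𝒞, Odd C.card
  dS : ∀ C ∈ 𝒞, Disjoint C S
  dis : ∀ C ∈ 𝒞, ∀ D ∈ 𝒞, C ≠ D → Disjoint C D
  nbr : ∀ C ∈ 𝒞, ∀ x ∈ C, ∀ y, H.Adj x y → y ∈ C ∨ y ∈ S
  card : S.card + 2 ≤ 𝒞.card

lemma fam_of_viol {X : Type} [Fintype X] (H : SimpleGraph X) (hX : Even (Fintype.card X))
    (u : Set X) (hu : H.IsTutteViolator u) : ∃ S 𝒞, Fam H S 𝒞 := by
  unfold SimpleGraph.IsTutteViolator at hu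
  set K := ((⊤ : H.Subgraph).deleteVerts u) with hK
  have hv : ∀ x, x ∈ K.verts ↔ x ∉ u := by intro x; simp [hK]
  have hpar := SimpleGraph.odd_ncard_oddComponents (G := K.coe)
  have hcardK : Nat.card K.verts + u.ncard = Fintype.card X := by
    have e : K.verts = uᶜ := by ext x; rw [hv]; rfl
    rw [Nat.card_coe_set_eq, e, add_comm, Set.ncard_add_ncard_compl, Nat.card_eq_fintype_card]
  let g : K.coe.ConnectedComponent → Finset X := fun c => (Subtype.val '' c.supp).toFinset
  have hgm : ∀ c x, x ∈ g c ↔ ∃ h : x ∈ K.verts, K.coe.connectedComponentMk ⟨x, h⟩ = c := by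
    intro c x
    simp only [g, Set.mem_toFinset, Set.mem_image, Subtype.exists, exists_and_right, exists_eq_right,
      SimpleGraph.ConnectedComponent.mem_supp_iff]
  have hgi : Function.Injective g := by
    intro c d hcd
    obtain ⟨x, hx⟩ := c.nonempty_supp
    have : x.1 ∈ g c := (hgm _ _).2 ⟨x.2, hx⟩
    have h1 := this
    rw [hcd] at this
    obtain ⟨h, h2⟩ := (hgm _ _).1 this
    exact hx.symm.trans h2
  refine ⟨u.toFinset, (K.coe.oddComponents.toFinset).image g, ⟨?_, ?_, ?_, ?_, ?_⟩⟩
  · intro C hC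
    obtain ⟨c, hc, rfl⟩ := Finset.mem_image.1 hC
    rw [Set.mem_toFinset] at hc
    have : (g c).card = c.supp.ncard := by
      rw [← Set.ncard_image_of_injective _ Subtype.val_injective, Set.ncard_eq_toFinset_card']
    rw [this]; exact hc
  · intro C hC
    obtain ⟨c, hc, rfl⟩ := Finset.mem_image.1 hC
    rw [Finset.disjoint_left]
    intro x hx hx2
    obtain ⟨h, -⟩ := (hgm _ _).1 hx
    exact (hv x).1 h (Set.mem_toFinset.1 hx2)
  · intro C hC D hD hCD
    obtain ⟨c, hc, rfl⟩ := Finset.mem_image.1 hC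
    obtain ⟨d, hd, rfl⟩ := Finset.mem_image.1 hD
    rw [Finset.disjoint_left]
    intro x hx hx2
    obtain ⟨h, h1⟩ := (hgm _ _).1 hx
    obtain ⟨h', h2⟩ := (hgm _ _).1 hx2
    exact hCD (by rw [← h1, ← h2])
  · intro C hC x hx y hxy
    obtain ⟨c, hc, rfl⟩ := Finset.mem_image.1 hC
    obtain ⟨h, h1⟩ := (hgm _ _).1 hx
    by_cases hy : y ∈ u
    · exact Or.inr (Set.mem_toFinset.2 hy)
    · left
      have hyK := (hv y).2 hy
      refine (hgm _ _).2 ⟨hyK, ?_⟩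
      rw [← h1]
      apply SimpleGraph.ConnectedComponent.sound
      apply SimpleGraph.Adj.reachable
      rw [SimpleGraph.Subgraph.coe_adj]
      exact SimpleGraph.Subgraph.deleteVerts_adj.2 ⟨trivial, hy, trivial, (hv x).1 h, hxy.symm⟩
  · rw [Finset.card_image_of_injective _ hgi, ← Set.ncard_eq_toFinset_card',
      ← Set.ncard_eq_toFinset_card']
    simp only [Nat.odd_iff, Nat.even_iff] at hpar hX
    generalize Nat.card K.verts = k at *
    generalize K.coe.oddComponents.ncard = o at *
    omega

/-- perfect matching or barrier in a simple graph. -/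
lemma tutte_even {X : Type} [Fintype X] (H : SimpleGraph X) (hX : Even (Fintype.card X)) :
    (∃ f : X → X, ∀ x, H.Adj x (f x) ∧ f (f x) = x) ∨ ∃ S 𝒞, Fam H S 𝒞 := by
  by_cases h : ∃ M : H.Subgraph, M.IsPerfectMatching
  · left
    obtain ⟨M, hM, hs⟩ := h
    choose f hf hf2 using fun x => hM (hs x)
    exact ⟨f, fun x => ⟨(hf x).adj_sub, (hf2 (f x) x (hf x).symm).symm⟩⟩
  · right
    rw [SimpleGraph.tutte] at h
    push Not at h
    obtain ⟨u, hu⟩ := h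
    exact fam_of_viol H hX u hu

/-- add a universal vertex. -/
def cone (H : SimpleGraph V) : SimpleGraph (Option V) where
  Adj a b := match a, b with
    | some x, some y => H.Adj x y
    | none, some _ => True
    | some _, none => True
    | none, none => False
  symm := ⟨by
    rintro (_ | a) (_ | b) h
    · exact h
    · exact h
    · exact h
    · exact SimpleGraph.Adj.symm h⟩
  loopless := ⟨by
    rintro (_ | a) h
    · exact h
    · exact H.loopless.irrefl a h⟩

lemma near_matching (H : SimpleGraph V) :
    (∃ D : Finset V, Fintype.card V ≤ D.card + 1 ∧ ∃ f : V → V, ∀ x ∈ D, f x ∈ D ∧ H.Adj x (f x) ∧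
      f (f x) = x) ∨ ∃ S 𝒞, Fam H S 𝒞 := by
  rcases Nat.even_or_odd (Fintype.card V) with he | ho
  · rcases tutte_even H he with ⟨f, hf⟩ | h
    · left
      exact ⟨Finset.univ, by simp, f, fun x _ => ⟨Finset.mem_univ _, hf x⟩⟩
    · exact Or.inr h
  · have he : Even (Fintype.card (Option V)) := by
      rw [Fintype.card_option]; exact ho.add_one
    rcases tutte_even (cone H) he with ⟨f, hf⟩ | ⟨S, 𝒞, h⟩
    · left
      have hn : f none ≠ none := fun h => (hf none).1.ne h.symm
      obtain ⟨m, hm⟩ := Option.ne_none_iff_exists'.1 hn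
      have hfm : f (some m) = none := by rw [← hm]; exact (hf none).2
      refine ⟨Finset.univ.erase m, by rw [Finset.card_erase_of_mem (Finset.mem_univ _), Finset.card_univ]; omega,
        fun x => (f (some x)).getD m, ?_⟩
      intro x hx
      have hxm := (Finset.mem_erase.1 hx).1
      have hne : f (some x) ≠ none := by
        intro h
        have := (hf (some x)).2
        rw [h, hm] at this
        exact hxm (Option.some.inj this).symm
      obtain ⟨y, hy⟩ := Option.ne_none_iff_exists'.1 hne
      have h1 := hf (some x)
      rw [hy] at h1
      simp only [hy, Option.getD_some]
      refine ⟨Finset.mem_erase.2 ⟨?_, Finset.mem_univ _⟩, h1.1, ?_⟩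
      · rintro rfl
        rw [hfm] at h1
        exact absurd h1.2 (by simp)
      · rw [h1.2]; rfl
    · right
      have hnS : none ∈ S := by
        by_contra hnS
        have hc := h.card
        obtain ⟨C, hC, D, hD, hCD⟩ := Finset.one_lt_card.1 (show 1 < 𝒞.card by omega)
        have key : ∀ C ∈ 𝒞, none ∈ C := by
          intro C hC
          obtain ⟨x, hx⟩ := Finset.card_pos.1 (h.odd C hC).pos
          cases x with
          | none => exact hx
          | some a => exact (h.nbr C hC _ hx none trivial).resolve_right hnS
        exact Finset.disjoint_left.1 (h.dis C hC D hD hCD) (key C hC) (key D hD)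
      let r : Finset (Option V) → Finset V := fun C => Finset.univ.filter fun x => some x ∈ C
      have hr : ∀ C x, x ∈ r C ↔ some x ∈ C := by intro C x; simp [r]
      have hnC : ∀ C ∈ 𝒞, none ∉ C := fun C hC hn => Finset.disjoint_left.1 (h.dS C hC) hn hnS
      have hrc : ∀ C : Finset (Option V), none ∉ C → (r C).card = C.card := by
        intro C hC
        have : C = (r C).map Function.Embedding.some := by
          ext x
          cases x with
          | none => simp [hC]
          | some a => simp [hr]
        conv_rhs => rw [this, Finset.card_map]
      have hri : ∀ C ∈ 𝒞, ∀ D ∈ 𝒞, r C = r D → C = D := by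
        intro C hC D hD hCD
        ext x
        cases x with
        | none => exact ⟨fun hh => absurd hh (hnC C hC), fun hh => absurd hh (hnC D hD)⟩
        | some a => rw [← hr, ← hr, hCD]
      have hSr : (r S).card + 1 = S.card := by
        have e : r S = r (S.erase none) := by ext x; simp [hr]
        rw [e, hrc _ (by simp), Finset.card_erase_add_one hnS]
      refine ⟨r S, 𝒞.image r, ⟨?_, ?_, ?_, ?_, ?_⟩⟩
      · intro C hC
        obtain ⟨C, hC', rfl⟩ := Finset.mem_image.1 hC
        replace hC := hC'
        rw [hrc C (hnC C hC)]; exact h.odd C hC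
      · intro C hC
        obtain ⟨C, hC', rfl⟩ := Finset.mem_image.1 hC
        replace hC := hC'
        rw [Finset.disjoint_left]
        intro x hx hx2
        exact Finset.disjoint_left.1 (h.dS C hC) ((hr _ _).1 hx) ((hr _ _).1 hx2)
      · intro C hC D hD hCD
        obtain ⟨C, hC', rfl⟩ := Finset.mem_image.1 hC
        obtain ⟨D, hD', rfl⟩ := Finset.mem_image.1 hD
        replace hC := hC'
        replace hD := hD'
        rw [Finset.disjoint_left]
        intro x hx hx2
        exact Finset.disjoint_left.1 (h.dis C hC D hD (by rintro rfl; exact hCD rfl)) ((hr _ _).1 hx) ((hr _ _).1 hx2)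
      · intro C hC x hx y hxy
        obtain ⟨C, hC', rfl⟩ := Finset.mem_image.1 hC
        replace hC := hC'
        rw [hr, hr]
        exact h.nbr C hC (some x) ((hr _ _).1 hx) (some y) hxy
      · rw [Finset.card_image_of_injOn (fun C hC D hD => hri C hC D hD)]
        have := h.card
        omega

lemma half_card {H : SimpleGraph V} {D : Finset V} {f : V → V}
    (hf : ∀ x ∈ D, f x ∈ D ∧ H.Adj x (f x) ∧ f (f x) = x) :
    D.card ≤ 2 * (D.image fun x => s(x, f x)).card := by
  refine Finset.card_le_mul_card_image (f := fun x => s(x, f x)) D 2 ?_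
  intro e he
  obtain ⟨a, ha, rfl⟩ := Finset.mem_image.1 he
  refine le_trans (Finset.card_le_card (t := {a, f a}) ?_) Finset.card_le_two
  intro x hx
  rw [Finset.mem_filter] at hx
  have := hx.2
  simp only [Sym2.eq_iff] at this
  simp only [Finset.mem_insert, Finset.mem_singleton]
  tauto
end Cat

namespace Cat
variable {V ι : Type} [Fintype V] [Fintype ι]

lemma degIn_map (p q : ι → V) (hpq : ∀ i, p i ≠ q i) (X : Finset ι) (x : V) :
    ((Multigraph.degIn (X.val.map fun i => s(p i, q i)) x : ℕ) : ZMod 2) = bd p q X x := by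
  unfold Multigraph.degIn bd
  rw [Multiset.filter_map, Multiset.card_map, ← Finset.filter_val, Finset.card_val,
    Finset.card_filter, Nat.cast_sum]
  apply Finset.sum_congr rfl
  intro i _
  have := hpq i
  by_cases h1 : p i = x
  · subst h1
    simp [this.symm]
  · by_cases h2 : q i = x
    · subst h2; simp [this]
    · simp [h1, h2, Ne.symm h1, Ne.symm h2]

lemma red_of {G : Multigraph V} {p q : ι → V}
    (he : Finset.univ.val.map (fun i => s(p i, q i)) = G.edges) (hred : G.Reduced) :
    Red p q Finset.univ := by
  have hpq : ∀ i, p i ≠ q i := by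
    intro i h
    apply G.loopless s(p i, q i)
    · rw [← he]; exact Multiset.mem_map_of_mem _ (Finset.mem_univ i)
    · simpa using h
  intro W _ hc
  by_contra hW
  have hsubE : ∀ X : Finset ι, X ⊆ Ins p q W →
      Multigraph.Within (W : Set V) (X.val.map fun i => s(p i, q i)) := by
    intro X hX e hme v hv
    obtain ⟨i, hi, rfl⟩ := Multiset.mem_map.1 hme
    have := mem_Ins.1 (hX hi)
    rcases Sym2.mem_iff.1 hv with rfl | rfl
    · exact this.1
    · exact this.2
  have hne : (W : Set V).Nonempty := Finset.card_pos.1 (by omega)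
  have := hred (W : Set V) ((Ins p q W).val.map fun i => s(p i, q i)) ⟨?_, hsubE _ (Finset.Subset.refl _)⟩
    ⟨hne, hsubE _ (Finset.Subset.refl _), ?_⟩
  · rw [Set.ncard_coe_finset] at this; exact hW this
  · rw [← he]; exact Multiset.map_le_map (Finset.val_le_iff.2 (Finset.subset_univ _))
  · intro R hR _ hev
    obtain ⟨X, hX, hbd, hcn⟩ := hc (fun x => if x ∈ R then 1 else 0)
      (fun x hx => if_neg fun h => hx (hR h)) (by
        rw [Finset.sum_boole]
        have : (Finset.univ.filter fun x => x ∈ R).card = R.ncard := by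
          rw [Set.ncard_eq_toFinset_card']; congr 1; ext x; simp
        rw [this]
        exact (ZMod.natCast_eq_zero_iff_even).2 hev)
    refine ⟨X.val.map fun i => s(p i, q i), Multiset.map_le_map (Finset.val_le_iff.2 hX),
      ⟨hne, hsubE X hX, ?_⟩, ?_⟩
    · intro u hu v hv
      refine hcn {v | Relation.ReflTransGen
        (fun a b => s(a, b) ∈ X.val.map fun i => s(p i, q i)) u v} ?_ u hu v hv .refl
      intro i hi
      have h1 : s(p i, q i) ∈ X.val.map fun i => s(p i, q i) := Multiset.mem_map_of_mem _ hi
      have h2 := h1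
      rw [Sym2.eq_swap] at h2
      exact ⟨fun h => h.tail h1, fun h => h.tail h2⟩
    · intro x _
      have h1 := degIn_map p q hpq X x
      rw [hbd] at h1
      rw [← ZMod.natCast_eq_one_iff_odd, h1]
      by_cases hx : x ∈ R <;> simp [hx]

lemma cut_of {G : Multigraph V} {p q : ι → V}
    (he : Finset.univ.val.map (fun i => s(p i, q i)) = G.edges) (h3 : G.ThreeEdgeConnected) :
    ∀ A B : Finset V, Disjoint A B → A ∪ B = Finset.univ → A.Nonempty → B.Nonempty →
      3 ≤ (crs p q A B).card := by
  rintro A B hd hU ⟨a, ha⟩ ⟨b, hb⟩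
  by_contra hlt
  have hsum : (crs p q A B).val + (Finset.univ \ crs p q A B).val = (Finset.univ : Finset ι).val := by
    rw [← Finset.disjUnion_val _ _ Finset.disjoint_sdiff, Finset.disjUnion_eq_union]
    rw [Finset.union_sdiff_of_subset (Finset.subset_univ _)]
  have := h3 ((crs p q A B).val.map fun i => s(p i, q i)) (by
    rw [← he]; exact Multiset.map_le_map (Finset.val_le_iff.2 (Finset.subset_univ _))) (by
    rw [Multiset.card_map, Finset.card_val]; omega)
  rw [← he, ← hsum, Multiset.map_add, add_tsub_cancel_left] at this
  have hr := this.2.2 a trivial b trivial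
  have hall : ∀ c, Relation.ReflTransGen (fun a b => s(a, b) ∈
      (Finset.univ \ crs p q A B).val.map fun i => s(p i, q i)) a c → c ∈ A := by
    intro c hc
    induction hc with
    | refl => exact ha
    | tail hxx hstep ih =>
      rename_i x y
      obtain ⟨i, hi, hxy⟩ := Multiset.mem_map.1 hstep
      have hni : i ∉ crs p q A B := (Finset.mem_sdiff.1 hi).2
      rw [mem_crs] at hni
      by_contra hy
      have hyB : y ∈ B := by
        have : y ∈ A ∪ B := by rw [hU]; exact Finset.mem_univ _
        exact (Finset.mem_union.1 this).resolve_left hy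
      rw [Sym2.eq_iff] at hxy
      rcases hxy with ⟨rfl, rfl⟩ | ⟨rfl, rfl⟩
      · exact hni (Or.inl ⟨ih, hyB⟩)
      · exact hni (Or.inr ⟨hyB, ih⟩)
  exact Finset.disjoint_left.1 hd (hall b hr) hb

lemma deg_of {p q : ι → V} (hr : Red p q Finset.univ) (hc : 2 ≤ Fintype.card V)
    (hcut : ∀ A B : Finset V, Disjoint A B → A ∪ B = Finset.univ → A.Nonempty → B.Nonempty →
      3 ≤ (crs p q A B).card) : ∀ x, 3 ≤ dg p q Finset.univ x := by
  intro x
  have h := hcut {x} {x}ᶜ disjoint_compl_right (Finset.union_compl _) ⟨x, by simp⟩ (by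
    apply Finset.card_pos.1
    rw [Finset.card_compl, Finset.card_singleton]; omega)
  refine h.trans ?_
  rw [← inc_card hr (Finset.Subset.refl _) (Finset.mem_univ x)]
  apply Finset.card_le_card
  intro i hi
  rw [mem_crs] at hi
  simp only [Finset.mem_singleton, Finset.mem_compl] at hi
  unfold inc
  rw [Finset.mem_filter, mem_eds]
  refine ⟨⟨Finset.mem_univ _, Finset.mem_univ _, ?_⟩, by tauto⟩
  intro hpq
  rw [hpq] at hi
  tauto

theorem main (G : Multigraph V)
    (h3 : G.ThreeEdgeConnected) (hred : G.Reduced) (hn : Fintype.card V ≤ 17) :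
    ∃ M : Multiset (Sym2 V), M ≤ G.edges ∧ Multigraph.IsMatching M ∧
      ((Fintype.card V : ℝ) - 1) / 2 ≤ (Multiset.card M : ℝ) := by
  by_cases hc : Fintype.card V ≤ 1
  · refine ⟨0, Multiset.zero_le _, ⟨Multiset.nodup_zero, by simp⟩, ?_⟩
    have : (Fintype.card V : ℝ) ≤ 1 := by exact_mod_cast hc
    simp; linarith
  obtain ⟨p, q, he⟩ : ∃ p q : G.edges.ToType → V,
      Finset.univ.val.map (fun i => s(p i, q i)) = G.edges := by
    have : ∀ i : G.edges.ToType, ∃ a b : V, (i.1 : Sym2 V) = s(a, b) := by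
      intro i; induction i.1 using Sym2.ind with
      | _ a b => exact ⟨a, b, rfl⟩
    choose p q h using this
    refine ⟨p, q, ?_⟩
    conv_rhs => rw [← Multiset.map_univ_coe G.edges]
    apply Multiset.map_congr rfl
    intro i _
    exact (h i).symm
  have hr := red_of he hred
  have hcut := cut_of he h3
  have hδ := deg_of hr (by omega) hcut
  let H : SimpleGraph V := { Adj := Adj p q, symm := ⟨fun _ _ h => Adj_symm h⟩, loopless := ⟨fun _ h => h.1 rfl⟩ }
  rcases near_matching H with ⟨D, hD, f, hf⟩ | ⟨S, 𝒞, hF⟩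
  · refine ⟨(D.image fun x => s(x, f x)).val, ?_, ⟨Finset.nodup _, ?_⟩, ?_⟩
    · rw [Multiset.le_iff_subset (Finset.nodup _)]
      intro e hme
      obtain ⟨x, hx, rfl⟩ := Finset.mem_image.1 hme
      obtain ⟨-, i, hi⟩ := (hf x hx).2.1
      rw [← he, Multiset.mem_map]
      refine ⟨i, Finset.mem_univ _, ?_⟩
      rw [Sym2.eq_iff]
      exact hi
    · have key : ∀ e ∈ (D.image fun x => s(x, f x)), ∀ x ∈ e, e = s(x, f x) := by
        intro e hme x hx
        obtain ⟨a, ha, rfl⟩ := Finset.mem_image.1 hme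
        rcases Sym2.mem_iff.1 hx with rfl | rfl
        · rfl
        · rw [(hf a ha).2.2]; exact Sym2.eq_swap
      intro e hme e' hme' hne x hx hx'
      exact hne ((key e hme x hx).trans (key e' hme' x hx').symm)
    · have := half_card hf
      rw [Finset.card_val]
      have h2 : (Fintype.card V : ℝ) ≤ 2 * ((D.image fun x => s(x, f x)).card : ℝ) + 1 := by
        exact_mod_cast (by omega : Fintype.card V ≤ 2 * (D.image fun x => s(x, f x)).card + 1)
      linarith
  · exact (no_bar hr hcut hδ hn _ S 𝒞 rfl ⟨hF.odd, hF.dS, hF.dis, hF.nbr, hF.card⟩).elim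
end Cat

/-- Theorem 3.4. Let `G` be a 3-edge-connected reduced graph of order
`n ≤ 17` which is not supereulerian.  Then `α'(G) ≥ (n − 1)/2`, i.e. `G` has a matching
with at least `(n − 1)/2` edges. -/
theorem statement7 {V : Type} [Fintype V] (G : Multigraph V)
    (h3 : G.ThreeEdgeConnected) (hred : G.Reduced)
    (hns : ¬ G.Supereulerian) (hn : Fintype.card V ≤ 17) :
    ∃ M : Multiset (Sym2 V), M ≤ G.edges ∧ Multigraph.IsMatching M ∧
      ((Fintype.card V : ℝ) - 1) / 2 ≤ (Multiset.card M : ℝ) := by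
  exact Cat.main G h3 hred hn
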